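/- There exists a constant d₃ > 0 such that for every δ > 0 one has ∫₁^T R(t)³ dt = d₃·T^{13/4} + O_δ(T^{45/14+δ}) as T → ∞. (This is the third moment of the remainder term in Weyl's law for the 3-dimensional Heisenberg manifold with the arithmetic metric, and it shows the asymmetric behavior of R(t) about the t-axis.) -/

import Mathlib

open scoped Classical
open Real MeasureTheory

/-- Counting function of the type I (torus) eigenvalues `4π²(m²+n²)`. -/
noncomputable def NT (t : ℝ) : ℝ :=
  Set.ncard {q : ℤ × ℤ | 4 * π ^ 2 * ((q.1 : ℝ) ^ 2 + (q.2 : ℝ) ^ 2) ≤ t}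

/-- Counting function of the type II eigenvalues `2πc(c+2k+1)`, counted with multiplicity `2c`. -/
noncomputable def NH (t : ℝ) : ℝ :=
  ∑' p : ℕ × ℕ,
    if 2 * π * (p.1 + 1 : ℝ) * ((p.1 + 1 : ℝ) + 2 * (p.2 : ℝ) + 1) ≤ t then
      2 * (p.1 + 1 : ℝ) else 0

/-- The Weyl remainder for the 3-dimensional Heisenberg manifold with arithmetic metric. -/
noncomputable def R (t : ℝ) : ℝ :=
  NT t + NH t - (Real.sqrt (2 * π) / (6 * π ^ 2)) * t ^ ((3 : ℝ) / 2)

namespace HeisenbergWeyl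

open Complex (I)

/-- First derivative test: an oscillatory integral with monotone amplitude quotient `w`. -/
theorem norm_integral_osc_le {a b : ℝ} (hab : a ≤ b) {w w' θ θ' : ℝ → ℝ}
    (hw : ∀ x ∈ Set.Icc a b, HasDerivAt w (w' x) x)
    (hθ : ∀ x ∈ Set.Icc a b, HasDerivAt θ (θ' x) x)
    (hwc : ContinuousOn w' (Set.Icc a b)) (hθc : ContinuousOn θ' (Set.Icc a b))
    (hw0 : ∀ x ∈ Set.Icc a b, 0 ≤ w' x) :
    ‖∫ x in a..b, ((w x * θ' x : ℝ) : ℂ) * Complex.exp (I * (θ x : ℂ))‖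
      ≤ |w a| + |w b| + (w b - w a) := by
  have hu : Set.uIcc a b = Set.Icc a b := Set.uIcc_of_le hab
  have hwcont : ContinuousOn w (Set.Icc a b) := fun x hx => (hw x hx).continuousAt.continuousWithinAt
  have hθcont : ContinuousOn θ (Set.Icc a b) := fun x hx => (hθ x hx).continuousAt.continuousWithinAt
  have hE : ContinuousOn (fun x => Complex.exp (I * (θ x : ℂ))) (Set.Icc a b) :=
    Complex.continuous_exp.comp_continuousOn
      (continuousOn_const.mul (Complex.continuous_ofReal.comp_continuousOn hθcont))
  have hd : ∀ x ∈ Set.uIcc a b, HasDerivAt (fun x => (w x : ℂ) * Complex.exp (I * (θ x : ℂ)))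
      ((w' x : ℂ) * Complex.exp (I * (θ x : ℂ)) + I * (((w x * θ' x : ℝ) : ℂ) * Complex.exp (I * (θ x : ℂ)))) x := by
    intro x hx
    rw [hu] at hx
    have h1 := (hw x hx).ofReal_comp
    have h2 := (((hθ x hx).ofReal_comp).const_mul I).cexp
    refine (h1.mul h2).congr_deriv ?_
    push_cast
    ring
  have hi1 : IntervalIntegrable (fun x => (w' x : ℂ) * Complex.exp (I * (θ x : ℂ))) volume a b := by
    apply ContinuousOn.intervalIntegrable
    rw [hu]
    exact (Complex.continuous_ofReal.comp_continuousOn hwc).mul hE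
  have hi2 : IntervalIntegrable (fun x => I * (((w x * θ' x : ℝ) : ℂ) * Complex.exp (I * (θ x : ℂ))))
      volume a b := by
    apply ContinuousOn.intervalIntegrable
    rw [hu]
    exact continuousOn_const.mul
      ((Complex.continuous_ofReal.comp_continuousOn (hwcont.mul hθc)).mul hE)
  have key := intervalIntegral.integral_eq_sub_of_hasDerivAt hd (hi1.add hi2)
  rw [intervalIntegral.integral_add hi1 hi2, intervalIntegral.integral_const_mul] at key
  have hnE : ∀ x, ‖Complex.exp (I * (θ x : ℂ))‖ = 1 := fun x => by
    rw [mul_comm]; exact Complex.norm_exp_ofReal_mul_I _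
  have hw'b : ‖∫ x in a..b, (w' x : ℂ) * Complex.exp (I * (θ x : ℂ))‖ ≤ w b - w a := by
    have h3 : ∫ x in a..b, w' x = w b - w a :=
      intervalIntegral.integral_eq_sub_of_hasDerivAt (fun x hx => hw x (hu ▸ hx))
        (by apply ContinuousOn.intervalIntegrable; rwa [hu])
    rw [← h3]
    apply intervalIntegral.norm_integral_le_of_norm_le hab
    · refine Filter.Eventually.of_forall fun x hx => ?_
      rw [norm_mul, hnE, mul_one, Complex.norm_real, Real.norm_eq_abs,
        abs_of_nonneg (hw0 x ⟨hx.1.le, hx.2⟩)]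
    · apply ContinuousOn.intervalIntegrable; rwa [hu]
  have h4 : I * ∫ x in a..b, ((w x * θ' x : ℝ) : ℂ) * Complex.exp (I * (θ x : ℂ)) =
      (w b : ℂ) * Complex.exp (I * (θ b : ℂ)) - (w a : ℂ) * Complex.exp (I * (θ a : ℂ))
        - ∫ x in a..b, (w' x : ℂ) * Complex.exp (I * (θ x : ℂ)) := by
    rw [← key]; ring
  have h5 : ‖∫ x in a..b, ((w x * θ' x : ℝ) : ℂ) * Complex.exp (I * (θ x : ℂ))‖ =
      ‖I * ∫ x in a..b, ((w x * θ' x : ℝ) : ℂ) * Complex.exp (I * (θ x : ℂ))‖ := by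
    rw [norm_mul, Complex.norm_I, one_mul]
  rw [h5, h4]
  have hb1 : ‖(w b : ℂ) * Complex.exp (I * (θ b : ℂ))‖ = |w b| := by
    rw [norm_mul, hnE, mul_one, Complex.norm_real, Real.norm_eq_abs]
  have ha1 : ‖(w a : ℂ) * Complex.exp (I * (θ a : ℂ))‖ = |w a| := by
    rw [norm_mul, hnE, mul_one, Complex.norm_real, Real.norm_eq_abs]
  calc _ ≤ ‖(w b : ℂ) * Complex.exp (I * (θ b : ℂ))‖ + ‖(w a : ℂ) * Complex.exp (I * (θ a : ℂ))‖
        + ‖∫ x in a..b, (w' x : ℂ) * Complex.exp (I * (θ x : ℂ))‖ :=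
        (norm_sub_le _ _).trans (add_le_add_left (norm_sub_le _ _) _)
    _ ≤ _ := by rw [hb1, ha1]; linarith

theorem norm_cexp_I_mul (t : ℝ) : ‖Complex.exp (I * (t : ℂ))‖ = 1 := by
  rw [mul_comm]; exact Complex.norm_exp_ofReal_mul_I _

theorem norm_damped_fresnel_le {ε a b : ℝ} (hε : 0 ≤ ε) (ha : 0 < a) (hab : a ≤ b) :
    ‖∫ v in a..b, ((Real.exp (-ε * v ^ 2) : ℝ) : ℂ) * Complex.exp (I * ((π * v ^ 2 : ℝ) : ℂ))‖
      ≤ 1 / (π * a) := by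
  have hpi := Real.pi_pos
  have hpos : ∀ x ∈ Set.Icc a b, 0 < x := fun x hx => ha.trans_le hx.1
  set w : ℝ → ℝ := fun v => -(Real.exp (-ε * v ^ 2) / (2 * π * v)) with hwdef
  have h := norm_integral_osc_le hab (w := w)
    (w' := fun v => (2 * ε * v * Real.exp (-ε * v ^ 2) * (2 * π * v)
      + Real.exp (-ε * v ^ 2) * (2 * π)) / (2 * π * v) ^ 2)
    (θ := fun v => π * v ^ 2) (θ' := fun v => 2 * π * v) ?_ ?_ ?_ ?_ ?_
  · have hb : 0 < b := ha.trans_le hab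
    have hwa : w a ≤ 0 := by
      simp only [hwdef]; have : 0 < Real.exp (-ε * a ^ 2) / (2 * π * a) := by positivity
      linarith
    have hwb : w b ≤ 0 := by
      simp only [hwdef]; have : 0 < Real.exp (-ε * b ^ 2) / (2 * π * b) := by positivity
      linarith
    have h1 : ‖∫ v in a..b, ((Real.exp (-ε * v ^ 2) : ℝ) : ℂ)
        * Complex.exp (I * ((π * v ^ 2 : ℝ) : ℂ))‖
        = ‖∫ x in a..b, ((w x * (2 * π * x) : ℝ) : ℂ) * Complex.exp (I * ((π * x ^ 2 : ℝ) : ℂ))‖ := by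
      rw [← norm_neg, ← intervalIntegral.integral_neg]
      congr 1
      apply intervalIntegral.integral_congr
      intro x hx
      rw [Set.uIcc_of_le hab] at hx
      have := hpos x hx
      simp only [hwdef]
      rw [show -(Real.exp (-ε * x ^ 2) / (2 * π * x)) * (2 * π * x) = -Real.exp (-ε * x ^ 2) by
        field_simp]
      push_cast; ring
    rw [h1]
    refine h.trans ?_
    rw [abs_of_nonpos hwa, abs_of_nonpos hwb]
    have h2 : -(2 * w a) ≤ 1 / (π * a) := by
      simp only [hwdef]
      have : Real.exp (-ε * a ^ 2) ≤ 1 := by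
        apply Real.exp_le_one_iff.2; nlinarith [sq_nonneg a]
      have h3 : Real.exp (-ε * a ^ 2) / (2 * π * a) ≤ 1 / (2 * π * a) := by gcongr
      have h4 : 1 / (π * a) = 2 * (1 / (2 * π * a)) := by field_simp
      rw [h4]; linarith
    linarith
  · intro x hx
    have hx0 := hpos x hx
    have h1 : HasDerivAt (fun v : ℝ => Real.exp (-ε * v ^ 2))
        (Real.exp (-ε * x ^ 2) * (-ε * (2 * x))) x := by
      have := ((hasDerivAt_pow 2 x).const_mul (-ε)).exp
      simpa using this
    have h2 : HasDerivAt (fun v : ℝ => 2 * π * v) (2 * π) x := by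
      simpa using (hasDerivAt_id x).const_mul (2 * π)
    refine (h1.div h2 (by positivity)).neg.congr_deriv ?_
    field_simp
    ring
  · intro x hx
    refine ((hasDerivAt_pow 2 x).const_mul π).congr_deriv ?_
    simp; ring
  · refine ContinuousOn.div (by fun_prop) (by fun_prop) ?_
    intro x hx
    have := hpos x hx
    positivity
  · fun_prop
  · intro x hx
    have := hpos x hx
    positivity

theorem norm_fresnel_sub_le {b : ℝ} (hb : 0 < b) :
    ‖(∫ v in (0:ℝ)..b, Complex.exp (I * ((π * v ^ 2 : ℝ) : ℂ)))
      - 1 / 2 * Complex.exp (I * ((π / 4 : ℝ) : ℂ))‖ ≤ 1 / b := by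
  have hpi := Real.pi_pos
  set f : ℝ → ℝ → ℂ := fun ε v =>
    ((Real.exp (-ε * v ^ 2) : ℝ) : ℂ) * Complex.exp (I * ((π * v ^ 2 : ℝ) : ℂ)) with hf
  have hfc : Continuous (Function.uncurry f) := by
    simp only [hf, Function.uncurry_def]; fun_prop
  set G : ℝ → ℂ := fun ε => ((π : ℂ) / ((ε : ℂ) - π * I)) ^ (1 / 2 : ℂ) / 2 with hG
  have hfg : ∀ ε v : ℝ, f ε v = Complex.exp (-((ε : ℂ) - π * I) * (v : ℂ) ^ 2) := by
    intro ε v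
    simp only [hf]
    push_cast
    rw [← Complex.exp_add]; congr 1; ring
  have hb0 : ∀ ε : ℝ, 0 < ε → 0 < ((ε : ℂ) - π * I).re := by
    intro ε hε; simpa using hε
  have hGint : ∀ ε : ℝ, 0 < ε → ∫ v in Set.Ioi (0:ℝ), f ε v = G ε := by
    intro ε hε
    simp_rw [hfg]
    exact integral_gaussian_complex_Ioi (hb0 ε hε)
  have hInt : ∀ ε : ℝ, 0 < ε → IntegrableOn (f ε) (Set.Ioi 0) := by
    intro ε hε
    have := (integrable_cexp_neg_mul_sq (hb0 ε hε)).integrableOn (s := Set.Ioi 0)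
    refine this.congr (Filter.Eventually.of_forall fun v => ?_)
    exact (hfg ε v).symm
  have hbound : ∀ ε : ℝ, 0 < ε → ‖(∫ v in (0:ℝ)..b, f ε v) - G ε‖ ≤ 1 / (π * b) := by
    intro ε hε
    have ht := intervalIntegral_tendsto_integral_Ioi 0 (hInt ε hε) Filter.tendsto_id
    rw [hGint ε hε] at ht
    have ht2 := (tendsto_const_nhds (x := ∫ v in (0:ℝ)..b, f ε v)).sub ht
    refine le_of_tendsto ht2.norm ?_
    filter_upwards [Filter.eventually_ge_atTop b] with B hB
    have hii : ∀ u v : ℝ, IntervalIntegrable (f ε) volume u v := fun u v =>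
      (hfc.comp (by fun_prop : Continuous fun v : ℝ => (ε, v))).intervalIntegrable u v
    rw [id, intervalIntegral.integral_interval_sub_left (hii _ _) (hii _ _),
      intervalIntegral.integral_symm, norm_neg]
    exact norm_damped_fresnel_le hε.le hb hB
  have hlim1 : Filter.Tendsto (fun ε => ∫ v in (0:ℝ)..b, f ε v) (nhdsWithin 0 (Set.Ioi 0))
      (nhds (∫ v in (0:ℝ)..b, f 0 v)) := by
    have := intervalIntegral.continuous_parametric_intervalIntegral_of_continuous' hfc 0 b
      (μ := volume)
    exact (this.tendsto 0).mono_left nhdsWithin_le_nhds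
  have h0 : (π : ℂ) / (((0 : ℝ) : ℂ) - π * I) = I := by
    have : (π : ℂ) ≠ 0 := by exact_mod_cast hpi.ne'
    push_cast
    rw [div_eq_iff (by simp [this])]
    linear_combination (π : ℂ) * Complex.I_mul_I
  have hlim2 : Filter.Tendsto G (nhdsWithin 0 (Set.Ioi 0)) (nhds (G 0)) := by
    have : ContinuousAt G 0 := by
      simp only [hG]
      refine ContinuousAt.div_const (ContinuousAt.cpow ?_ continuousAt_const ?_) 2
      · refine ContinuousAt.div continuousAt_const (by fun_prop) ?_
        have : (π : ℂ) ≠ 0 := by exact_mod_cast hpi.ne'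
        simp [this]
      · rw [h0]; simp [Complex.mem_slitPlane_iff]
    exact this.tendsto.mono_left nhdsWithin_le_nhds
  have hG0 : G 0 = 1 / 2 * Complex.exp (I * ((π / 4 : ℝ) : ℂ)) := by
    simp only [hG]
    rw [h0, Complex.cpow_def_of_ne_zero Complex.I_ne_zero, Complex.log_I]
    push_cast
    rw [show (π : ℂ) / 2 * I * (1 / 2) = I * (π / 4) by ring]
    ring
  have hfin := le_of_tendsto (hlim1.sub hlim2).norm
    (Filter.eventually_of_mem self_mem_nhdsWithin hbound)
  rw [hG0] at hfin
  have hf0 : ∀ v, f 0 v = Complex.exp (I * ((π * v ^ 2 : ℝ) : ℂ)) := by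
    intro v; simp [hf]
  simp_rw [hf0] at hfin
  refine hfin.trans ?_
  apply one_div_le_one_div_of_le hb
  nlinarith [Real.pi_gt_three]

/-- The truncated Fresnel integral `∫₀ᵇ e^{iπv²} dv`. -/
noncomputable def fresnel (b : ℝ) : ℂ :=
  ∫ v in (0:ℝ)..b, Complex.exp (I * ((π * v ^ 2 : ℝ) : ℂ))

theorem integral_fresnel_eq (a b : ℝ) :
    ∫ v in (-a)..b, Complex.exp (I * ((π * v ^ 2 : ℝ) : ℂ)) = fresnel b + fresnel a := by
  have hc : Continuous fun v : ℝ => Complex.exp (I * ((π * v ^ 2 : ℝ) : ℂ)) := by fun_prop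
  have h1 : ∫ v in (-a)..0, Complex.exp (I * ((π * v ^ 2 : ℝ) : ℂ)) = fresnel a := by
    have := intervalIntegral.integral_comp_neg (a := 0) (b := a)
      (fun v : ℝ => Complex.exp (I * ((π * v ^ 2 : ℝ) : ℂ)))
    simp only [neg_zero, neg_sq] at this
    exact this.symm
  rw [← intervalIntegral.integral_add_adjacent_intervals (hc.intervalIntegrable (-a) 0)
    (hc.intervalIntegrable 0 b), h1, add_comm]
  rfl

theorem saddle_fresnel_part {Λ z₀ z₁ : ℝ} (hΛ : 0 < Λ) (h0 : 0 < z₀) (h01 : z₀ ≤ z₁) :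
    ∫ z in z₀..z₁, ((1 + 1 / z ^ 2 : ℝ) : ℂ) *
        Complex.exp (I * ((π * Λ * (z ^ 2 + 1 / z ^ 2) : ℝ) : ℂ))
      = Complex.exp (I * ((2 * π * Λ : ℝ) : ℂ)) * ((1 / √Λ : ℝ) : ℂ) *
        (fresnel (√Λ * (z₁ - 1 / z₁)) + fresnel (√Λ * (1 / z₀ - z₀))) := by
  have hs : √Λ ^ 2 = Λ := Real.sq_sqrt hΛ.le
  have hs0 : 0 < √Λ := Real.sqrt_pos.2 hΛ
  have hpos : ∀ x ∈ Set.uIcc z₀ z₁, 0 < x := fun x hx => by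
    rw [Set.uIcc_of_le h01] at hx; exact h0.trans_le hx.1
  have hsub := intervalIntegral.integral_deriv_smul_comp (a := z₀) (b := z₁)
    (f := fun z : ℝ => √Λ * (z - 1 / z)) (f' := fun z => √Λ * (1 + 1 / z ^ 2))
    (g := fun v : ℝ => Complex.exp (I * ((π * v ^ 2 : ℝ) : ℂ))) ?_ ?_ (by fun_prop)
  · rw [show √Λ * (z₀ - 1 / z₀) = -(√Λ * (1 / z₀ - z₀)) by ring, integral_fresnel_eq] at hsub
    rw [← hsub, ← intervalIntegral.integral_const_mul]
    apply intervalIntegral.integral_congr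
    intro z hz
    have hz0 := hpos z hz
    simp only [Function.comp, Complex.real_smul]
    have e1 : π * Λ * (z ^ 2 + 1 / z ^ 2) = 2 * π * Λ + π * (√Λ * (z - 1 / z)) ^ 2 := by
      rw [mul_pow, hs]; field_simp; ring
    rw [e1, Complex.ofReal_add (2 * π * Λ), mul_add I, Complex.exp_add, Complex.ofReal_mul (√Λ)]
    have e2 : ((1 / √Λ : ℝ) : ℂ) * ((√Λ : ℝ) : ℂ) = 1 := by
      rw [← Complex.ofReal_mul, one_div_mul_cancel hs0.ne', Complex.ofReal_one]
    linear_combination (-((1 + 1 / z ^ 2 : ℝ) : ℂ) * Complex.exp (I * ((2 * π * Λ : ℝ) : ℂ)) *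
      Complex.exp (I * ((π * (√Λ * (z - 1 / z)) ^ 2 : ℝ) : ℂ))) * e2
  · intro z hz
    have hz0 := hpos z hz
    have h1 : HasDerivAt (fun z : ℝ => 1 / z) (-(1 / z ^ 2)) z := by
      simpa [one_div] using hasDerivAt_inv hz0.ne'
    exact (((hasDerivAt_id z).sub h1).const_mul (√Λ)).congr_deriv (by ring)
  · refine ContinuousOn.mul continuousOn_const (ContinuousOn.add continuousOn_const
      (ContinuousOn.div continuousOn_const (by fun_prop) ?_))
    intro z hz
    have := hpos z hz
    positivity

theorem norm_saddle_remainder_le {Λ z₀ z₁ : ℝ} (hΛ : 0 < Λ) (h0 : 0 < z₀) (h01 : z₀ ≤ z₁)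
    (h1 : 1 ≤ z₁) :
    ‖∫ z in z₀..z₁, ((2 * z ^ 3 - (1 + 1 / z ^ 2) : ℝ) : ℂ) *
        Complex.exp (I * ((π * Λ * (z ^ 2 + 1 / z ^ 2) : ℝ) : ℂ))‖ ≤ 2 * z₁ ^ 2 / (π * Λ) := by
  have hpi := Real.pi_pos
  have hpos : ∀ x ∈ Set.Icc z₀ z₁, 0 < x := fun x hx => h0.trans_le hx.1
  set w : ℝ → ℝ := fun z => (2 * z ^ 5 + 2 * z ^ 4 + 2 * z ^ 3 + z ^ 2 + z) /
    (z ^ 3 + z ^ 2 + z + 1) / (2 * π * Λ) with hw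
  have h := norm_integral_osc_le h01 (w := w)
    (w' := fun z => (4 * z ^ 7 + 8 * z ^ 6 + 12 * z ^ 5 + 17 * z ^ 4 + 10 * z ^ 3 + 6 * z ^ 2
      + 2 * z + 1) / (z ^ 3 + z ^ 2 + z + 1) ^ 2 / (2 * π * Λ))
    (θ := fun z => π * Λ * (z ^ 2 + 1 / z ^ 2))
    (θ' := fun z => π * Λ * (2 * z - 2 / z ^ 3)) ?_ ?_ ?_ ?_ ?_
  · have e : ∀ z ∈ Set.uIcc z₀ z₁, ((w z * (π * Λ * (2 * z - 2 / z ^ 3)) : ℝ) : ℂ) *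
        Complex.exp (I * ((π * Λ * (z ^ 2 + 1 / z ^ 2) : ℝ) : ℂ)) =
        ((2 * z ^ 3 - (1 + 1 / z ^ 2) : ℝ) : ℂ) *
        Complex.exp (I * ((π * Λ * (z ^ 2 + 1 / z ^ 2) : ℝ) : ℂ)) := by
      intro z hz
      rw [Set.uIcc_of_le h01] at hz
      have hz0 := hpos z hz
      congr 2
      simp only [hw]
      have : z ^ 3 + z ^ 2 + z + 1 ≠ 0 := by positivity
      field_simp
      ring
    rw [← intervalIntegral.integral_congr e]
    refine h.trans ?_
    have hz1 : 0 < z₁ := by linarith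
    have w0 : 0 ≤ w z₀ := by simp only [hw]; positivity
    have w1 : 0 ≤ w z₁ := by simp only [hw]; positivity
    rw [abs_of_nonneg w0, abs_of_nonneg w1]
    have : w z₁ ≤ z₁ ^ 2 / (π * Λ) := by
      simp only [hw]
      rw [div_div, div_le_div_iff₀ (by positivity) (by positivity)]
      have : (2 * z₁ ^ 5 + 2 * z₁ ^ 4 + 2 * z₁ ^ 3 + z₁ ^ 2 + z₁) ≤
          z₁ ^ 2 * ((z₁ ^ 3 + z₁ ^ 2 + z₁ + 1) * 2) := by nlinarith
      calc _ ≤ z₁ ^ 2 * ((z₁ ^ 3 + z₁ ^ 2 + z₁ + 1) * 2) * (π * Λ) := by gcongr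
        _ = _ := by ring
    have e3 : 2 * z₁ ^ 2 / (π * Λ) = 2 * (z₁ ^ 2 / (π * Λ)) := by ring
    rw [e3]; linarith
  · intro z hz
    have hz0 := hpos z hz
    have hD : z ^ 3 + z ^ 2 + z + 1 ≠ 0 := by positivity
    have d1 : HasDerivAt (fun z : ℝ => 2 * z ^ 5 + 2 * z ^ 4 + 2 * z ^ 3 + z ^ 2 + z)
        (10 * z ^ 4 + 8 * z ^ 3 + 6 * z ^ 2 + 2 * z + 1) z := by
      refine ((((((hasDerivAt_pow 5 z).const_mul 2).add ((hasDerivAt_pow 4 z).const_mul 2)).add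
        ((hasDerivAt_pow 3 z).const_mul 2)).add (hasDerivAt_pow 2 z)).add
        (hasDerivAt_id z)).congr_deriv ?_
      push_cast; ring
    have d2 : HasDerivAt (fun z : ℝ => z ^ 3 + z ^ 2 + z + 1) (3 * z ^ 2 + 2 * z + 1) z := by
      refine ((((hasDerivAt_pow 3 z).add (hasDerivAt_pow 2 z)).add (hasDerivAt_id z)).add_const
        1).congr_deriv ?_
      push_cast; ring
    refine ((d1.div d2 hD).div_const (2 * π * Λ)).congr_deriv ?_
    congr 2
    ring
  · intro z hz
    have hz0 := hpos z hz
    have d1 : HasDerivAt (fun z : ℝ => 1 / z ^ 2) (-(2 / z ^ 3)) z := by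
      refine ((hasDerivAt_const z (1:ℝ)).div (hasDerivAt_pow 2 z) (by positivity)).congr_deriv ?_
      field_simp; ring
    refine (((hasDerivAt_pow 2 z).add d1).const_mul (π * Λ)).congr_deriv ?_
    push_cast; ring
  · refine ContinuousOn.div_const (ContinuousOn.div (by fun_prop) (by fun_prop) ?_) _
    intro z hz
    have := hpos z hz
    positivity
  · refine ContinuousOn.mul continuousOn_const (ContinuousOn.sub (by fun_prop)
      (ContinuousOn.div continuousOn_const (by fun_prop) ?_))
    intro z hz
    have := hpos z hz
    positivity
  · intro z hz
    have := hpos z hz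
    positivity

/-- The integrand `u e^{iπ(p/u+qu)}`. -/
noncomputable def saddleFun (p q u : ℝ) : ℂ :=
  (u : ℂ) * Complex.exp (I * ((π * (p / u + q * u) : ℝ) : ℂ))

/-- The oscillatory integral `∫₀¹ u e^{iπ(p/u+qu)} du`. -/
noncomputable def saddleInt (p q : ℝ) : ℂ := ∫ u in (0:ℝ)..1, saddleFun p q u

/-- The contribution of the stationary point of `saddleInt`. -/
noncomputable def saddleMain (p q : ℝ) : ℂ :=
  ((p ^ (3 / 4 : ℝ) * q ^ (-(5 / 4) : ℝ) : ℝ) : ℂ) *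
    Complex.exp (I * ((2 * π * √(p * q) + π / 4 : ℝ) : ℂ))

theorem norm_saddleFun (p q u : ℝ) : ‖saddleFun p q u‖ = |u| := by
  rw [saddleFun, norm_mul, norm_cexp_I_mul, mul_one, Complex.norm_real, Real.norm_eq_abs]

theorem measurable_saddleFun (p q : ℝ) : Measurable (saddleFun p q) := by
  unfold saddleFun
  fun_prop

theorem intervalIntegrable_saddleFun (p q a b : ℝ) :
    IntervalIntegrable (saddleFun p q) volume a b := by
  have h : IntervalIntegrable (fun u : ℝ => u) volume a b := continuous_id.intervalIntegrable a b
  refine h.mono_fun (measurable_saddleFun p q).aestronglyMeasurable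
    (Filter.Eventually.of_forall fun u => ?_)
  simp [norm_saddleFun]

theorem norm_integral_saddleFun_le (p q : ℝ) {a : ℝ} (ha : 0 ≤ a) :
    ‖∫ u in (0:ℝ)..a, saddleFun p q u‖ ≤ a ^ 2 / 2 := by
  have : ∫ u in (0:ℝ)..a, u = a ^ 2 / 2 := by rw [integral_id]; ring
  rw [← this]
  apply intervalIntegral.norm_integral_le_of_norm_le ha
  · refine Filter.Eventually.of_forall fun u hu => ?_
    rw [norm_saddleFun, abs_of_pos hu.1]
  · exact continuous_id.intervalIntegrable _ _

theorem saddleInt_sub (p q a : ℝ) :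
    saddleInt p q - ∫ u in a..1, saddleFun p q u = ∫ u in (0:ℝ)..a, saddleFun p q u := by
  rw [saddleInt, sub_eq_iff_eq_add]
  exact (intervalIntegral.integral_add_adjacent_intervals
    (intervalIntegrable_saddleFun _ _ _ _) (intervalIntegrable_saddleFun _ _ _ _)).symm

/-- Bounds for the truncated integrals that are uniform pass to the full integral. -/
theorem norm_saddleInt_sub_le_of_forall {p q B : ℝ} {m : ℂ} {a g : ℝ → ℝ}
    (ha : Filter.Tendsto a (nhdsWithin 0 (Set.Ioi 0)) (nhds 0))
    (hg : Filter.Tendsto g (nhdsWithin 0 (Set.Ioi 0)) (nhds 0))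
    (ha0 : ∀ z, 0 < z → 0 ≤ a z)
    (h : ∀ z, 0 < z → z < 1 → ‖(∫ u in (a z)..1, saddleFun p q u) - m‖ ≤ B + g z) :
    ‖saddleInt p q - m‖ ≤ B := by
  have hl : Filter.Tendsto (fun z => a z ^ 2 / 2 + (B + g z)) (nhdsWithin 0 (Set.Ioi 0))
      (nhds (0 ^ 2 / 2 + (B + 0))) :=
    ((ha.pow 2).div_const 2).add (tendsto_const_nhds.add hg)
  simp only [ne_eq, OfNat.ofNat_ne_zero, not_false_eq_true, zero_pow, zero_div, add_zero,
    zero_add] at hl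
  refine ge_of_tendsto hl ?_
  have h1 : ∀ᶠ z : ℝ in nhdsWithin 0 (Set.Ioi 0), z < 1 :=
    nhdsWithin_le_nhds (Iio_mem_nhds one_pos)
  filter_upwards [h1, self_mem_nhdsWithin] with z hz hz0
  have e : saddleInt p q - m = (∫ u in (0:ℝ)..(a z), saddleFun p q u) +
      ((∫ u in (a z)..1, saddleFun p q u) - m) := by
    rw [← saddleInt_sub]; ring
  rw [e]
  exact (norm_add_le _ _).trans (add_le_add (norm_integral_saddleFun_le p q (ha0 z hz0)) (h z hz0 hz))

theorem norm_saddleInt_le_of_lt {p q : ℝ} (hp : 0 < p) (hqp : q < p) :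
    ‖saddleInt p q‖ ≤ 1 / (p - q) := by
  have hpi := Real.pi_pos
  rw [← sub_zero (saddleInt p q)]
  refine norm_saddleInt_sub_le_of_forall (a := fun z => z) (g := fun _ => 0)
    (Filter.tendsto_id.mono_left nhdsWithin_le_nhds) tendsto_const_nhds (fun z hz => hz.le) ?_
  intro z hz hz1
  rw [sub_zero, add_zero]
  have hpos : ∀ x ∈ Set.Icc z 1, 0 < x := fun x hx => hz.trans_le hx.1
  have hden : ∀ x ∈ Set.Icc z 1, 0 < p - q * x ^ 2 := fun x hx => by
    have h0 := hpos x hx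
    have : x ^ 2 ≤ 1 := pow_le_one₀ h0.le hx.2
    rcases le_or_gt q 0 with h | h
    · nlinarith [sq_nonneg x]
    · nlinarith
  set w : ℝ → ℝ := fun u => u ^ 3 / (p - q * u ^ 2) / π with hw
  have h := norm_integral_osc_le hz1.le (w := w)
    (w' := fun u => (3 * u ^ 2 * (p - q * u ^ 2) + 2 * q * u ^ 4) / (p - q * u ^ 2) ^ 2 / π)
    (θ := fun u => π * (p / u + q * u)) (θ' := fun u => π * (q - p / u ^ 2)) ?_ ?_ ?_ ?_ ?_
  · have e : ∀ u ∈ Set.uIcc z 1, ((w u * (π * (q - p / u ^ 2)) : ℝ) : ℂ) *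
        Complex.exp (I * ((π * (p / u + q * u) : ℝ) : ℂ)) = - saddleFun p q u := by
      intro u hu
      rw [Set.uIcc_of_le hz1.le] at hu
      have h0 := hpos u hu
      have hd := hden u hu
      have : w u * (π * (q - p / u ^ 2)) = -u := by
        simp only [hw]
        have e1 : q - p / u ^ 2 = -(p - q * u ^ 2) / u ^ 2 := by field_simp; ring
        rw [e1]
        generalize p - q * u ^ 2 = D at hd
        field_simp
      rw [this, saddleFun]; push_cast; ring
    rw [intervalIntegral.integral_congr e, intervalIntegral.integral_neg, norm_neg] at h
    refine h.trans ?_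
    have w0 : 0 ≤ w z := by
      have := hden z ⟨le_rfl, hz1.le⟩
      simp only [hw]; positivity
    have w1 : w 1 = 1 / (p - q) / π := by simp [hw]
    have hpq : 0 < p - q := by linarith
    have w1' : 0 ≤ w 1 := by rw [w1]; positivity
    rw [abs_of_nonneg w0, abs_of_nonneg w1']
    have : 2 * w 1 ≤ 1 / (p - q) := by
      rw [w1, ← mul_div_assoc, div_le_iff₀ hpi, mul_comm 2]
      have : (2 : ℝ) ≤ π := by linarith [Real.pi_gt_three]
      gcongr
    linarith
  · intro u hu
    have hd := hden u hu
    have d2 : HasDerivAt (fun u : ℝ => p - q * u ^ 2) (-(q * (2 * u))) u := by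
      refine (((hasDerivAt_pow 2 u).const_mul q).const_sub p).congr_deriv ?_
      push_cast; ring
    refine (((hasDerivAt_pow 3 u).div d2 hd.ne').div_const π).congr_deriv ?_
    congr 2
    push_cast; ring
  · intro u hu
    have h0 := hpos u hu
    have d1 : HasDerivAt (fun u : ℝ => p / u) (-(p / u ^ 2)) u := by
      refine ((hasDerivAt_const u p).div (hasDerivAt_id u) h0.ne').congr_deriv ?_
      simp; ring
    refine ((d1.add ((hasDerivAt_id u).const_mul q)).const_mul π).congr_deriv ?_
    ring
  · refine ContinuousOn.div_const (ContinuousOn.div (by fun_prop) (by fun_prop) ?_) _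
    intro u hu
    have := hden u hu
    positivity
  · refine ContinuousOn.mul continuousOn_const (ContinuousOn.sub (by fun_prop)
      (ContinuousOn.div continuousOn_const (by fun_prop) ?_))
    intro u hu
    have := hpos u hu
    positivity
  · intro u hu
    have h0 := hpos u hu
    have hd := hden u hu
    have : 0 ≤ 3 * u ^ 2 * (p - q * u ^ 2) + 2 * q * u ^ 4 := by
      have e : 3 * u ^ 2 * (p - q * u ^ 2) + 2 * q * u ^ 4
        = u ^ 2 * (2 * p + (p - q * u ^ 2)) := by ring
      rw [e]; positivity
    positivity

theorem integral_saddleFun_eq {q z₀ z₁ : ℝ} (hq : 0 < q) (h0 : 0 < z₀) (h01 : z₀ ≤ z₁) :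
    ∫ u in (1 / z₁ ^ 2 * z₀ ^ 2)..1, saddleFun (q / z₁ ^ 4) q u
      = ((1 / z₁ ^ 4 : ℝ) : ℂ) * ∫ z in z₀..z₁, ((2 * z ^ 3 : ℝ) : ℂ) *
        Complex.exp (I * ((π * (q / z₁ ^ 2) * (z ^ 2 + 1 / z ^ 2) : ℝ) : ℂ)) := by
  have hz1 : 0 < z₁ := h0.trans_le h01
  have hpos : ∀ x ∈ Set.uIcc z₀ z₁, 0 < x := fun x hx => by
    rw [Set.uIcc_of_le h01] at hx; exact h0.trans_le hx.1
  have hsub := intervalIntegral.integral_deriv_smul_comp' (a := z₀) (b := z₁)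
    (f := fun z : ℝ => 1 / z₁ ^ 2 * z ^ 2) (f' := fun z => 1 / z₁ ^ 2 * (2 * z))
    (g := saddleFun (q / z₁ ^ 4) q) ?_ (by fun_prop) ?_
  · rw [show 1 / z₁ ^ 2 * z₁ ^ 2 = 1 by field_simp] at hsub
    rw [← hsub, ← intervalIntegral.integral_const_mul]
    apply intervalIntegral.integral_congr
    intro z hz
    have hz0 := hpos z hz
    simp only [Function.comp, Complex.real_smul, saddleFun]
    rw [show π * (q / z₁ ^ 4 / (1 / z₁ ^ 2 * z ^ 2) + q * (1 / z₁ ^ 2 * z ^ 2)) =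
      π * (q / z₁ ^ 2) * (z ^ 2 + 1 / z ^ 2) by field_simp; ring]
    rw [← mul_assoc ((1 / z₁ ^ 2 * (2 * z) : ℝ) : ℂ), ← mul_assoc ((1 / z₁ ^ 4 : ℝ) : ℂ),
      ← Complex.ofReal_mul, ← Complex.ofReal_mul]
    congr 2
    field_simp
  · intro z hz
    exact ((hasDerivAt_pow 2 z).const_mul (1 / z₁ ^ 2)).congr_deriv (by push_cast; ring)
  · unfold saddleFun
    refine ContinuousOn.mul (by fun_prop) (Complex.continuous_exp.comp_continuousOn
      (continuousOn_const.mul (Complex.continuous_ofReal.comp_continuousOn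
      (continuousOn_const.mul ((continuousOn_const.div continuousOn_id ?_).add (by fun_prop))))))
    rintro u ⟨z, hz, rfl⟩
    have := hpos z hz
    simp only [id]
    positivity

theorem norm_saddleInt_sub_fresnel_le {q z₁ : ℝ} (hq : 0 < q) (h1 : 1 ≤ z₁) :
    ‖saddleInt (q / z₁ ^ 4) q - ((1 / z₁ ^ 4 : ℝ) : ℂ) *
      (Complex.exp (I * ((2 * π * (q / z₁ ^ 2) : ℝ) : ℂ)) * ((1 / √(q / z₁ ^ 2) : ℝ) : ℂ) *
        (fresnel (√(q / z₁ ^ 2) * (z₁ - 1 / z₁)) + 1 / 2 * Complex.exp (I * ((π / 4 : ℝ) : ℂ))))‖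
      ≤ 1 / q := by
  have hpi := Real.pi_pos
  have hz1 : 0 < z₁ := by linarith
  set Λ := q / z₁ ^ 2 with hΛd
  have hΛ : 0 < Λ := by positivity
  have hs0 : 0 < √Λ := Real.sqrt_pos.2 hΛ
  refine norm_saddleInt_sub_le_of_forall (a := fun z => 1 / z₁ ^ 2 * z ^ 2)
    (g := fun z => 1 / z₁ ^ 4 * (1 / √Λ) * (1 / √Λ * (z / (1 - z ^ 2)))) ?_ ?_
    (fun z hz => by positivity) ?_
  · have : Continuous fun z : ℝ => 1 / z₁ ^ 2 * z ^ 2 := by fun_prop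
    have := (this.tendsto 0).mono_left (nhdsWithin_le_nhds (s := Set.Ioi 0))
    simpa using this
  · have : ContinuousAt (fun z : ℝ => 1 / z₁ ^ 4 * (1 / √Λ) * (1 / √Λ * (z / (1 - z ^ 2)))) 0 := by
      refine continuousAt_const.mul (continuousAt_const.mul (ContinuousAt.div (by fun_prop)
        (by fun_prop) (by norm_num)))
    have := this.tendsto.mono_left (nhdsWithin_le_nhds (s := Set.Ioi 0))
    simpa using this
  · intro z hz hz1'
    have hzz : z ≤ z₁ := by linarith
    have hpos : ∀ x ∈ Set.uIcc z z₁, 0 < x := fun x hx => by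
      rw [Set.uIcc_of_le hzz] at hx; exact hz.trans_le hx.1
    rw [integral_saddleFun_eq hq hz hzz]
    have hexpc : ContinuousOn (fun z : ℝ =>
        Complex.exp (I * ((π * Λ * (z ^ 2 + 1 / z ^ 2) : ℝ) : ℂ))) (Set.uIcc z z₁) := by
      refine Complex.continuous_exp.comp_continuousOn
        (continuousOn_const.mul (Complex.continuous_ofReal.comp_continuousOn
        (continuousOn_const.mul (ContinuousOn.add (by fun_prop) (continuousOn_const.div
          (by fun_prop) ?_)))))
      intro x hx; have := hpos x hx; positivity
    have hac : ContinuousOn (fun z : ℝ => 1 + 1 / z ^ 2) (Set.uIcc z z₁) := by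
      refine continuousOn_const.add (continuousOn_const.div (by fun_prop) ?_)
      intro x hx; have := hpos x hx; positivity
    have hsplit : ∫ t in z..z₁, ((2 * t ^ 3 : ℝ) : ℂ) *
          Complex.exp (I * ((π * Λ * (t ^ 2 + 1 / t ^ 2) : ℝ) : ℂ)) =
        (∫ t in z..z₁, ((2 * t ^ 3 - (1 + 1 / t ^ 2) : ℝ) : ℂ) *
          Complex.exp (I * ((π * Λ * (t ^ 2 + 1 / t ^ 2) : ℝ) : ℂ))) +
        ∫ t in z..z₁, ((1 + 1 / t ^ 2 : ℝ) : ℂ) *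
          Complex.exp (I * ((π * Λ * (t ^ 2 + 1 / t ^ 2) : ℝ) : ℂ)) := by
      rw [← intervalIntegral.integral_add]
      · congr 1; ext t; push_cast; ring
      · refine (ContinuousOn.mul (Complex.continuous_ofReal.comp_continuousOn
          (ContinuousOn.sub (by fun_prop) hac)) hexpc).intervalIntegrable
      · exact (ContinuousOn.mul (Complex.continuous_ofReal.comp_continuousOn hac)
          hexpc).intervalIntegrable
    rw [hsplit, saddle_fresnel_part hΛ hz hzz]
    have hrem := norm_saddle_remainder_le hΛ hz hzz h1
    set A := ∫ t in z..z₁, ((2 * t ^ 3 - (1 + 1 / t ^ 2) : ℝ) : ℂ) *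
          Complex.exp (I * ((π * Λ * (t ^ 2 + 1 / t ^ 2) : ℝ) : ℂ))
    have hv : 0 < 1 / z - z := by
      rw [sub_pos, lt_div_iff₀ hz]; nlinarith
    have hfr := norm_fresnel_sub_le (mul_pos hs0 hv)
    change ‖fresnel (√Λ * (1 / z - z)) - _‖ ≤ _ at hfr
    set E := Complex.exp (I * ((2 * π * Λ : ℝ) : ℂ)) with hE
    have hnE : ‖E‖ = 1 := norm_cexp_I_mul _
    set F₁ := fresnel (√Λ * (z₁ - 1 / z₁))
    set F₀ := fresnel (√Λ * (1 / z - z))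
    have e : ((1 / z₁ ^ 4 : ℝ) : ℂ) * (A + E * ((1 / √Λ : ℝ) : ℂ) * (F₁ + F₀)) -
        ((1 / z₁ ^ 4 : ℝ) : ℂ) * (E * ((1 / √Λ : ℝ) : ℂ) *
          (F₁ + 1 / 2 * Complex.exp (I * ((π / 4 : ℝ) : ℂ)))) =
        ((1 / z₁ ^ 4 : ℝ) : ℂ) * A + ((1 / z₁ ^ 4 : ℝ) : ℂ) * (E * ((1 / √Λ : ℝ) : ℂ) *
          (F₀ - 1 / 2 * Complex.exp (I * ((π / 4 : ℝ) : ℂ)))) := by ring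
    rw [e]
    refine (norm_add_le _ _).trans (add_le_add ?_ ?_)
    · rw [norm_mul, Complex.norm_real, Real.norm_of_nonneg (by positivity)]
      calc 1 / z₁ ^ 4 * ‖A‖ ≤ 1 / z₁ ^ 4 * (2 * z₁ ^ 2 / (π * Λ)) := by gcongr
        _ = 2 / π * (1 / q) := by rw [hΛd]; field_simp
        _ ≤ 1 * (1 / q) := by
          gcongr; rw [div_le_one hpi]; linarith [Real.pi_gt_three]
        _ = 1 / q := one_mul _
    · rw [norm_mul, norm_mul, norm_mul, hnE, Complex.norm_real, Complex.norm_real,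
        Real.norm_of_nonneg (by positivity), Real.norm_of_nonneg (by positivity), one_mul, mul_assoc]
      gcongr
      refine hfr.trans (le_of_eq ?_)
      have : 1 - z ^ 2 ≠ 0 := by nlinarith
      have : 1 / z - z = (1 - z ^ 2) / z := by field_simp
      rw [this]; field_simp

theorem saddleMain_eq {q z₁ : ℝ} (hq : 0 < q) (hz1 : 0 < z₁) :
    saddleMain (q / z₁ ^ 4) q = ((1 / z₁ ^ 4 : ℝ) : ℂ) *
      (Complex.exp (I * ((2 * π * (q / z₁ ^ 2) : ℝ) : ℂ)) * ((1 / √(q / z₁ ^ 2) : ℝ) : ℂ) *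
        Complex.exp (I * ((π / 4 : ℝ) : ℂ))) := by
  have e1 : √(q / z₁ ^ 4 * q) = q / z₁ ^ 2 := by
    rw [show q / z₁ ^ 4 * q = (q / z₁ ^ 2) ^ 2 by field_simp, Real.sqrt_sq (by positivity)]
  have e2 : (q / z₁ ^ 4) ^ (3 / 4 : ℝ) * q ^ (-(5 / 4) : ℝ) = 1 / z₁ ^ 4 * (1 / √(q / z₁ ^ 2)) := by
    rw [Real.div_rpow hq.le (by positivity), ← Real.rpow_natCast, ← Real.rpow_mul hz1.le,
      Real.sqrt_div' _ (by positivity), Real.sqrt_sq hz1.le, Real.sqrt_eq_rpow]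
    rw [show ((4 : ℕ) : ℝ) * (3 / 4) = ((3 : ℕ) : ℝ) by norm_num, Real.rpow_natCast,
      div_mul_eq_mul_div, ← Real.rpow_add hq, show (3 / 4 : ℝ) + -(5 / 4) = -(1 / 2) by norm_num,
      Real.rpow_neg hq.le]
    have : 0 < q ^ (1 / 2 : ℝ) := by positivity
    rw [Real.rpow_natCast]
    field_simp
  rw [saddleMain, e1, e2, Complex.ofReal_add, mul_add, Complex.exp_add, Complex.ofReal_mul]
  ring

theorem norm_saddleInt_sub_main_le {p q : ℝ} (hp : 0 < p) (hpq : p < q) :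
    ‖saddleInt p q - saddleMain p q‖ ≤ 3 / (q - p) := by
  have hq : 0 < q := hp.trans hpq
  obtain ⟨z₁, hz, hpz⟩ : ∃ z₁ : ℝ, 1 < z₁ ∧ p = q / z₁ ^ 4 := by
    refine ⟨(q / p) ^ (1 / 4 : ℝ), Real.one_lt_rpow ((one_lt_div hp).2 hpq) (by norm_num), ?_⟩
    rw [← Real.rpow_natCast, ← Real.rpow_mul (by positivity)]
    norm_num
    field_simp
  have hz1 : 0 < z₁ := by linarith
  have h := norm_saddleInt_sub_fresnel_le hq hz.le
  rw [← hpz] at h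
  have hm := saddleMain_eq hq hz1
  rw [← hpz] at hm
  set Λ := q / z₁ ^ 2 with hΛd
  have hΛ : 0 < Λ := by positivity
  have hs0 : 0 < √Λ := Real.sqrt_pos.2 hΛ
  have hv : 0 < z₁ - 1 / z₁ := by
    rw [sub_pos, div_lt_iff₀ hz1]; nlinarith
  have hfr := norm_fresnel_sub_le (mul_pos hs0 hv)
  change ‖fresnel (√Λ * (z₁ - 1 / z₁)) - _‖ ≤ _ at hfr
  set E := Complex.exp (I * ((2 * π * Λ : ℝ) : ℂ)) with hE
  have hnE : ‖E‖ = 1 := norm_cexp_I_mul _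
  set F₁ := fresnel (√Λ * (z₁ - 1 / z₁))
  set e4 := Complex.exp (I * ((π / 4 : ℝ) : ℂ))
  set Y := ((1 / z₁ ^ 4 : ℝ) : ℂ) * (E * ((1 / √Λ : ℝ) : ℂ) * (F₁ + 1 / 2 * e4)) with hY
  have e : saddleInt p q - saddleMain p q = (saddleInt p q - Y) +
      ((1 / z₁ ^ 4 : ℝ) : ℂ) * (E * ((1 / √Λ : ℝ) : ℂ) * (F₁ - 1 / 2 * e4)) := by
    rw [hm, hY]; ring
  rw [e]
  have hqp : 0 < q - p := by linarith
  have b1 : 1 / q ≤ 1 / (q - p) := one_div_le_one_div_of_le hqp (by linarith)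
  have b2 : ‖((1 / z₁ ^ 4 : ℝ) : ℂ) * (E * ((1 / √Λ : ℝ) : ℂ) * (F₁ - 1 / 2 * e4))‖
      ≤ 2 / (q - p) := by
    rw [norm_mul, norm_mul, norm_mul, hnE, Complex.norm_real, Complex.norm_real,
      Real.norm_of_nonneg (by positivity), Real.norm_of_nonneg (by positivity), one_mul]
    calc 1 / z₁ ^ 4 * (1 / √Λ * ‖F₁ - 1 / 2 * e4‖)
        ≤ 1 / z₁ ^ 4 * (1 / √Λ * (1 / (√Λ * (z₁ - 1 / z₁)))) := by gcongr
      _ = 1 / (q * z₁ * (z₁ ^ 2 - 1)) := by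
        have h1 : z₁ - 1 / z₁ = (z₁ ^ 2 - 1) / z₁ := by field_simp
        have h2 : √Λ * √Λ = Λ := Real.mul_self_sqrt hΛ.le
        have h3 : z₁ ^ 2 - 1 ≠ 0 := by nlinarith
        rw [one_div_mul_one_div, ← mul_assoc, h2, h1, hΛd]
        field_simp
      _ ≤ 2 / (q - p) := by
        have h3 : 0 < z₁ ^ 2 - 1 := by nlinarith
        rw [div_le_div_iff₀ (by positivity) hqp]
        have h4 : q - p = q * (z₁ ^ 2 - 1) * ((z₁ ^ 2 + 1) / z₁ ^ 4) := by
          rw [hpz]; field_simp; ring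
        have h5 : (z₁ ^ 2 + 1) / z₁ ^ 4 ≤ 2 * z₁ := by
          rw [div_le_iff₀ (by positivity)]
          have : 1 ≤ z₁ ^ 2 := by nlinarith
          have h6 : 1 ≤ z₁ ^ 3 := one_le_pow₀ hz.le
          nlinarith
        rw [h4]
        calc 1 * (q * (z₁ ^ 2 - 1) * ((z₁ ^ 2 + 1) / z₁ ^ 4))
            ≤ 1 * (q * (z₁ ^ 2 - 1) * (2 * z₁)) := by gcongr
          _ = _ := by ring
  calc _ ≤ 1 / q + 2 / (q - p) := (norm_add_le _ _).trans (add_le_add h b2)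
    _ ≤ 1 / (q - p) + 2 / (q - p) := by gcongr
    _ = _ := by ring

theorem norm_saddleInt_sub_half_main_le {p : ℝ} (hp : 0 < p) :
    ‖saddleInt p p - 1 / 2 * saddleMain p p‖ ≤ 1 / p := by
  have h := norm_saddleInt_sub_fresnel_le hp le_rfl
  have hm := saddleMain_eq hp one_pos
  have f0 : fresnel 0 = 0 := by simp [fresnel]
  simp only [one_pow, div_one, sub_self, mul_zero, f0, zero_add] at h hm
  rw [hm]
  convert h using 2
  ring

/-- The centred sawtooth function. -/
noncomputable def saw (u : ℝ) : ℝ := Int.fract u - 1 / 2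

/-- The truncated Fourier series of the sawtooth. -/
noncomputable def sawTrunc (K : ℕ) (u : ℝ) : ℝ :=
  -(∑ k ∈ Finset.range K, Real.sin (2 * π * (k + 1) * u) / (π * (k + 1)))

/-- The error of the truncated Fourier series of the sawtooth. -/
noncomputable def sawErr (K : ℕ) (u : ℝ) : ℝ := saw u - sawTrunc K u

theorem measurable_saw : Measurable saw := by unfold saw; fun_prop

theorem continuous_sawTrunc (K : ℕ) : Continuous (sawTrunc K) := by
  unfold sawTrunc; fun_prop

theorem measurable_sawErr (K : ℕ) : Measurable (sawErr K) :=
  measurable_saw.sub (continuous_sawTrunc K).measurable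

theorem abs_saw_le (u : ℝ) : |saw u| ≤ 1 / 2 := by
  have := Int.fract_nonneg u
  have := Int.fract_lt_one u
  rw [saw, abs_le]; constructor <;> linarith

theorem sum_inv_le_log (K : ℕ) : ∑ k ∈ Finset.range K, (1 : ℝ) / (k + 1) ≤ 1 + Real.log K := by
  have h := harmonic_le_one_add_log K
  have e : ((harmonic K : ℚ) : ℝ) = ∑ k ∈ Finset.range K, (1 : ℝ) / (k + 1) := by
    rw [harmonic]; push_cast; simp
  rwa [e] at h

theorem abs_sawTrunc_le (K : ℕ) (u : ℝ) : |sawTrunc K u| ≤ 1 + Real.log K := by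
  rw [sawTrunc, abs_neg]
  refine (Finset.abs_sum_le_sum_abs _ _).trans (le_trans ?_ (sum_inv_le_log K))
  apply Finset.sum_le_sum
  intro k _
  rw [abs_div, abs_of_pos (by positivity : 0 < π * ((k : ℝ) + 1))]
  apply div_le_div₀ zero_le_one (Real.abs_sin_le_one _) (by positivity)
  nlinarith [Real.pi_gt_three, (Nat.cast_nonneg k : (0:ℝ) ≤ k)]

theorem log_natCast_nonneg (K : ℕ) : 0 ≤ Real.log K := by
  rcases Nat.eq_zero_or_pos K with h | h
  · simp [h]
  · exact Real.log_nonneg (by exact_mod_cast h)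

theorem abs_sawErr_le (K : ℕ) (u : ℝ) : |sawErr K u| ≤ 2 + Real.log K := by
  have h1 := abs_saw_le u
  have h2 := abs_sawTrunc_le K u
  have := abs_sub (saw u) (sawTrunc K u)
  rw [sawErr]; linarith

theorem saw_periodic : Function.Periodic saw 1 := by
  intro u; simp [saw]

theorem sawErr_periodic (K : ℕ) : Function.Periodic (sawErr K) 1 := by
  intro u
  have : sawTrunc K (u + 1) = sawTrunc K u := by
    unfold sawTrunc
    congr 1
    apply Finset.sum_congr rfl
    intro k _
    have : 2 * π * ((k : ℝ) + 1) * (u + 1) = 2 * π * (k + 1) * u + ((k + 1 : ℕ) : ℤ) * (2 * π) := by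
      push_cast; ring
    rw [this, Real.sin_add_int_mul_two_pi]
  rw [sawErr, sawErr, this, saw_periodic u]

theorem intervalIntegrable_of_bdd {f : ℝ → ℝ} {B : ℝ} (hf : Measurable f) (hB : ∀ x, |f x| ≤ B)
    (a b : ℝ) : IntervalIntegrable f volume a b := by
  have h : IntervalIntegrable (fun _ : ℝ => B) volume a b := intervalIntegrable_const
  refine h.mono_fun hf.aestronglyMeasurable (Filter.Eventually.of_forall fun x => ?_)
  simp only [Real.norm_eq_abs]
  exact (hB x).trans (le_abs_self B)

theorem intervalIntegrable_sawErr_sq (K : ℕ) (a b : ℝ) :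
    IntervalIntegrable (fun u => sawErr K u ^ 2) volume a b := by
  refine intervalIntegrable_of_bdd ((measurable_sawErr K).pow_const 2)
    (B := (2 + Real.log K) ^ 2) (fun x => ?_) a b
  rw [abs_pow]
  exact pow_le_pow_left₀ (abs_nonneg _) (abs_sawErr_le K x) 2

theorem integral_cos_two_pi {m : ℤ} (hm : m ≠ 0) :
    ∫ u in (0:ℝ)..1, Real.cos (2 * π * m * u) = 0 := by
  have h : (2 * π * m : ℝ) ≠ 0 := by
    have : (m : ℝ) ≠ 0 := by exact_mod_cast hm
    have := Real.pi_pos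
    positivity
  rw [intervalIntegral.integral_comp_mul_left (fun v => Real.cos v) h, integral_cos]
  have : 2 * π * (m : ℝ) * 1 = ((m * 2 : ℤ) : ℝ) * π := by push_cast; ring
  rw [this, Real.sin_int_mul_pi]; simp

theorem integral_sin_mul_sin {j k : ℕ} :
    ∫ u in (0:ℝ)..1, Real.sin (2 * π * (j + 1) * u) * Real.sin (2 * π * (k + 1) * u)
      = if j = k then 1 / 2 else 0 := by
  have e : ∀ u : ℝ, Real.sin (2 * π * (j + 1) * u) * Real.sin (2 * π * (k + 1) * u) =
      1 / 2 * Real.cos (2 * π * ((j - k : ℤ) : ℝ) * u)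
        - 1 / 2 * Real.cos (2 * π * ((j + k + 2 : ℤ) : ℝ) * u) := by
    intro u
    have h1 : 2 * π * ((j - k : ℤ) : ℝ) * u = 2 * π * (j + 1) * u - 2 * π * (k + 1) * u := by
      push_cast; ring
    have h2 : 2 * π * ((j + k + 2 : ℤ) : ℝ) * u = 2 * π * (j + 1) * u + 2 * π * (k + 1) * u := by
      push_cast; ring
    rw [h1, h2, Real.cos_sub, Real.cos_add]; ring
  simp_rw [e]
  rw [intervalIntegral.integral_sub (Continuous.intervalIntegrable (by fun_prop) _ _)
    (Continuous.intervalIntegrable (by fun_prop) _ _), intervalIntegral.integral_const_mul,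
    intervalIntegral.integral_const_mul, integral_cos_two_pi (m := (j + k + 2 : ℤ)) (by omega)]
  split_ifs with h
  · subst h; simp
  · rw [integral_cos_two_pi (by omega)]; simp

theorem integral_saw_congr {F : ℝ → ℝ → ℝ} :
    ∫ u in (0:ℝ)..1, F (saw u) u = ∫ u in (0:ℝ)..1, F (u - 1 / 2) u := by
  apply intervalIntegral.integral_congr_Ioo_of_le zero_le_one
  intro u hu
  have : Int.fract u = u := Int.fract_eq_self.2 ⟨hu.1.le, hu.2⟩
  simp [saw, this]

theorem integral_saw_mul_sin (k : ℕ) :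
    ∫ u in (0:ℝ)..1, saw u * Real.sin (2 * π * (k + 1) * u) = -(1 / (2 * π * (k + 1))) := by
  rw [integral_saw_congr (F := fun s u => s * Real.sin (2 * π * (k + 1) * u))]
  set c : ℝ := 2 * π * (k + 1) with hc
  have hc0 : 0 < c := by positivity
  have hd : ∀ u ∈ Set.uIcc (0:ℝ) 1, HasDerivAt
      (fun u => -((u - 1 / 2) * Real.cos (c * u)) / c + Real.sin (c * u) / c ^ 2)
      ((u - 1 / 2) * Real.sin (c * u)) u := by
    intro u _
    have h0 : HasDerivAt (fun u : ℝ => c * u) c u := by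
      simpa using (hasDerivAt_id u).const_mul c
    have h1 := h0.cos
    have h2 := h0.sin
    have h3 : HasDerivAt (fun u : ℝ => u - 1 / 2) 1 u := (hasDerivAt_id u).sub_const _
    refine (((h3.mul h1).neg.div_const c).add (h2.div_const (c ^ 2))).congr_deriv ?_
    field_simp; ring
  rw [intervalIntegral.integral_eq_sub_of_hasDerivAt hd
    (Continuous.intervalIntegrable (by fun_prop) _ _)]
  have e1 : c * 1 = ((k + 1 : ℕ) : ℝ) * (2 * π) := by rw [hc]; push_cast; ring
  rw [e1, Real.cos_nat_mul_two_pi]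
  have : Real.sin (((k + 1 : ℕ) : ℝ) * (2 * π)) = 0 := by
    simpa using Real.sin_nat_mul_two_pi_sub 0 (k + 1)
  rw [this]
  simp; ring

theorem integral_sawErr_sq (K : ℕ) :
    ∫ u in (0:ℝ)..1, sawErr K u ^ 2 =
      1 / 12 - 1 / (2 * π ^ 2) * ∑ k ∈ Finset.range K, 1 / ((k : ℝ) + 1) ^ 2 := by
  induction K with
  | zero =>
    have : ∀ u, sawErr 0 u = saw u := fun u => by simp [sawErr, sawTrunc]
    simp_rw [this]
    rw [integral_saw_congr (F := fun s u => s ^ 2),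
      intervalIntegral.integral_comp_sub_right (fun v => v ^ 2), integral_pow]
    norm_num
  | succ K ih =>
    set s : ℝ → ℝ := fun u => Real.sin (2 * π * (K + 1) * u) with hs
    have hsc : Continuous s := by simp only [hs]; fun_prop
    have e : ∀ u, sawErr (K + 1) u = sawErr K u + s u / (π * (K + 1)) := by
      intro u
      simp only [sawErr, sawTrunc, Finset.sum_range_succ, hs]; ring
    have hsb : ∀ u, |s u| ≤ 1 := fun u => Real.abs_sin_le_one _
    have hsaws : IntervalIntegrable (fun u => saw u * s u) volume 0 1 :=
      intervalIntegrable_of_bdd (measurable_saw.mul hsc.measurable) (B := 1 / 2 * 1) (fun u => by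
        rw [Pi.mul_apply, abs_mul]; exact mul_le_mul (abs_saw_le u) (hsb u) (abs_nonneg _) (by norm_num)) _ _
    have hcross : ∫ u in (0:ℝ)..1, sawErr K u * s u = -(1 / (2 * π * (K + 1))) := by
      have e2 : ∀ u, sawErr K u * s u = saw u * s u + ∑ k ∈ Finset.range K,
          (1 / (π * (k + 1))) * (Real.sin (2 * π * (k + 1) * u) * s u) := by
        intro u
        simp only [sawErr, sawTrunc, sub_neg_eq_add, add_mul, Finset.sum_mul]
        congr 1
        apply Finset.sum_congr rfl
        intro k _; ring
      simp_rw [e2]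
      rw [intervalIntegral.integral_add hsaws (Continuous.intervalIntegrable (by fun_prop) _ _),
        integral_saw_mul_sin, intervalIntegral.integral_finsetSum
        (fun k _ => Continuous.intervalIntegrable (by fun_prop) _ _)]
      rw [Finset.sum_eq_zero, add_zero]
      intro k hk
      rw [intervalIntegral.integral_const_mul, integral_sin_mul_sin, if_neg
        (Finset.mem_range.1 hk).ne, mul_zero]
    have hcrossI : IntervalIntegrable (fun u => sawErr K u * s u) volume 0 1 :=
      intervalIntegrable_of_bdd ((measurable_sawErr K).mul hsc.measurable)
        (B := (2 + Real.log K) * 1) (fun u => by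
        rw [Pi.mul_apply, abs_mul]
        exact mul_le_mul (abs_sawErr_le K u) (hsb u) (abs_nonneg _)
          (by linarith [log_natCast_nonneg K])) _ _
    have e3 : ∀ u, sawErr (K + 1) u ^ 2 = sawErr K u ^ 2 +
        ((2 / (π * (K + 1))) * (sawErr K u * s u) + (1 / (π * (K + 1)) ^ 2) * (s u * s u)) := by
      intro u; rw [e]; generalize π * ((K : ℝ) + 1) = D; ring
    simp_rw [e3]
    rw [intervalIntegral.integral_add (intervalIntegrable_sawErr_sq K 0 1)
      ((hcrossI.const_mul _).add (Continuous.intervalIntegrable (by fun_prop) _ _)), ih,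
      intervalIntegral.integral_add (hcrossI.const_mul _)
      (Continuous.intervalIntegrable (by fun_prop) _ _), intervalIntegral.integral_const_mul,
      intervalIntegral.integral_const_mul, hcross, integral_sin_mul_sin, if_pos rfl,
      Finset.sum_range_succ]
    have := Real.pi_pos
    have : (K : ℝ) + 1 ≠ 0 := by positivity
    field_simp
    ring

theorem integral_sawErr_sq_le {K : ℕ} (hK : 0 < K) :
    ∫ u in (0:ℝ)..1, sawErr K u ^ 2 ≤ 1 / K := by
  have hK' : (0 : ℝ) < K := by exact_mod_cast hK
  rw [integral_sawErr_sq]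
  have hz : HasSum (fun k : ℕ => 1 / ((k : ℝ) + 1) ^ 2) (π ^ 2 / 6) := by
    have := (hasSum_nat_add_iff' 1).2 hasSum_zeta_two
    simpa using this
  have ht : π ^ 2 / 6 ≤ ∑ k ∈ Finset.range K, 1 / ((k : ℝ) + 1) ^ 2 + 1 / K := by
    refine hz.tsum_eq ▸ hz.summable.tsum_le_of_sum_range_le fun n => ?_
    have key : ∀ m : ℕ, ∑ k ∈ Finset.range (K + m), 1 / ((k : ℝ) + 1) ^ 2 ≤
        ∑ k ∈ Finset.range K, 1 / ((k : ℝ) + 1) ^ 2 + (1 / K - 1 / ((K : ℝ) + m)) := by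
      intro m
      induction m with
      | zero => simp
      | succ m ih =>
        rw [← add_assoc, Finset.sum_range_succ]
        have h1 : 1 / (((K + m : ℕ) : ℝ) + 1) ^ 2 ≤
            1 / ((K : ℝ) + m) - 1 / ((K : ℝ) + ((m + 1 : ℕ) : ℝ)) := by
          push_cast
          rw [div_sub_div _ _ (by positivity) (by positivity),
            div_le_div_iff₀ (by positivity) (by positivity)]
          have : (0 : ℝ) ≤ m := Nat.cast_nonneg m
          nlinarith
        linarith
    have hmono : ∑ k ∈ Finset.range n, 1 / ((k : ℝ) + 1) ^ 2 ≤
        ∑ k ∈ Finset.range (K + n), 1 / ((k : ℝ) + 1) ^ 2 :=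
      Finset.sum_le_sum_of_subset_of_nonneg (Finset.range_mono (by omega))
        (fun _ _ _ => by positivity)
    have : 0 ≤ 1 / ((K : ℝ) + n) := by positivity
    linarith [key n]
  have hpi : 1 ≤ 2 * π ^ 2 := by nlinarith [Real.pi_gt_three]
  have h2 : 1 / (2 * π ^ 2) * (π ^ 2 / 6) = 1 / 12 := by
    have := Real.pi_pos
    field_simp; norm_num
  have h3 : 1 / (2 * π ^ 2) * (π ^ 2 / 6) ≤
      1 / (2 * π ^ 2) * (∑ k ∈ Finset.range K, 1 / ((k : ℝ) + 1) ^ 2 + 1 / K) := by gcongr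
  have h4 : 1 / (2 * π ^ 2) * (1 / (K : ℝ)) ≤ 1 * (1 / K) := by
    gcongr; rw [div_le_one (by positivity)]; exact hpi
  rw [mul_add] at h3
  linarith

theorem integral_sawErr_sq_interval_le {K : ℕ} (hK : 0 < K) {a b : ℝ} (hab : a ≤ b) :
    ∫ u in a..b, sawErr K u ^ 2 ≤ (b - a + 1) / K := by
  have hK' : (0 : ℝ) < K := by exact_mod_cast hK
  set n := ⌈b - a⌉₊
  have hn : b ≤ a + n := by have := Nat.le_ceil (b - a); linarith
  have hn' : (n : ℝ) ≤ b - a + 1 := (Nat.ceil_lt_add_one (by linarith)).le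
  have hper : Function.Periodic (fun u => sawErr K u ^ 2) 1 := fun u => by
    simp only [sawErr_periodic K u]
  have h1 : ∫ u in a..b, sawErr K u ^ 2 ≤ ∫ u in a..(a + n), sawErr K u ^ 2 := by
    apply intervalIntegral.integral_mono_interval le_rfl hab hn
    · exact Filter.Eventually.of_forall fun u => sq_nonneg _
    · exact intervalIntegrable_sawErr_sq K _ _
  have h2 := hper.intervalIntegral_add_zsmul_eq n a
  simp only [zsmul_eq_mul, mul_one, Int.cast_natCast] at h2
  rw [h2 fun _ _ => intervalIntegrable_sawErr_sq K _ _] at h1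
  have h3 := hper.intervalIntegral_add_eq 0 a
  rw [zero_add] at h3
  refine h1.trans ?_
  have h4 := integral_sawErr_sq_le hK
  have h5 : (n : ℝ) * (1 / K) ≤ (b - a + 1) * (1 / K) := by gcongr
  calc _ ≤ (n : ℝ) * (1 / K) := by gcongr; exact h3 ▸ h4
    _ ≤ _ := by rw [← mul_one_div (b - a + 1)]; exact h5

theorem sum_cexp_Icc (K : ℕ) (t : ℝ) :
    ∑ ρ ∈ Finset.Icc (-(K : ℤ)) K, Complex.exp (I * ((2 * π * ρ * t : ℝ) : ℂ)) =
      ((1 + ∑ k ∈ Finset.range K, 2 * Real.cos (2 * π * (k + 1) * t) : ℝ) : ℂ) := by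
  induction K with
  | zero => simp
  | succ K ih =>
    have e : Finset.Icc (-((K + 1 : ℕ) : ℤ)) ((K + 1 : ℕ) : ℤ) =
        insert ((K : ℤ) + 1) (insert (-((K : ℤ) + 1)) (Finset.Icc (-(K : ℤ)) K)) := by
      ext x; simp only [Finset.mem_insert, Finset.mem_Icc]; push_cast; omega
    rw [e, Finset.sum_insert, Finset.sum_insert, ih, Finset.sum_range_succ]
    · have h2 : ((2 * Real.cos (2 * π * (K + 1) * t) : ℝ) : ℂ) =
          Complex.exp (I * ((2 * π * (K + 1) * t : ℝ) : ℂ)) +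
          Complex.exp (-(I * ((2 * π * (K + 1) * t : ℝ) : ℂ))) := by
        push_cast
        rw [Complex.cos]
        ring_nf
      rw [← add_assoc 1, Complex.ofReal_add _ (2 * Real.cos _), h2]
      push_cast
      have e3 : I * (2 * (π : ℂ) * -((K : ℂ) + 1) * t) = -(I * (2 * π * ((K : ℂ) + 1) * t)) := by
        ring
      rw [e3]
      ring
    · simp
    · simp only [Finset.mem_insert, Finset.mem_Icc]; omega

/-- Truncated Poisson summation with the sawtooth truncation error made explicit. -/
theorem sum_sub_poisson_eq {g g' : ℝ → ℂ} {a b : ℝ} (ha : 0 ≤ a) (hab : a ≤ b)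
    (hg : ∀ t ∈ Set.Icc a b, HasDerivAt g (g' t) t) (hg' : ContinuousOn g' (Set.Icc a b)) (K : ℕ) :
    ∑ c ∈ Finset.Ioc ⌊a⌋₊ ⌊b⌋₊, g c - ∑ ρ ∈ Finset.Icc (-(K : ℤ)) K,
        ∫ t in a..b, g t * Complex.exp (I * ((2 * π * ρ * t : ℝ) : ℂ)) =
      g a * ((sawErr K a : ℝ) : ℂ) - g b * ((sawErr K b : ℝ) : ℂ) +
        ∫ t in a..b, g' t * ((sawErr K t : ℝ) : ℂ) := by
  have hu : Set.uIcc a b = Set.Icc a b := Set.uIcc_of_le hab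
  have hgc : ContinuousOn g (Set.Icc a b) := fun x hx => (hg x hx).continuousAt.continuousWithinAt
  set S : ℝ → ℝ := fun t => t + 1 / 2 - sawTrunc K t with hS
  set D : ℝ → ℝ := fun t => 1 + ∑ k ∈ Finset.range K, 2 * Real.cos (2 * π * (k + 1) * t) with hD
  have hDc : Continuous D := by simp only [hD]; fun_prop
  have hSc : Continuous S := by
    have := continuous_sawTrunc K
    simp only [hS]; fun_prop
  have hSd : ∀ t, HasDerivAt S (D t) t := by
    intro t
    have h1 : HasDerivAt (fun t => ∑ k ∈ Finset.range K,
        Real.sin (2 * π * (k + 1) * t) / (π * (k + 1)))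
        (∑ k ∈ Finset.range K, 2 * Real.cos (2 * π * (k + 1) * t)) t := by
      apply HasDerivAt.fun_sum
      intro k _
      have h0 : HasDerivAt (fun u : ℝ => 2 * π * (k + 1) * u) (2 * π * (k + 1)) t := by
        simpa using (hasDerivAt_id t).const_mul (2 * π * ((k : ℝ) + 1))
      refine (h0.sin.div_const (π * (k + 1))).congr_deriv ?_
      have : (k : ℝ) + 1 ≠ 0 := by positivity
      field_simp
    refine (((hasDerivAt_id t).add_const (1 / 2)).sub h1.neg).congr_deriv ?_
    simp [hD]
  have hfl : ∀ t : ℝ, 0 ≤ t → ((⌊t⌋₊ : ℝ) + 1) = S t - sawErr K t := by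
    intro t ht
    have h1 := Int.self_sub_fract t
    have h2 : ((⌊t⌋₊ : ℕ) : ℝ) = (⌊t⌋ : ℝ) := by
      rw [← natCast_floor_eq_intCast_floor ht]
    simp only [hS, sawErr, saw]
    rw [h2, ← h1]; ring
  have hab' := sum_mul_eq_sub_sub_integral_mul (fun _ => (1 : ℂ)) (f := g) ha hab
    (fun t ht => (hg t ht).differentiableAt) ?_
  · simp only [mul_one, Finset.sum_const, Nat.card_Icc, Nat.sub_zero, nsmul_eq_mul] at hab'
    rw [← intervalIntegral.integral_of_le hab] at hab'
    have e1 : ∀ t : ℝ, 0 ≤ t → (((⌊t⌋₊ + 1 : ℕ) : ℂ)) = ((S t : ℝ) : ℂ) - ((sawErr K t : ℝ) : ℂ) := by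
      intro t ht
      rw [← Complex.ofReal_sub, ← hfl t ht]; push_cast; rfl
    have hi1 : IntervalIntegrable (fun t => g' t * ((S t : ℝ) : ℂ)) volume a b := by
      apply ContinuousOn.intervalIntegrable; rw [hu]
      exact hg'.mul (by fun_prop)
    have hi2 : IntervalIntegrable (fun t => g' t * ((sawErr K t : ℝ) : ℂ)) volume a b := by
      have h0 : IntervalIntegrable g' volume a b := by
        apply ContinuousOn.intervalIntegrable; rwa [hu]
      have h1 := h0.norm.const_mul (2 + Real.log K)
      refine h1.mono_fun ((h0.aestronglyMeasurable_restrict_uIoc).mul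
        (Complex.measurable_ofReal.comp (measurable_sawErr K)).aestronglyMeasurable)
        (Filter.Eventually.of_forall fun t => ?_)
      beta_reduce
      rw [norm_mul, Real.norm_of_nonneg (by have := log_natCast_nonneg K; positivity),
        Complex.norm_real, Real.norm_eq_abs, mul_comm]
      gcongr
      exact abs_sawErr_le K t
    have e2 : ∫ t in a..b, deriv g t * ((⌊t⌋₊ + 1 : ℕ) : ℂ) =
        (∫ t in a..b, g' t * ((S t : ℝ) : ℂ)) - ∫ t in a..b, g' t * ((sawErr K t : ℝ) : ℂ) := by
      rw [← intervalIntegral.integral_sub hi1 hi2]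
      apply intervalIntegral.integral_congr
      intro t ht
      rw [hu] at ht
      simp only
      rw [(hg t ht).deriv, e1 t (ha.trans ht.1)]; ring
    have hparts := intervalIntegral.integral_deriv_mul_eq_sub (u := g) (v := fun t => ((S t : ℝ) : ℂ))
      (u' := g') (v' := fun t => ((D t : ℝ) : ℂ)) (a := a) (b := b)
      (fun t ht => hg t (hu ▸ ht)) (fun t _ => (hSd t).ofReal_comp)
      (by apply ContinuousOn.intervalIntegrable; rwa [hu])
      (Continuous.intervalIntegrable (by fun_prop) _ _)
    have hi3 : IntervalIntegrable (fun t => g t * ((D t : ℝ) : ℂ)) volume a b := by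
      apply ContinuousOn.intervalIntegrable; rw [hu]
      exact hgc.mul (by fun_prop)
    rw [intervalIntegral.integral_add hi1 hi3] at hparts
    have e3 : ∑ ρ ∈ Finset.Icc (-(K : ℤ)) K,
        ∫ t in a..b, g t * Complex.exp (I * ((2 * π * ρ * t : ℝ) : ℂ)) =
        ∫ t in a..b, g t * ((D t : ℝ) : ℂ) := by
      rw [← intervalIntegral.integral_finsetSum]
      · congr 1; ext t
        rw [← Finset.mul_sum, sum_cexp_Icc]
      · intro ρ _
        apply ContinuousOn.intervalIntegrable; rw [hu]
        exact hgc.mul (by fun_prop)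
    rw [hab', e2, e1 a ha, e1 b (ha.trans hab), e3]
    linear_combination -hparts
  · refine ContinuousOn.integrableOn_Icc (hg'.congr fun t ht => (hg t ht).deriv)

theorem norm_sum_sub_poisson_le {g g' : ℝ → ℂ} {a b G : ℝ} (ha : 0 ≤ a) (hab : a ≤ b)
    (hg : ∀ t ∈ Set.Icc a b, HasDerivAt g (g' t) t) (hg' : ContinuousOn g' (Set.Icc a b))
    (hG : ∀ t ∈ Set.Icc a b, ‖g' t‖ ≤ G) {N : ℕ} (hN : 0 < N) :
    ‖∑ c ∈ Finset.Ioc ⌊a⌋₊ ⌊b⌋₊, g c - ∑ ρ ∈ Finset.Icc (-((N ^ 2 : ℕ) : ℤ)) (N ^ 2 : ℕ),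
        ∫ t in a..b, g t * Complex.exp (I * ((2 * π * ρ * t : ℝ) : ℂ))‖ ≤
      ‖g a‖ * |sawErr (N ^ 2) a| + ‖g b‖ * |sawErr (N ^ 2) b| + G * ((b - a + 1) / N) := by
  have hN' : (0 : ℝ) < N := by exact_mod_cast hN
  have hu : Set.uIcc a b = Set.Icc a b := Set.uIcc_of_le hab
  have hG0 : 0 ≤ G := (norm_nonneg _).trans (hG a ⟨le_rfl, hab⟩)
  rw [sum_sub_poisson_eq ha hab hg hg']
  refine (norm_add_le _ _).trans (add_le_add ((norm_sub_le _ _).trans (le_of_eq ?_)) ?_)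
  · rw [norm_mul, norm_mul, Complex.norm_real, Complex.norm_real, Real.norm_eq_abs, Real.norm_eq_abs]
  · have hsq := intervalIntegrable_sawErr_sq (N ^ 2) a b
    have hbnd : ∀ t ∈ Set.Ioc a b, ‖g' t * ((sawErr (N ^ 2) t : ℝ) : ℂ)‖ ≤
        G * (1 / 2 * (N * sawErr (N ^ 2) t ^ 2 + 1 / N)) := by
      intro t ht
      rw [norm_mul, Complex.norm_real, Real.norm_eq_abs]
      have h1 := hG t ⟨ht.1.le, ht.2⟩
      gcongr
      rw [← sq_abs (sawErr (N ^ 2) t)]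
      set z := |sawErr (N ^ 2) t|
      have : 0 ≤ (N * z - 1) ^ 2 / N := by positivity
      have e : (N * z - 1) ^ 2 / N = N * z ^ 2 - 2 * z + 1 / N := by field_simp; ring
      linarith
    have hInt : IntervalIntegrable (fun t => G * (1 / 2 * (N * sawErr (N ^ 2) t ^ 2 + 1 / (N : ℝ))))
        volume a b := ((hsq.const_mul _).add intervalIntegrable_const).const_mul _ |>.const_mul _
    refine (intervalIntegral.norm_integral_le_of_norm_le hab
      (Filter.Eventually.of_forall hbnd) hInt).trans ?_
    rw [intervalIntegral.integral_const_mul, intervalIntegral.integral_const_mul,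
      intervalIntegral.integral_add (hsq.const_mul _) intervalIntegrable_const,
      intervalIntegral.integral_const_mul, intervalIntegral.integral_const]
    have h2 := integral_sawErr_sq_interval_le (K := N ^ 2) (by positivity) hab
    gcongr
    have h3 : (N : ℝ) * ∫ t in a..b, sawErr (N ^ 2) t ^ 2 ≤ (b - a + 1) / N := by
      calc _ ≤ (N : ℝ) * ((b - a + 1) / ((N ^ 2 : ℕ) : ℝ)) := by gcongr
        _ = _ := by push_cast; field_simp
    have h4 : (b - a) • (1 / (N : ℝ)) ≤ (b - a + 1) / N := by
      rw [smul_eq_mul, mul_one_div]; gcongr; linarith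
    linarith

theorem finite_lattice_disc (s : ℝ) :
    {q : ℤ × ℤ | (q.1 : ℝ) ^ 2 + (q.2 : ℝ) ^ 2 ≤ s}.Finite := by
  refine ((Set.finite_Icc (-⌈|s|⌉) ⌈|s|⌉).prod (Set.finite_Icc (-⌈|s|⌉) ⌈|s|⌉)).subset ?_
  have key : ∀ m : ℤ, (m : ℝ) ^ 2 ≤ s → m ∈ Set.Icc (-⌈|s|⌉) ⌈|s|⌉ := by
    intro m hm
    have h1 : ((|m| : ℤ) : ℝ) ≤ ((m ^ 2 : ℤ) : ℝ) := by
      have : |m| ≤ m ^ 2 := by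
        rw [← sq_abs]
        rcases (abs_nonneg m).eq_or_lt with h | h
        · rw [← h]; norm_num
        · nlinarith
      exact_mod_cast this
    have h2 : ((|m| : ℤ) : ℝ) ≤ ((⌈|s|⌉ : ℤ) : ℝ) := by
      refine h1.trans ?_
      push_cast
      exact hm.trans ((le_abs_self s).trans (Int.le_ceil _))
    exact abs_le.1 (by exact_mod_cast h2)
  rintro ⟨m, n⟩ h
  simp only [Set.mem_ofPred_eq] at h
  exact ⟨key m (by nlinarith [sq_nonneg (n : ℝ)]), key n (by nlinarith [sq_nonneg (m : ℝ)])⟩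

theorem volume_floor_fiber (q : ℤ × ℤ) :
    volume {z : ℂ | (⌊z.re⌋, ⌊z.im⌋) = q} = 1 := by
  have h : {z : ℂ | (⌊z.re⌋, ⌊z.im⌋) = q} = Complex.measurableEquivRealProd ⁻¹'
      (Set.Ico (q.1 : ℝ) (q.1 + 1) ×ˢ Set.Ico (q.2 : ℝ) (q.2 + 1)) := by
    ext z
    obtain ⟨a, b⟩ := q
    simp [Prod.ext_iff, Int.floor_eq_iff, Complex.measurableEquivRealProd_apply]
  rw [h, Complex.volume_preserving_equiv_real_prod.measure_preimage_equiv,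
    Measure.volume_eq_prod, Measure.prod_prod]
  simp

theorem measurableSet_floor_fiber (q : ℤ × ℤ) :
    MeasurableSet {z : ℂ | (⌊z.re⌋, ⌊z.im⌋) = q} := by
  have : Measurable fun z : ℂ => (⌊z.re⌋, ⌊z.im⌋) :=
    (Complex.measurable_re.floor).prodMk (Complex.measurable_im.floor)
  exact this (measurableSet_singleton q)

theorem abs_ncard_lattice_disc_sub_le {r : ℝ} (hr : 0 ≤ r) :
    |(Set.ncard {q : ℤ × ℤ | (q.1 : ℝ) ^ 2 + (q.2 : ℝ) ^ 2 ≤ r ^ 2} : ℝ) - π * r ^ 2|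
      ≤ π * (4 * r + 4) := by
  have hpi := Real.pi_pos
  set S := {q : ℤ × ℤ | (q.1 : ℝ) ^ 2 + (q.2 : ℝ) ^ 2 ≤ r ^ 2} with hS
  have hfin : S.Finite := finite_lattice_disc _
  set A : Set ℂ := {z | (⌊z.re⌋, ⌊z.im⌋) ∈ S} with hA
  have hvol : volume A = (S.ncard : ENNReal) := by
    have e : A = ⋃ q ∈ hfin.toFinset, {z : ℂ | (⌊z.re⌋, ⌊z.im⌋) = q} := by
      ext z; simp [hA]
    rw [e, measure_biUnion_finset]
    · simp_rw [volume_floor_fiber]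
      rw [Set.ncard_eq_toFinset_card _ hfin]; simp
    · intro p _ q _ hpq
      refine Set.disjoint_left.2 fun z hz hz' => hpq ?_
      exact hz.symm.trans hz'
    · intro q _; exact measurableSet_floor_fiber q
  have hdist : ∀ z : ℂ, ‖z - ((⌊z.re⌋ : ℂ) + (⌊z.im⌋ : ℂ) * Complex.I)‖ < 2 := by
    intro z
    refine (Complex.norm_le_abs_re_add_abs_im _).trans_lt ?_
    have h1 : (z - ((⌊z.re⌋ : ℂ) + (⌊z.im⌋ : ℂ) * Complex.I)).re = Int.fract z.re := by
      simp only [Int.fract]; simp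
    have h2 : (z - ((⌊z.re⌋ : ℂ) + (⌊z.im⌋ : ℂ) * Complex.I)).im = Int.fract z.im := by
      simp only [Int.fract]; simp
    rw [h1, h2, abs_of_nonneg (Int.fract_nonneg _), abs_of_nonneg (Int.fract_nonneg _)]
    linarith [Int.fract_lt_one z.re, Int.fract_lt_one z.im]
  have hnorm : ∀ z : ℂ, ‖((⌊z.re⌋ : ℂ) + (⌊z.im⌋ : ℂ) * Complex.I)‖ ^ 2 =
      (⌊z.re⌋ : ℝ) ^ 2 + (⌊z.im⌋ : ℝ) ^ 2 := by
    intro z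
    rw [← Complex.normSq_eq_norm_sq, Complex.normSq_apply]; simp; ring
  have hmem : ∀ z : ℂ, z ∈ A ↔ ‖((⌊z.re⌋ : ℂ) + (⌊z.im⌋ : ℂ) * Complex.I)‖ ≤ r := by
    intro z
    rw [← sq_le_sq₀ (norm_nonneg _) hr, hnorm]; rfl
  have hup : (S.ncard : ℝ) ≤ π * (r + 2) ^ 2 := by
    have hsub : A ⊆ Metric.ball 0 (r + 2) := by
      intro z hz
      rw [hmem] at hz
      rw [mem_ball_zero_iff]
      have := hdist z
      have h3 := norm_add_le (z - ((⌊z.re⌋ : ℂ) + (⌊z.im⌋ : ℂ) * Complex.I))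
        ((⌊z.re⌋ : ℂ) + (⌊z.im⌋ : ℂ) * Complex.I)
      rw [sub_add_cancel] at h3
      linarith
    have h := measure_mono (μ := volume) hsub
    rw [hvol, Complex.volume_ball] at h
    have h' := ENNReal.toReal_mono (by finiteness) h
    simp only [ENNReal.toReal_natCast, ENNReal.toReal_mul, ENNReal.toReal_pow,
      ENNReal.coe_toReal, NNReal.coe_real_pi] at h'
    rw [ENNReal.toReal_ofReal (by linarith)] at h'
    linarith
  have hlow : π * (r ^ 2 - 4 * r) ≤ S.ncard := by
    rcases lt_or_ge r 2 with h2 | h2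
    · have : π * (r ^ 2 - 4 * r) ≤ 0 := by
        apply mul_nonpos_of_nonneg_of_nonpos hpi.le; nlinarith
      exact this.trans (Nat.cast_nonneg _)
    · have hsub : Metric.ball 0 (r - 2) ⊆ A := by
        intro z hz
        rw [mem_ball_zero_iff] at hz
        rw [hmem]
        have := hdist z
        have h3 := norm_sub_le z (z - ((⌊z.re⌋ : ℂ) + (⌊z.im⌋ : ℂ) * Complex.I))
        rw [sub_sub_cancel] at h3
        linarith
      have h := measure_mono (μ := volume) hsub
      rw [hvol, Complex.volume_ball] at h
      have h' := ENNReal.toReal_mono (by finiteness) h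
      simp only [ENNReal.toReal_natCast, ENNReal.toReal_mul, ENNReal.toReal_pow,
        ENNReal.coe_toReal, NNReal.coe_real_pi] at h'
      rw [ENNReal.toReal_ofReal (by linarith)] at h'
      nlinarith
  rw [abs_le]
  constructor <;> nlinarith

theorem abs_NT_sub_le {x : ℝ} (hx : 1 ≤ x) : |NT (2 * π * x) - x / 2| ≤ 30 * √x := by
  have hpi := Real.pi_pos
  set r := √(x / (2 * π)) with hr
  have hr2 : r ^ 2 = x / (2 * π) := Real.sq_sqrt (by positivity)
  have e : NT (2 * π * x) = (Set.ncard {q : ℤ × ℤ | (q.1 : ℝ) ^ 2 + (q.2 : ℝ) ^ 2 ≤ r ^ 2} : ℝ) := by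
    rw [NT]
    congr 2
    ext q
    simp only [Set.mem_ofPred_eq]
    rw [hr2, le_div_iff₀ (by positivity)]
    constructor <;> intro h <;> nlinarith
  have h := abs_ncard_lattice_disc_sub_le (Real.sqrt_nonneg (x / (2 * π)))
  rw [← hr, ← e, hr2, show π * (x / (2 * π)) = x / 2 by field_simp] at h
  refine h.trans ?_
  have h1 : r ≤ √x := Real.sqrt_le_sqrt (by
    rw [div_le_iff₀ (by positivity)]; nlinarith [Real.pi_gt_three])
  have h2 : 1 ≤ √x := Real.one_le_sqrt.2 hx
  nlinarith [Real.pi_lt_four, Real.pi_lt_d2]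

/-- The argument of the sawtooth in the count of type II eigenvalues. -/
noncomputable def sawArg (x c : ℝ) : ℝ := (x / c - c + 1) / 2

theorem NH_eq_sum {x : ℝ} (hx : 0 ≤ x) :
    NH (2 * π * x) = ∑ i ∈ Finset.range ⌊√x⌋₊,
      2 * ((i : ℝ) + 1) * (⌊sawArg x (i + 1)⌋₊ : ℝ) := by
  have hpi := Real.pi_pos
  have hcond : ∀ p : ℕ × ℕ, (2 * π * (p.1 + 1 : ℝ) * ((p.1 + 1 : ℝ) + 2 * (p.2 : ℝ) + 1) ≤ 2 * π * x)
      ↔ p.2 < ⌊sawArg x (p.1 + 1)⌋₊ := by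
    intro p
    rw [← Nat.add_one_le_iff, Nat.le_floor_iff' (by omega), sawArg, le_div_iff₀ two_pos]
    have hc : (0 : ℝ) < (p.1 : ℝ) + 1 := by positivity
    rw [mul_assoc (2 * π), mul_le_mul_iff_right₀ (by positivity), ← le_div_iff₀' hc]
    push_cast
    constructor <;> intro h <;> linarith
  have hfl : ∀ i : ℕ, ⌊sawArg x (i + 1)⌋₊ ≤ ⌈x⌉₊ + 1 := by
    intro i
    apply Nat.floor_le_of_le
    have hc : (1 : ℝ) ≤ (i : ℝ) + 1 := by have : (0:ℝ) ≤ i := Nat.cast_nonneg i; linarith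
    have : x / ((i : ℝ) + 1) ≤ x := div_le_self hx hc
    have := Nat.le_ceil x
    rw [sawArg]; push_cast; linarith
  have hbig : ∀ i : ℕ, ⌊√x⌋₊ ≤ i → ⌊sawArg x (i + 1)⌋₊ = 0 := by
    intro i hi
    have h1 : √x < (i : ℝ) + 1 := by
      have := Nat.lt_floor_add_one (√x)
      have h2 : (⌊√x⌋₊ : ℝ) ≤ i := by exact_mod_cast hi
      linarith
    rw [Nat.floor_eq_zero, sawArg, div_lt_one two_pos]
    have h3 : x / ((i : ℝ) + 1) < (i : ℝ) + 1 := by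
      rw [div_lt_iff₀ (by positivity)]
      have := Real.sq_sqrt hx
      nlinarith [Real.sqrt_nonneg x]
    linarith
  rw [NH, tsum_eq_sum (s := Finset.range ⌊√x⌋₊ ×ˢ Finset.range (⌈x⌉₊ + 1)), Finset.sum_product]
  · apply Finset.sum_congr rfl
    intro i _
    rw [Finset.sum_congr rfl fun k _ => if_congr (hcond (i, k)) rfl rfl]
    rw [← Finset.sum_filter]
    dsimp only
    rw [Finset.sum_const, nsmul_eq_mul]
    have : (Finset.range (⌈x⌉₊ + 1)).filter (fun k => k < ⌊sawArg x ((i : ℝ) + 1)⌋₊) =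
        Finset.range ⌊sawArg x ((i : ℝ) + 1)⌋₊ := by
      ext k
      simp only [Finset.mem_filter, Finset.mem_range]
      have := hfl i
      omega
    rw [this, Finset.card_range]; ring
  · rintro ⟨i, k⟩ h
    rw [if_neg]
    rw [hcond]
    have h' : ⌊√x⌋₊ ≤ i ∨ ⌈x⌉₊ + 1 ≤ k := by
      by_contra hc
      push Not at hc
      exact h (Finset.mem_product.2 ⟨Finset.mem_range.2 hc.1, Finset.mem_range.2 hc.2⟩)
    rw [not_lt]
    rcases h' with h | h
    · exact (hbig i h).le.trans (Nat.zero_le _)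
    · exact (hfl i).trans h

theorem abs_sum_sub_sq_le {y : ℝ} (hy : 1 ≤ y) :
    |∑ i ∈ Finset.range ⌊y⌋₊, (y ^ 2 - ((i : ℝ) + 1) ^ 2) - (2 / 3 * y ^ 3 - y ^ 2 / 2)| ≤ 3 * y := by
  have hs : ∀ n : ℕ, ∑ i ∈ Finset.range n, (y ^ 2 - ((i : ℝ) + 1) ^ 2) =
      n * y ^ 2 - (2 * (n : ℝ) ^ 3 + 3 * (n : ℝ) ^ 2 + n) / 6 := by
    intro n
    induction n with
    | zero => simp
    | succ n ih => rw [Finset.sum_range_succ, ih]; push_cast; ring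
  rw [hs]
  have h1 := Nat.floor_le (by linarith : 0 ≤ y)
  have h2 := Nat.lt_floor_add_one y
  set n : ℝ := (⌊y⌋₊ : ℝ)
  obtain ⟨f, hf⟩ : ∃ f, f = y - n := ⟨_, rfl⟩
  have hn : n = y - f := by rw [hf]; ring
  have hf0 : 0 ≤ f := by linarith
  have hf1 : f ≤ 1 := by linarith
  have e : n * y ^ 2 - (2 * n ^ 3 + 3 * n ^ 2 + n) / 6 - (2 / 3 * y ^ 3 - y ^ 2 / 2) =
      y * (f - f ^ 2) + f ^ 3 / 3 - f ^ 2 / 2 - (y - f) / 6 := by rw [hn]; ring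
  rw [e]
  have a1 : 0 ≤ f - f ^ 2 := by nlinarith
  have a2 : f - f ^ 2 ≤ 1 := by nlinarith
  have a3 : 0 ≤ f ^ 3 := by positivity
  have a4 : f ^ 3 ≤ 1 := pow_le_one₀ hf0 hf1
  have a5 : f ^ 2 ≤ 1 := pow_le_one₀ hf0 hf1
  have a6 : y * (f - f ^ 2) ≤ y * 1 := by gcongr
  have a7 : 0 ≤ y * (f - f ^ 2) := by positivity
  rw [abs_le]; constructor <;> nlinarith [sq_nonneg f]

/-- The Weyl remainder is a weighted sum of sawtooth values up to `O(√x)`. -/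
theorem abs_R_add_sum_saw_le {x : ℝ} (hx : 1 ≤ x) :
    |R (2 * π * x) + 2 * ∑ i ∈ Finset.range ⌊√x⌋₊, ((i : ℝ) + 1) * saw (sawArg x (i + 1))|
      ≤ 33 * √x := by
  have hpi := Real.pi_pos
  have hy1 : 1 ≤ √x := Real.one_le_sqrt.2 hx
  have hsq : √x ^ 2 = x := Real.sq_sqrt (by linarith)
  have h1 := abs_NT_sub_le hx
  have h2 := abs_sum_sub_sq_le hy1
  have hmain : (Real.sqrt (2 * π) / (6 * π ^ 2)) * (2 * π * x) ^ ((3 : ℝ) / 2) = 2 / 3 * √x ^ 3 := by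
    have e1 : (2 * π * x) ^ ((3 : ℝ) / 2) = √(2 * π) ^ 3 * √x ^ 3 := by
      rw [← mul_pow, ← Real.sqrt_mul (by positivity), Real.sqrt_eq_rpow, ← Real.rpow_natCast,
        ← Real.rpow_mul (by positivity)]
      norm_num
    have e2 : √(2 * π) ^ 2 = 2 * π := Real.sq_sqrt (by positivity)
    rw [e1]
    have e3 : √(2 * π) / (6 * π ^ 2) * (√(2 * π) ^ 3 * √x ^ 3) =
        (√(2 * π) ^ 2) ^ 2 * √x ^ 3 / (6 * π ^ 2) := by ring
    rw [e3, e2]; field_simp; norm_num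
  have hNH : NH (2 * π * x) = ∑ i ∈ Finset.range ⌊√x⌋₊, (√x ^ 2 - ((i : ℝ) + 1) ^ 2) -
      2 * ∑ i ∈ Finset.range ⌊√x⌋₊, ((i : ℝ) + 1) * saw (sawArg x (i + 1)) := by
    rw [NH_eq_sum (by linarith), Finset.mul_sum, ← Finset.sum_sub_distrib]
    apply Finset.sum_congr rfl
    intro i hi
    have hi' : ((i + 1 : ℕ) : ℝ) ≤ √x := by
      have : i + 1 ≤ ⌊√x⌋₊ := Finset.mem_range.1 hi
      exact (Nat.le_floor_iff (Real.sqrt_nonneg x)).1 this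
    push_cast at hi'
    have hc : (0 : ℝ) < (i : ℝ) + 1 := by positivity
    have hz : 0 ≤ sawArg x (i + 1) := by
      have : (i : ℝ) + 1 ≤ x / (i + 1) := by
        rw [le_div_iff₀ hc]; nlinarith
      rw [sawArg]; linarith
    have hfl : (⌊sawArg x (i + 1)⌋₊ : ℝ) = sawArg x (i + 1) - 1 / 2 - saw (sawArg x (i + 1)) := by
      have h3 := Int.self_sub_fract (sawArg x (i + 1))
      have h4 : ((⌊sawArg x (i + 1)⌋₊ : ℕ) : ℝ) = (⌊sawArg x (i + 1)⌋ : ℝ) := by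
        rw [← natCast_floor_eq_intCast_floor hz]
      rw [h4, ← h3, saw]; ring
    rw [hfl, hsq]
    have : 2 * ((i : ℝ) + 1) * (sawArg x (i + 1) - 1 / 2) = x - ((i : ℝ) + 1) ^ 2 := by
      rw [sawArg]; field_simp; ring
    linear_combination this
  have e : R (2 * π * x) + 2 * ∑ i ∈ Finset.range ⌊√x⌋₊, ((i : ℝ) + 1) * saw (sawArg x (i + 1)) =
      (NT (2 * π * x) - x / 2) + (∑ i ∈ Finset.range ⌊√x⌋₊, (√x ^ 2 - ((i : ℝ) + 1) ^ 2) -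
        (2 / 3 * √x ^ 3 - √x ^ 2 / 2)) := by
    rw [R, hmain, hNH, hsq]; ring
  rw [e]
  refine (abs_add_le _ _).trans ?_
  linarith

/-- Weight of the saddle point: `1` inside the range of integration, `1/2` at its endpoint. -/
noncomputable def saddleWt (p q : ℝ) : ℝ := if p < q then 1 else if p = q then 1 / 2 else 0

theorem norm_saddleInt_sub_wt_main_le {p q D : ℝ} (hp : 0 < p)
    (hD : p = q → 1 / p ≤ D) (hD' : p ≠ q → 3 / |p - q| ≤ D) :
    ‖saddleInt p q - (saddleWt p q : ℂ) * saddleMain p q‖ ≤ D := by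
  rcases lt_trichotomy p q with h | h | h
  · have h1 := norm_saddleInt_sub_main_le hp h
    have h2 := hD' h.ne
    rw [abs_sub_comm, abs_of_pos (sub_pos.2 h)] at h2
    rw [saddleWt, if_pos h]
    push_cast
    rw [one_mul]
    exact h1.trans h2
  · subst h
    have h1 := norm_saddleInt_sub_half_main_le hp
    rw [saddleWt, if_neg (lt_irrefl _), if_pos rfl]
    push_cast
    exact h1.trans (hD rfl)
  · have h1 := norm_saddleInt_le_of_lt hp h
    have h2 := hD' h.ne'
    rw [abs_of_pos (sub_pos.2 h)] at h2
    rw [saddleWt, if_neg h.not_gt, if_neg h.ne']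
    push_cast
    rw [zero_mul, sub_zero]
    refine h1.trans (le_trans ?_ h2)
    gcongr
    linarith

theorem saddleFun_scale (p q κ u : ℝ) :
    saddleFun p q (κ * u) = (κ : ℂ) * saddleFun (p / κ) (q * κ) u := by
  rw [saddleFun, saddleFun]
  have : p / (κ * u) + q * (κ * u) = p / κ / u + q * κ * u := by
    rw [div_div]; ring
  rw [this]; push_cast; ring

theorem integral_saddleFun_scale (p q a b κ : ℝ) :
    ∫ u in (κ * a)..(κ * b), saddleFun p q u =
      (κ : ℂ) ^ 2 * ∫ u in a..b, saddleFun (p / κ) (q * κ) u := by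
  rw [← intervalIntegral.smul_integral_comp_mul_left]
  simp_rw [saddleFun_scale p q]
  rw [intervalIntegral.integral_const_mul, Complex.real_smul]
  ring

theorem saddleMain_scale {p q κ : ℝ} (hp : 0 ≤ p) (hq : 0 ≤ q) (hκ : 0 < κ) :
    (κ : ℂ) ^ 2 * saddleMain (p / κ) (q * κ) = saddleMain p q := by
  rw [saddleMain, saddleMain, show p / κ * (q * κ) = p * q by field_simp, ← mul_assoc]
  congr 1
  rw [Real.div_rpow hp hκ.le, Real.mul_rpow hq hκ.le]
  have : κ ^ 2 * (p ^ (3 / 4 : ℝ) / κ ^ (3 / 4 : ℝ) * (q ^ (-(5 / 4) : ℝ) * κ ^ (-(5 / 4) : ℝ))) =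
      p ^ (3 / 4 : ℝ) * q ^ (-(5 / 4) : ℝ) := by
    have h1 : κ ^ 2 * (κ ^ (-(5 / 4) : ℝ) / κ ^ (3 / 4 : ℝ)) = 1 := by
      rw [← Real.rpow_sub hκ, ← Real.rpow_natCast, ← Real.rpow_add hκ]; norm_num
    linear_combination (p ^ (3 / 4 : ℝ) * q ^ (-(5 / 4) : ℝ)) * h1
  exact_mod_cast this

theorem saddleWt_scale (p q : ℝ) {κ : ℝ} (hκ : 0 < κ) :
    saddleWt (κ * p) (κ * q) = saddleWt p q := by
  simp only [saddleWt, mul_lt_mul_iff_right₀ hκ, mul_right_inj' hκ.ne']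

theorem saddleWt_of_lt {p q : ℝ} (h : q < p) : saddleWt p q = 0 := by
  rw [saddleWt, if_neg h.not_gt, if_neg h.ne']

theorem norm_integral_saddleFun_sub_le {y h r L D₁ D₂ : ℝ} (hy : 0 < y) (hh : 1 ≤ h) (hL : 1 ≤ L)
    (h1 : h = r → 1 ≤ D₁) (h1' : h ≠ r → 1 / |h - r| ≤ D₁) (h2 : h * L ^ 2 = r → 1 ≤ D₂)
    (h2' : h * L ^ 2 ≠ r → 1 / |h * L ^ 2 - r| ≤ D₂) :
    ‖(∫ u in (1 / L)..1, saddleFun (y * h) (y * r) u) -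
      ((saddleWt h r - saddleWt (h * L ^ 2) r : ℝ) : ℂ) * saddleMain (y * h) (y * r)‖ ≤
      3 / y * (D₁ + D₂) := by
  have hL0 : 0 < L := by linarith
  have hκ : 0 < 1 / L := by positivity
  have hκ1 : 1 / L ≤ 1 := by rw [div_le_one hL0]; exact hL
  have hp : 0 < y * h := by positivity
  have hp2 : 0 < y * h / (1 / L) := by positivity
  have hD2 : 0 ≤ D₂ := by
    by_cases hc : h * L ^ 2 = r
    · linarith [h2 hc]
    · exact le_trans (by positivity) (h2' hc)
  have e1 : (∫ u in (1 / L)..1, saddleFun (y * h) (y * r) u) = saddleInt (y * h) (y * r) -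
      ((1 / L : ℝ) : ℂ) ^ 2 * saddleInt (y * h / (1 / L)) (y * r * (1 / L)) := by
    have := integral_saddleFun_scale (y * h) (y * r) 0 1 (1 / L)
    rw [mul_zero, mul_one] at this
    rw [saddleInt.eq_def (y * h / (1 / L)), ← this, ← saddleInt_sub]; ring
  have hw1 : saddleWt (y * h) (y * r) = saddleWt h r := saddleWt_scale _ _ hy
  have hw2 : saddleWt (y * h / (1 / L)) (y * r * (1 / L)) = saddleWt (h * L ^ 2) r := by
    rw [← saddleWt_scale (h * L ^ 2) r (κ := y / L) (by positivity)]
    congr 1 <;> field_simp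
  have b1 := norm_saddleInt_sub_wt_main_le (p := y * h) (q := y * r) (D := 3 / y * D₁) hp
    (by
      intro he
      have h1 := h1 (mul_left_cancel₀ hy.ne' he)
      rw [div_le_iff₀ hp]
      have : 3 / y * D₁ * (y * h) = 3 * (D₁ * h) := by field_simp
      rw [this]; nlinarith)
    (by
      intro hne
      have hne' : h ≠ r := fun hc => hne (by rw [hc])
      have := h1' hne'
      rw [← mul_sub, abs_mul, abs_of_pos hy, ← div_div, div_eq_mul_one_div (3 / y)]
      gcongr)
  have b2 := norm_saddleInt_sub_wt_main_le (p := y * h / (1 / L)) (q := y * r * (1 / L))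
    (D := 3 / y * D₂ * L) hp2
    (by
      intro he
      have h2 := h2 (by field_simp at he; linarith)
      rw [div_le_iff₀ hp2]
      have : 3 / y * D₂ * L * (y * h / (1 / L)) = 3 * (D₂ * h) * L ^ 2 := by field_simp
      rw [this]
      have : 1 ≤ D₂ * h := by nlinarith
      nlinarith)
    (by
      intro hne
      have hne' : h * L ^ 2 ≠ r := by
        intro hc; apply hne; rw [← hc]; field_simp
      have := h2' hne'
      have e : y * h / (1 / L) - y * r * (1 / L) = y / L * (h * L ^ 2 - r) := by field_simp
      rw [e, abs_mul, abs_of_pos (by positivity : 0 < y / L), ← div_div,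
        div_eq_mul_one_div (3 / (y / L)), show 3 / y * D₂ * L = 3 / (y / L) * D₂ by field_simp]
      gcongr)
  rw [hw1] at b1
  rw [hw2] at b2
  have hscale : ((saddleWt (h * L ^ 2) r : ℝ) : ℂ) * (((1 / L : ℝ) : ℂ) ^ 2 *
      saddleMain (y * h / (1 / L)) (y * r * (1 / L))) =
      ((saddleWt (h * L ^ 2) r : ℝ) : ℂ) * saddleMain (y * h) (y * r) := by
    rcases lt_or_ge r 0 with hr | hr
    · rw [saddleWt_of_lt (by nlinarith [sq_nonneg L, mul_pos (by linarith : 0 < h) (pow_pos hL0 2)])]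
      push_cast; rw [zero_mul, zero_mul]
    · rw [saddleMain_scale hp.le (by positivity) hκ]
  have e2 : (∫ u in (1 / L)..1, saddleFun (y * h) (y * r) u) -
      ((saddleWt h r - saddleWt (h * L ^ 2) r : ℝ) : ℂ) * saddleMain (y * h) (y * r) =
      (saddleInt (y * h) (y * r) - (saddleWt h r : ℂ) * saddleMain (y * h) (y * r)) -
      ((1 / L : ℝ) : ℂ) ^ 2 * (saddleInt (y * h / (1 / L)) (y * r * (1 / L)) -
        (saddleWt (h * L ^ 2) r : ℂ) * saddleMain (y * h / (1 / L)) (y * r * (1 / L))) := by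
    rw [e1]
    push_cast at hscale ⊢
    linear_combination -hscale
  rw [e2]
  refine (norm_sub_le _ _).trans ?_
  rw [norm_mul, norm_pow, Complex.norm_real, Real.norm_of_nonneg hκ.le]
  have hb : (1 / L) ^ 2 * (3 / y * D₂ * L) ≤ 3 / y * D₂ := by
    have e : (1 / L) ^ 2 * (3 / y * D₂ * L) = 3 / y * D₂ * (1 / L) := by field_simp
    rw [e]
    exact mul_le_of_le_one_right (by positivity) hκ1
  have hc : (1 / L) ^ 2 * ‖saddleInt (y * h / (1 / L)) (y * r * (1 / L)) -
        (saddleWt (h * L ^ 2) r : ℂ) * saddleMain (y * h / (1 / L)) (y * r * (1 / L))‖ ≤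
        (1 / L) ^ 2 * (3 / y * D₂ * L) := by gcongr
  linarith

theorem saddleWt_nonneg (p q : ℝ) : 0 ≤ saddleWt p q := by
  rw [saddleWt]; split_ifs <;> norm_num

theorem saddleWt_le_one (p q : ℝ) : saddleWt p q ≤ 1 := by
  rw [saddleWt]; split_ifs <;> norm_num

theorem saddleWt_antitone_left {p p' q : ℝ} (h : p ≤ p') : saddleWt p' q ≤ saddleWt p q := by
  rw [saddleWt, saddleWt]; split_ifs <;> first | (norm_num; done) | (exfalso; linarith) | grind

theorem sum_inv_max_le (j : ℤ) (K M : ℕ) (hM : 2 * K + j.natAbs ≤ M) :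
    ∑ ρ ∈ Finset.Icc (-(K : ℤ)) K, 1 / max 1 |((2 * ρ + j : ℤ) : ℝ)| ≤ 4 + 2 * Real.log M := by
  have hmaps : ∀ ρ ∈ Finset.Icc (-(K : ℤ)) K, (2 * ρ + j).natAbs ∈ Finset.range (M + 1) := by
    intro ρ hρ
    rw [Finset.mem_Icc] at hρ
    rw [Finset.mem_range]
    omega
  rw [← Finset.sum_fiberwise_of_maps_to hmaps]
  have hf : ∀ k ∈ Finset.range (M + 1),
      ∑ ρ ∈ Finset.Icc (-(K : ℤ)) K with (2 * ρ + j).natAbs = k, 1 / max 1 |((2 * ρ + j : ℤ) : ℝ)|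
        ≤ 2 * (1 / max 1 (k : ℝ)) := by
    intro k _
    have hval : ∀ ρ ∈ (Finset.Icc (-(K : ℤ)) K).filter (fun ρ => (2 * ρ + j).natAbs = k),
        1 / max 1 |((2 * ρ + j : ℤ) : ℝ)| = 1 / max 1 (k : ℝ) := by
      intro ρ hρ
      rw [Finset.mem_filter] at hρ
      rw [← hρ.2, Nat.cast_natAbs, Int.cast_abs]
    rw [Finset.sum_congr rfl hval, Finset.sum_const, nsmul_eq_mul]
    have hcard : ((Finset.Icc (-(K : ℤ)) K).filter (fun ρ => (2 * ρ + j).natAbs = k)).card ≤ 2 := by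
      refine (Finset.card_le_card (t := {((k : ℤ) - j) / 2, (-(k : ℤ) - j) / 2}) ?_).trans
        Finset.card_le_two
      intro ρ hρ
      rw [Finset.mem_filter] at hρ
      rw [Finset.mem_insert, Finset.mem_singleton]
      omega
    have : (((Finset.Icc (-(K : ℤ)) K).filter (fun ρ => (2 * ρ + j).natAbs = k)).card : ℝ) ≤ 2 := by
      exact_mod_cast hcard
    gcongr
  refine (Finset.sum_le_sum hf).trans ?_
  rw [← Finset.mul_sum, Finset.sum_range_succ']
  have e : ∑ k ∈ Finset.range M, 1 / max 1 (((k + 1 : ℕ) : ℝ)) =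
      ∑ k ∈ Finset.range M, 1 / ((k : ℝ) + 1) := by
    apply Finset.sum_congr rfl
    intro k _
    push_cast
    rw [max_eq_right]
    have : (0 : ℝ) ≤ k := Nat.cast_nonneg k
    linarith
  have h0 := sum_inv_le_log M
  rw [e]; norm_num
  norm_num at h0
  linarith

theorem hasDerivAt_saddleFun (p q : ℝ) {t : ℝ} (ht : t ≠ 0) :
    HasDerivAt (saddleFun p q) (Complex.exp (I * ((π * (p / t + q * t) : ℝ) : ℂ)) *
      (1 + (t : ℂ) * (I * ((π * (q - p / t ^ 2) : ℝ) : ℂ)))) t := by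
  have h1 : HasDerivAt (fun u : ℝ => (u : ℂ)) 1 t := Complex.ofRealCLM.hasDerivAt
  have h2 : HasDerivAt (fun u : ℝ => π * (p / u + q * u)) (π * (q - p / t ^ 2)) t := by
    have h3 : HasDerivAt (fun u : ℝ => p / u) (-p / t ^ 2) t :=
      ((hasDerivAt_inv ht).const_mul p).congr_deriv (by ring)
    have h4 : HasDerivAt (fun u : ℝ => q * u) q t :=
      ((hasDerivAt_id t).const_mul q).congr_deriv (by simp)
    exact ((h3.add h4).const_mul π).congr_deriv (by ring)
  have h5 := ((h2.ofReal_comp.const_mul I).cexp)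
  exact (h1.mul h5).congr_deriv (by push_cast; ring)

theorem saddleFun_mul_cexp (p q t : ℝ) (ρ : ℤ) :
    saddleFun p q t * Complex.exp (I * ((2 * π * ρ * t : ℝ) : ℂ)) = saddleFun p (q + 2 * ρ) t := by
  rw [saddleFun, saddleFun, mul_assoc, ← Complex.exp_add]
  congr 2
  push_cast; ring

/-- The Poisson-transformed exponential sum over one frequency `h`. -/
theorem norm_sum_saddleFun_sub_le {x : ℝ} (hx : 1 ≤ x) {L h N M : ℕ} (hL : √x < L) (hh : 1 ≤ h)
    (hN : 0 < N) (hM : 2 * N ^ 2 + h * L ^ 2 ≤ M) :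
    ‖∑ c ∈ Finset.Ioc 0 ⌊√x⌋₊, saddleFun (h * x) h (c : ℝ) -
      ∑ ρ ∈ Finset.Icc (-((N ^ 2 : ℕ) : ℤ)) (N ^ 2 : ℕ), (x : ℂ) *
        (((saddleWt (h : ℝ) ((h : ℝ) + 2 * ρ) - saddleWt ((h : ℝ) * (L : ℝ) ^ 2) ((h : ℝ) + 2 * ρ) : ℝ) : ℂ) *
          saddleMain (√x * h) (√x * ((h : ℝ) + 2 * ρ)))‖ ≤
      √x / L * |sawErr (N ^ 2) (√x / L)| + √x * |sawErr (N ^ 2) √x| +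
        (1 + π * (h * (√x * L + √x))) * ((√x + 1) / N) + 3 * √x * (8 + 4 * Real.log M) := by
  have hpi := Real.pi_pos
  set y := √x with hy
  have hy1 : 1 ≤ y := Real.one_le_sqrt.2 hx
  have hy0 : 0 < y := by linarith
  have hxy : x = y ^ 2 := (Real.sq_sqrt (by linarith)).symm
  have hL1 : (1 : ℝ) < L := by linarith
  have hL0 : (0 : ℝ) < L := by linarith
  have hh1 : (1 : ℝ) ≤ h := by exact_mod_cast hh
  have ha0 : 0 < y / L := by positivity
  have hab : y / L ≤ y := div_le_self hy0.le hL1.le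
  have ha1 : y / L < 1 := by rw [div_lt_one hL0]; exact hL
  have hpos : ∀ t ∈ Set.Icc (y / L) y, 0 < t := fun t ht => ha0.trans_le ht.1
  have hP := norm_sum_sub_poisson_le (g := saddleFun (h * x) h)
    (g' := fun t => Complex.exp (I * ((π * (h * x / t + h * t) : ℝ) : ℂ)) *
      (1 + (t : ℂ) * (I * ((π * (h - h * x / t ^ 2) : ℝ) : ℂ))))
    (G := 1 + π * (h * (y * L + y))) ha0.le hab
    (fun t ht => hasDerivAt_saddleFun _ _ (hpos t ht).ne')
    (by
      intro t ht
      have := (hpos t ht).ne'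
      apply ContinuousAt.continuousWithinAt
      have h1 : ContinuousAt (fun t : ℝ => π * (h * x / t + h * t)) t := by fun_prop (disch := assumption)
      have h2 : ContinuousAt (fun t : ℝ => π * (h - h * x / t ^ 2)) t := by
        have : t ^ 2 ≠ 0 := pow_ne_zero 2 this
        fun_prop (disch := assumption)
      have h3 := Complex.continuous_ofReal.continuousAt.comp h1
      have h4 := Complex.continuous_ofReal.continuousAt.comp h2
      have h5 : ContinuousAt (fun t : ℝ => (t : ℂ)) t := Complex.continuous_ofReal.continuousAt
      exact ((continuousAt_const.mul h3).cexp).mul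
        (continuousAt_const.add (h5.mul (continuousAt_const.mul h4))))
    (by
      intro t ht
      have ht0 := hpos t ht
      rw [norm_mul, norm_cexp_I_mul, one_mul]
      refine (norm_add_le _ _).trans ?_
      rw [norm_one, norm_mul, norm_mul, Complex.norm_I, Complex.norm_real, Complex.norm_real,
        one_mul, Real.norm_of_nonneg ht0.le, Real.norm_eq_abs, abs_mul, abs_of_pos hpi]
      have h1 : t * |(h : ℝ) - h * x / t ^ 2| ≤ h * (y * L + y) := by
        have h2 : |(h : ℝ) - h * x / t ^ 2| ≤ |(h : ℝ)| + |h * x / t ^ 2| := abs_sub _ _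
        rw [abs_of_nonneg (by positivity : (0:ℝ) ≤ h), abs_of_nonneg (by rw [hxy]; positivity : 0 ≤ h * x / t ^ 2)] at h2
        have h3 : t * (h * x / t ^ 2) ≤ h * (y * L) := by
          have e : t * (h * x / t ^ 2) = h * (y ^ 2 / t) := by rw [hxy]; field_simp
          rw [e]
          have h4 : y ^ 2 / t ≤ y * L := by
            rw [div_le_iff₀ ht0]
            have h6 := ht.1
            rw [div_le_iff₀ hL0] at h6
            nlinarith
          gcongr
        have h5 : t * (h : ℝ) ≤ h * y := by nlinarith [ht.2]
        nlinarith
      nlinarith)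
    hN
  rw [Nat.floor_eq_zero.2 ha1] at hP
  have hInt : ∀ ρ : ℤ, ∫ t in (y / L)..y, saddleFun (h * x) h t * Complex.exp (I * ((2 * π * ρ * t : ℝ) : ℂ)) =
      (x : ℂ) * ∫ u in (1 / (L : ℝ))..1, saddleFun (y * h) (y * ((h : ℝ) + 2 * ρ)) u := by
    intro ρ
    simp_rw [saddleFun_mul_cexp]
    have := integral_saddleFun_scale (h * x) ((h : ℝ) + 2 * ρ) (1 / L) 1 y
    rw [mul_one, mul_one_div] at this
    rw [this, show (h : ℝ) * x / y = y * h by rw [hxy]; field_simp, mul_comm ((h : ℝ) + 2 * ρ) y]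
    congr 1
    rw [hxy]; push_cast; ring
  simp_rw [hInt] at hP
  rw [norm_saddleFun, norm_saddleFun, abs_of_pos ha0, abs_of_pos hy0] at hP
  have hnum : ((1 + π * (h * (y * L + y))) * ((y - y / L + 1) / N)) ≤
      (1 + π * (h * (y * L + y))) * ((y + 1) / N) := by
    gcongr; linarith
  have hone : ∀ j : ℤ, j ≠ 0 → 1 ≤ |(j : ℝ)| := fun j hj => by
    exact_mod_cast Int.one_le_abs hj
  have hD : ∀ (j : ℤ) (v : ℝ), v = j → (v = 0 → 1 ≤ 1 / max 1 |(j : ℝ)|) ∧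
      (v ≠ 0 → 1 / |v| ≤ 1 / max 1 |(j : ℝ)|) := by
    intro j v hv
    constructor
    · intro h0
      rw [← hv, h0]; norm_num
    · intro h0
      have : j ≠ 0 := by
        rintro rfl; exact h0 (by rw [hv]; simp)
      rw [hv, max_eq_right (hone j this)]
  have hsad : ∀ ρ ∈ Finset.Icc (-((N ^ 2 : ℕ) : ℤ)) (N ^ 2 : ℕ),
      ‖(x : ℂ) * (∫ u in (1 / (L : ℝ))..1, saddleFun (y * h) (y * ((h : ℝ) + 2 * ρ)) u) -
        (x : ℂ) * (((saddleWt (h : ℝ) ((h : ℝ) + 2 * ρ) - saddleWt ((h : ℝ) * (L : ℝ) ^ 2) ((h : ℝ) + 2 * ρ) : ℝ) : ℂ) *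
          saddleMain (y * h) (y * ((h : ℝ) + 2 * ρ)))‖ ≤
      3 * y * (1 / max 1 |((2 * ρ + 0 : ℤ) : ℝ)| +
        1 / max 1 |((2 * ρ + ((h : ℤ) - h * (L : ℤ) ^ 2) : ℤ) : ℝ)|) := by
    intro ρ _
    rw [← mul_sub, norm_mul, Complex.norm_real, Real.norm_of_nonneg (by linarith)]
    obtain ⟨a1, a2⟩ := hD (2 * ρ + 0) (((h : ℝ) + 2 * ρ) - h) (by push_cast; ring)
    obtain ⟨b1, b2⟩ := hD (2 * ρ + ((h : ℤ) - h * (L : ℤ) ^ 2))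
      (((h : ℝ) + 2 * ρ) - h * (L : ℝ) ^ 2) (by push_cast; ring)
    have := norm_integral_saddleFun_sub_le (r := (h : ℝ) + 2 * ρ) hy0 hh1 hL1.le
      (fun he => a1 (sub_eq_zero.2 he.symm))
      (fun he => by rw [abs_sub_comm]; exact a2 (sub_ne_zero.2 he.symm))
      (fun he => b1 (sub_eq_zero.2 he.symm))
      (fun he => by rw [abs_sub_comm]; exact b2 (sub_ne_zero.2 he.symm))
    refine (mul_le_mul_of_nonneg_left this (by linarith)).trans (le_of_eq ?_)
    rw [← mul_assoc]
    congr 1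
    rw [hxy]; field_simp
  have hsum := norm_sum_le_of_le _ hsad
  rw [← Finset.mul_sum, Finset.sum_add_distrib, Finset.sum_sub_distrib] at hsum
  have hL1' : 1 ≤ L ^ 2 := Nat.one_le_pow _ _ (by exact_mod_cast hL0)
  have s1 := sum_inv_max_le 0 (N ^ 2) M (by rw [Int.natAbs_zero]; omega)
  have s2 := sum_inv_max_le ((h : ℤ) - h * (L : ℤ) ^ 2) (N ^ 2) M (by
    have e : (h : ℤ) - h * (L : ℤ) ^ 2 = ((h : ℕ) : ℤ) - ((h * L ^ 2 : ℕ) : ℤ) := by push_cast; ring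
    have : h ≤ h * L ^ 2 := Nat.le_mul_of_pos_right _ (by omega)
    rw [e]; omega)
  have hfin : 3 * y * (∑ ρ ∈ Finset.Icc (-((N ^ 2 : ℕ) : ℤ)) (N ^ 2 : ℕ), 1 / max 1 |((2 * ρ + 0 : ℤ) : ℝ)| +
      ∑ ρ ∈ Finset.Icc (-((N ^ 2 : ℕ) : ℤ)) (N ^ 2 : ℕ),
        1 / max 1 |((2 * ρ + ((h : ℤ) - h * (L : ℤ) ^ 2) : ℤ) : ℝ)|) ≤ 3 * y * (8 + 4 * Real.log M) := by
    exact mul_le_mul_of_nonneg_left (by linarith) (by positivity)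
  refine (norm_sub_le_norm_sub_add_norm_sub _ _ _).trans (add_le_add (hP.trans ?_) (hsum.trans hfin))
  linarith

theorem sin_sawArg (x : ℝ) (h c : ℕ) :
    sin (2 * π * h * sawArg x c) = (-1) ^ h * sin (π * (h * x / c + h * c)) := by
  have e : 2 * π * h * sawArg x c = π * (h * x / c + h * c) - (h * c : ℕ) * (2 * π) + h * π := by
    rw [sawArg]; push_cast; ring
  rw [e, Real.sin_add_nat_mul_pi, Real.sin_sub_nat_mul_two_pi]

theorem saddleFun_im (p q u : ℝ) : (saddleFun p q u).im = u * sin (π * (p / u + q * u)) := by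
  rw [saddleFun, Complex.im_ofReal_mul, mul_comm I, Complex.exp_ofReal_mul_I_im]

theorem sum_sawTrunc_eq (x : ℝ) (n H : ℕ) :
    2 * ∑ i ∈ Finset.range n, ((i : ℝ) + 1) * sawTrunc H (sawArg x (i + 1)) =
      -∑ k ∈ Finset.range H, 2 / (π * ((k : ℝ) + 1)) * ((-1) ^ (k + 1) *
        (∑ c ∈ Finset.Ioc 0 n, saddleFun ((k + 1 : ℕ) * x) (k + 1 : ℕ) (c : ℝ)).im) := by
  have e : Finset.Ioc 0 n = Finset.Ico 1 (n + 1) := by ext; simp; omega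
  have e2 : ∀ k : ℕ, (∑ c ∈ Finset.Ioc 0 n, saddleFun ((k + 1 : ℕ) * x) (k + 1 : ℕ) (c : ℝ)).im =
      ∑ i ∈ Finset.range n, ((i : ℝ) + 1) * sin (π * ((k + 1 : ℕ) * x / (i + 1 : ℕ) + (k + 1 : ℕ) * (i + 1 : ℕ))) := by
    intro k
    rw [Complex.im_sum, e, Finset.sum_Ico_eq_sum_range]
    simp only [Nat.add_sub_cancel]
    apply Finset.sum_congr rfl
    intro i _
    rw [saddleFun_im, add_comm 1 i]; push_cast; ring
  simp_rw [e2]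
  have e3 : ∀ i : ℕ, sawTrunc H (sawArg x (i + 1)) = -∑ k ∈ Finset.range H, (-1) ^ (k + 1) *
      sin (π * ((k + 1 : ℕ) * x / (i + 1 : ℕ) + (k + 1 : ℕ) * (i + 1 : ℕ))) / (π * ((k : ℝ) + 1)) := by
    intro i
    rw [sawTrunc]
    congr 1
    apply Finset.sum_congr rfl
    intro k _
    have := sin_sawArg x (k + 1) (i + 1)
    rw [← this]; push_cast; rfl
  simp_rw [e3, mul_neg, Finset.sum_neg_distrib, mul_neg, Finset.mul_sum]
  congr 1
  rw [Finset.sum_comm]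
  apply Finset.sum_congr rfl
  intro k _
  apply Finset.sum_congr rfl
  intro i _
  have hk : (k : ℝ) + 1 ≠ 0 := by positivity
  field_simp

/-- Coefficients of the truncated Voronoi-type expansion, before grouping by `h * r`. -/
noncomputable def coefPair (Z h r : ℕ) : ℝ :=
  if r % 2 = h % 2 ∧ h ≤ Z ^ 6 then
    (-1) ^ h * (saddleWt h r - saddleWt (h * (Z : ℝ) ^ 2) r) *
      ((h : ℝ) ^ (-(1 / 4) : ℝ) * (r : ℝ) ^ (-(5 / 4) : ℝ))
  else 0

theorem im_mul_saddleMain {x h r : ℝ} (hx : 0 < x) (hh : 0 < h) (hr : 0 < r) :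
    x * (saddleMain (√x * h) (√x * r)).im =
      x ^ (3 / 4 : ℝ) * (h * (h ^ (-(1 / 4) : ℝ) * r ^ (-(5 / 4) : ℝ))) *
        sin (2 * π * √(h * r * x) + π / 4) := by
  have hy := Real.sqrt_pos.2 hx
  have e0 : √x * h * (√x * r) = h * r * x := by
    have := Real.mul_self_sqrt hx.le
    linear_combination (h * r) * this
  have e1 : (Complex.exp (I * ((2 * π * √(h * r * x) + π / 4 : ℝ) : ℂ))).im =
      sin (2 * π * √(h * r * x) + π / 4) := by
    rw [mul_comm, Complex.exp_ofReal_mul_I_im]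
  rw [saddleMain, e0, Complex.im_ofReal_mul, e1, ← mul_assoc]
  congr 1
  rw [Real.mul_rpow hy.le hh.le, Real.mul_rpow hy.le hr.le, Real.sqrt_eq_rpow, ← Real.rpow_mul hx.le,
    ← Real.rpow_mul hx.le]
  have h1 : x * (x ^ (1 / 2 * (3 / 4) : ℝ) * x ^ (1 / 2 * -(5 / 4) : ℝ)) = x ^ (3 / 4 : ℝ) := by
    rw [← Real.rpow_add hx]
    nth_rewrite 1 [← Real.rpow_one x]
    rw [← Real.rpow_add hx]; norm_num
  have h2 : h ^ (3 / 4 : ℝ) = h * h ^ (-(1 / 4) : ℝ) := by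
    nth_rewrite 2 [← Real.rpow_one h]
    rw [← Real.rpow_add hh]; norm_num
  rw [← h1, h2]; ring

theorem sum_saddleMain_eq {x : ℝ} (hx : 0 < x) {Z h : ℕ} (hZ : 2 ≤ Z) (hh : 1 ≤ h) (hH : h ≤ Z ^ 6) :
    (-1) ^ h * (∑ ρ ∈ Finset.Icc (-(((Z ^ 9) ^ 2 : ℕ) : ℤ)) ((Z ^ 9) ^ 2 : ℕ), (x : ℂ) *
        (((saddleWt (h : ℝ) ((h : ℝ) + 2 * ρ) - saddleWt ((h : ℝ) * (Z : ℝ) ^ 2) ((h : ℝ) + 2 * ρ) : ℝ) : ℂ) *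
          saddleMain (√x * h) (√x * ((h : ℝ) + 2 * ρ)))).im =
      h * (x ^ (3 / 4 : ℝ) * ∑ r ∈ Finset.Icc 1 (Z ^ 8), coefPair Z h r *
        sin (2 * π * √((h * r : ℕ) * x) + π / 4)) := by
  have hh0 : (0 : ℝ) < h := by exact_mod_cast hh
  have hZ1 : 1 ≤ Z ^ 2 := Nat.one_le_pow _ _ (by omega)
  have hbig : Z ^ 8 + Z ^ 6 ≤ (Z ^ 9) ^ 2 := by
    have h1 : Z ^ 6 ≤ Z ^ 8 := Nat.pow_le_pow_right (by omega) (by norm_num)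
    have h2 : 2 ≤ Z ^ 10 := hZ.trans (Nat.le_self_pow (by norm_num) Z)
    have h3 : (Z ^ 9) ^ 2 = Z ^ 8 * Z ^ 10 := by ring
    rw [h3]; nlinarith
  have hhZ : h * Z ^ 2 ≤ Z ^ 8 := by
    calc h * Z ^ 2 ≤ Z ^ 6 * Z ^ 2 := Nat.mul_le_mul_right _ hH
      _ = Z ^ 8 := by ring
  have hhh : h ≤ h * Z ^ 2 := Nat.le_mul_of_pos_right _ (by omega)
  rw [Complex.im_sum, Finset.mul_sum, Finset.mul_sum, Finset.mul_sum]
  symm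
  rw [← Finset.sum_filter_of_ne (p := fun r => r % 2 = h % 2)]
  · refine Finset.sum_of_injOn (fun r : ℕ => ((r : ℤ) - h) / 2) ?_ ?_ ?_ ?_
    · intro r hr r' hr' he
      simp only [Finset.coe_filter, Set.mem_ofPred_eq] at hr hr'
      dsimp only at he
      omega
    · intro r hr
      simp only [Finset.coe_filter, Set.mem_ofPred_eq, Finset.mem_Icc] at hr
      rw [Finset.mem_coe, Finset.mem_Icc]
      generalize (Z ^ 9) ^ 2 = A at *
      constructor <;> dsimp only <;> omega
    · intro ρ _ hne
      have hW : saddleWt (h : ℝ) ((h : ℝ) + 2 * ρ) - saddleWt ((h : ℝ) * (Z : ℝ) ^ 2) ((h : ℝ) + 2 * ρ) = 0 := by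
        rcases lt_or_ge ρ 0 with h0 | h0
        · have h1 : (ρ : ℝ) < 0 := by exact_mod_cast h0
          have h2 : (h : ℝ) ≤ h * (Z : ℝ) ^ 2 := by exact_mod_cast hhh
          rw [saddleWt_of_lt (by linarith), saddleWt_of_lt (by linarith), sub_zero]
        · obtain ⟨k, rfl⟩ := Int.eq_ofNat_of_zero_le h0
          have h1 : Z ^ 8 < h + 2 * k := by
            by_contra hc
            apply hne
            refine ⟨h + 2 * k, ?_, ?_⟩
            · simp only [Finset.coe_filter, Set.mem_ofPred_eq, Finset.mem_Icc]
              omega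
            · dsimp only; push_cast; omega
          have h2 : (h : ℝ) * (Z : ℝ) ^ 2 < (h : ℝ) + 2 * ((k : ℤ) : ℝ) := by
            have : h * Z ^ 2 < h + 2 * k := by omega
            exact_mod_cast this
          have h3 : (h : ℝ) ≤ h * (Z : ℝ) ^ 2 := by exact_mod_cast hhh
          rw [saddleWt, if_pos (by linarith), saddleWt, if_pos h2, sub_self]
      rw [hW]; simp
    · intro r hr
      rw [Finset.mem_filter, Finset.mem_Icc] at hr
      have hr0 : (0 : ℝ) < r := by exact_mod_cast hr.1.1
      have e : (h : ℝ) + 2 * ((((r : ℤ) - h) / 2 : ℤ) : ℝ) = r := by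
        have : (h : ℤ) + 2 * (((r : ℤ) - h) / 2) = r := by omega
        exact_mod_cast this
      rw [e, Complex.im_ofReal_mul, Complex.im_ofReal_mul, coefPair, if_pos ⟨hr.2, hH⟩]
      have := im_mul_saddleMain hx hh0 hr0
      push_cast
      linear_combination (-(-1) ^ h * (saddleWt (h : ℝ) r - saddleWt ((h : ℝ) * (Z : ℝ) ^ 2) r)) * this
  · intro r _ hne
    by_contra hc
    apply hne
    rw [coefPair, if_neg (fun h => hc h.1)]; simp

/-- Coefficients of the truncated Voronoi-type expansion. -/
noncomputable def coefTrunc (Z n : ℕ) : ℝ := ∑ p ∈ n.divisorsAntidiagonal, coefPair Z p.1 p.2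

/-- The `L²`-small part of the error in the truncated Voronoi-type expansion. -/
noncomputable def voronoiErr (Z : ℕ) (x : ℝ) : ℝ :=
  2 * ∑ i ∈ Finset.range Z, ((i : ℝ) + 1) * |sawErr (Z ^ 6) (sawArg x (i + 1))| +
    4 * (1 + Real.log Z) * Z * (|sawErr ((Z ^ 9) ^ 2) √x| + |sawErr ((Z ^ 9) ^ 2) (√x / Z)|)

theorem coefPair_eq_zero_of_lt {Z h r : ℕ} (hZ : 1 ≤ Z) (hr : Z ^ 8 < r) : coefPair Z h r = 0 := by
  rw [coefPair]
  split_ifs with hc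
  · have h1 : h * Z ^ 2 < r := by
      calc h * Z ^ 2 ≤ Z ^ 6 * Z ^ 2 := Nat.mul_le_mul_right _ hc.2
        _ = Z ^ 8 := by ring
        _ < r := hr
    have h2 : h < r := lt_of_le_of_lt (Nat.le_mul_of_pos_right _ (Nat.pos_of_ne_zero (by positivity))) h1
    have h1' : (h : ℝ) * (Z : ℝ) ^ 2 < r := by exact_mod_cast h1
    have h2' : (h : ℝ) < r := by exact_mod_cast h2
    rw [saddleWt, if_pos h2', saddleWt, if_pos h1']; simp
  · rfl

theorem sum_coefTrunc_eq {Z : ℕ} (hZ : 1 ≤ Z) (s : ℕ → ℝ) :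
    ∑ h ∈ Finset.Icc 1 (Z ^ 6), ∑ r ∈ Finset.Icc 1 (Z ^ 8), coefPair Z h r * s (h * r) =
      ∑ n ∈ Finset.Icc 1 (Z ^ 14), coefTrunc Z n * s n := by
  rw [← Finset.sum_product' (f := fun h r => coefPair Z h r * s (h * r)),
    ← Finset.sum_fiberwise_of_maps_to (g := fun p : ℕ × ℕ => p.1 * p.2) (t := Finset.Icc 1 (Z ^ 14))]
  · apply Finset.sum_congr rfl
    intro n hn
    rw [coefTrunc, Finset.sum_mul]
    have hn1 : 1 ≤ n := (Finset.mem_Icc.1 hn).1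
    have e : ∀ p ∈ n.divisorsAntidiagonal, coefPair Z p.1 p.2 * s n =
        coefPair Z p.1 p.2 * s (p.1 * p.2) := by
      intro p hp
      rw [(Nat.mem_divisorsAntidiagonal.1 hp).1]
    rw [Finset.sum_congr rfl e]
    apply Finset.sum_subset
    · intro p hp
      rw [Finset.mem_filter] at hp
      rw [Nat.mem_divisorsAntidiagonal]
      exact ⟨hp.2, by omega⟩
    · intro p hp hnp
      rw [Nat.mem_divisorsAntidiagonal] at hp
      have hpos : 0 < p.1 * p.2 := by rw [hp.1]; omega
      have h1 := Nat.pos_of_mul_pos_right hpos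
      have h2 := Nat.pos_of_mul_pos_left hpos
      by_cases c1 : p.1 ≤ Z ^ 6
      · by_cases c2 : p.2 ≤ Z ^ 8
        · exfalso; apply hnp
          rw [Finset.mem_filter, Finset.mem_product, Finset.mem_Icc, Finset.mem_Icc]
          exact ⟨⟨⟨by omega, c1⟩, ⟨by omega, c2⟩⟩, hp.1⟩
        · rw [coefPair_eq_zero_of_lt hZ (not_le.1 c2), zero_mul]
      · rw [coefPair, if_neg (fun h => c1 h.2), zero_mul]
  · intro p hp
    rw [Finset.mem_product, Finset.mem_Icc, Finset.mem_Icc] at hp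
    rw [Finset.mem_Icc]
    refine ⟨Nat.mul_pos hp.1.1 hp.2.1, ?_⟩
    calc p.1 * p.2 ≤ Z ^ 6 * Z ^ 8 := Nat.mul_le_mul hp.1.2 hp.2.2
      _ = Z ^ 14 := by ring

theorem log_natCast_pow (Z k : ℕ) : Real.log ((Z ^ k : ℕ) : ℝ) = k * Real.log Z := by
  rw [Nat.cast_pow, Real.log_pow]

/-- The truncated Voronoi-type expansion of the Weyl remainder. -/
theorem abs_R_sub_sum_coefTrunc_le {Z : ℕ} (hZ : 2 ≤ Z) {x : ℝ} (hx : 1 ≤ x) (hxZ : x < (Z : ℝ) ^ 2) :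
    |R (2 * π * x) - 2 / π * x ^ (3 / 4 : ℝ) *
      ∑ n ∈ Finset.Icc 1 (Z ^ 14), coefTrunc Z n * sin (2 * π * √(n * x) + π / 4)| ≤
      1100 * (1 + Real.log Z) ^ 2 * √x + voronoiErr Z x := by
  have hpi := Real.pi_pos
  have hx0 : 0 < x := by linarith
  have hZ0 : (0 : ℝ) < Z := by positivity
  have hZ2 : (2 : ℝ) ≤ Z := by exact_mod_cast hZ
  have hyZ : √x < Z := by rw [Real.sqrt_lt' hZ0]; exact hxZ
  have hy1 : 1 ≤ √x := Real.one_le_sqrt.2 hx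
  set y := √x with hy
  have hlog : 0 ≤ Real.log Z := log_natCast_nonneg Z
  set Λ := 1 + Real.log Z with hΛ
  have hΛ1 : 1 ≤ Λ := by linarith
  set H := Z ^ 6 with hH
  set K := (Z ^ 9) ^ 2 with hK
  set Er := y / Z * |sawErr K (y / Z)| + y * |sawErr K y| with hEr
  set T : ℕ → ℂ := fun h => ∑ c ∈ Finset.Ioc 0 ⌊y⌋₊, saddleFun (h * x) h (c : ℝ) with hT
  set P : ℕ → ℂ := fun h => ∑ ρ ∈ Finset.Icc (-(K : ℤ)) K, (x : ℂ) *
        (((saddleWt (h : ℝ) ((h : ℝ) + 2 * ρ) - saddleWt ((h : ℝ) * (Z : ℝ) ^ 2) ((h : ℝ) + 2 * ρ) : ℝ) : ℂ) *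
          saddleMain (y * h) (y * ((h : ℝ) + 2 * ρ))) with hP
  have hTP : ∀ h : ℕ, 1 ≤ h → h ≤ H → |(T h).im - (P h).im| ≤ Er + 258 * (Λ * y) := by
    intro h h1 hh
    rw [← Complex.sub_im]
    refine (Complex.abs_im_le_norm _).trans ?_
    refine (norm_sum_saddleFun_sub_le hx hyZ h1 (N := Z ^ 9) (M := 3 * Z ^ 18) (by positivity) ?_).trans ?_
    · have h2 : h * Z ^ 2 ≤ Z ^ 8 := by
        calc h * Z ^ 2 ≤ Z ^ 6 * Z ^ 2 := Nat.mul_le_mul_right _ hh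
          _ = Z ^ 8 := by ring
      have h3 : Z ^ 8 ≤ Z ^ 18 := Nat.pow_le_pow_right (by omega) (by norm_num)
      have h4 : (Z ^ 9) ^ 2 = Z ^ 18 := by ring
      omega
    · have hhr : (h : ℝ) ≤ (Z : ℝ) ^ 6 := by exact_mod_cast hh
      have a1 : (1 + π * (h * (y * Z + y))) * ((y + 1) / (Z ^ 9 : ℕ)) ≤ 18 := by
        have b1 : π * (h * (y * Z + y)) ≤ 4 * ((Z : ℝ) ^ 6 * (Z * Z + Z)) := by
          gcongr; exact Real.pi_lt_four.le
        have b2 : (1 + π * (h * (y * Z + y))) ≤ 9 * (Z : ℝ) ^ 8 := by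
          have c1 : (Z : ℝ) ^ 6 * (Z * Z + Z) ≤ 3 / 2 * (Z : ℝ) ^ 8 := by
            have : (Z : ℝ) * Z + Z ≤ 3 / 2 * (Z : ℝ) ^ 2 := by nlinarith
            calc (Z : ℝ) ^ 6 * (Z * Z + Z) ≤ (Z : ℝ) ^ 6 * (3 / 2 * (Z : ℝ) ^ 2) := by gcongr
              _ = _ := by ring
          have c2 : (1 : ℝ) ≤ (Z : ℝ) ^ 8 := one_le_pow₀ (by linarith)
          linarith
        have b3 : (y + 1) / ((Z ^ 9 : ℕ) : ℝ) ≤ 2 * Z / (Z : ℝ) ^ 9 := by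
          push_cast; gcongr; linarith
        calc _ ≤ (9 * (Z : ℝ) ^ 8) * (2 * Z / (Z : ℝ) ^ 9) := by gcongr
          _ = 18 := by field_simp; norm_num
      have a2 : Real.log ((3 * Z ^ 18 : ℕ) : ℝ) ≤ 18 * Λ := by
        rw [Nat.cast_mul, Real.log_mul (by norm_num) (by positivity), log_natCast_pow]
        have : Real.log ((3 : ℕ) : ℝ) ≤ 2 := by
          have := Real.log_le_sub_one_of_pos (show (0 : ℝ) < 3 by norm_num)
          push_cast; linarith
        push_cast at this ⊢; linarith
      have a3 : 3 * y * (8 + 4 * Real.log ((3 * Z ^ 18 : ℕ) : ℝ)) ≤ 3 * y * (80 * Λ) :=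
        mul_le_mul_of_nonneg_left (by linarith) (by positivity)
      have a4 : 1 ≤ Λ * y := by nlinarith
      have : y / (Z : ℝ) * |sawErr ((Z ^ 9) ^ 2) (y / Z)| + y * |sawErr ((Z ^ 9) ^ 2) y| = Er := rfl
      linarith
  have hmain : ∑ k ∈ Finset.range H, 2 / (π * ((k : ℝ) + 1)) * ((-1) ^ (k + 1) * (P (k + 1)).im) =
      2 / π * x ^ (3 / 4 : ℝ) *
      ∑ n ∈ Finset.Icc 1 (Z ^ 14), coefTrunc Z n * sin (2 * π * √(n * x) + π / 4) := by
    rw [← sum_coefTrunc_eq (by omega) (fun n => sin (2 * π * √(n * x) + π / 4)), Finset.mul_sum,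
      show Finset.Icc 1 (Z ^ 6) = Finset.Ico 1 (H + 1) by ext; simp; omega,
      Finset.sum_Ico_eq_sum_range, Nat.add_sub_cancel]
    apply Finset.sum_congr rfl
    intro k hk
    have hk' : k + 1 ≤ Z ^ 6 := Finset.mem_range.1 hk
    rw [sum_saddleMain_eq hx0 hZ (by omega) hk', add_comm 1 k]
    have key : ∀ S : ℝ, 2 / (π * ((k : ℝ) + 1)) * (((k + 1 : ℕ) : ℝ) * (x ^ (3 / 4 : ℝ) * S)) =
        2 / π * x ^ (3 / 4 : ℝ) * S := by
      intro S
      have : ((k + 1 : ℕ) : ℝ) ≠ 0 := by positivity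
      push_cast at this ⊢
      field_simp
    exact key _
  have hdiff : |∑ k ∈ Finset.range H, 2 / (π * ((k : ℝ) + 1)) * ((-1) ^ (k + 1) * (T (k + 1)).im) -
      ∑ k ∈ Finset.range H, 2 / (π * ((k : ℝ) + 1)) * ((-1) ^ (k + 1) * (P (k + 1)).im)| ≤
      4 * Λ * (Er + 258 * (Λ * y)) := by
    rw [← Finset.sum_sub_distrib]
    refine (Finset.abs_sum_le_sum_abs _ _).trans ?_
    have hb : ∀ k ∈ Finset.range H, |2 / (π * ((k : ℝ) + 1)) * ((-1) ^ (k + 1) * (T (k + 1)).im) -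
        2 / (π * ((k : ℝ) + 1)) * ((-1) ^ (k + 1) * (P (k + 1)).im)| ≤
        (2 / 3 * (Er + 258 * (Λ * y))) * (1 / ((k : ℝ) + 1)) := by
      intro k hk
      have := hTP (k + 1) (by omega) (Finset.mem_range.1 hk)
      rw [← mul_sub, ← mul_sub, abs_mul, abs_mul, abs_pow, abs_neg, abs_one, one_pow, one_mul,
        abs_of_pos (by positivity)]
      have e : 2 / (π * ((k : ℝ) + 1)) ≤ 2 / 3 * (1 / ((k : ℝ) + 1)) := by
        rw [← div_div, mul_one_div]
        gcongr; exact Real.pi_gt_three.le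
      calc _ ≤ (2 / 3 * (1 / ((k : ℝ) + 1))) * (Er + 258 * (Λ * y)) := by gcongr
        _ = _ := by ring
    refine (Finset.sum_le_sum hb).trans ?_
    rw [← Finset.mul_sum]
    have h6 := sum_inv_le_log H
    rw [hH, log_natCast_pow] at h6
    have hE0 : 0 ≤ Er + 258 * (Λ * y) := by positivity
    calc _ ≤ (2 / 3 * (Er + 258 * (Λ * y))) * (6 * Λ) := by
          gcongr
          refine h6.trans ?_
          push_cast; linarith
      _ = _ := by ring
  have hR := abs_R_add_sum_saw_le hx
  have hsplit : 2 * ∑ i ∈ Finset.range ⌊y⌋₊, ((i : ℝ) + 1) * saw (sawArg x (i + 1)) =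
      2 * ∑ i ∈ Finset.range ⌊y⌋₊, ((i : ℝ) + 1) * sawErr H (sawArg x (i + 1)) -
      ∑ k ∈ Finset.range H, 2 / (π * ((k : ℝ) + 1)) * ((-1) ^ (k + 1) * (T (k + 1)).im) := by
    have := sum_sawTrunc_eq x ⌊y⌋₊ H
    rw [sub_eq_add_neg, ← this, ← mul_add, ← Finset.sum_add_distrib]
    congr 1
    apply Finset.sum_congr rfl
    intro i _
    rw [sawErr]; ring
  have herr : |2 * ∑ i ∈ Finset.range ⌊y⌋₊, ((i : ℝ) + 1) * sawErr H (sawArg x (i + 1))| ≤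
      2 * ∑ i ∈ Finset.range Z, ((i : ℝ) + 1) * |sawErr H (sawArg x (i + 1))| := by
    rw [abs_mul, abs_two]
    gcongr
    refine (Finset.abs_sum_le_sum_abs _ _).trans ?_
    have e : ∀ i : ℕ, |((i : ℝ) + 1) * sawErr H (sawArg x (i + 1))| =
        ((i : ℝ) + 1) * |sawErr H (sawArg x (i + 1))| := by
      intro i
      rw [abs_mul, abs_of_pos (by positivity)]
    simp_rw [e]
    apply Finset.sum_le_sum_of_subset_of_nonneg
    · intro i hi
      rw [Finset.mem_range] at hi ⊢
      refine hi.trans_le ?_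
      exact Nat.floor_le_of_le hyZ.le
    · intro i _ _; positivity
  have hEr' : Er ≤ Z * (|sawErr K y| + |sawErr K (y / Z)|) := by
    have h1 : y / Z ≤ Z := (div_le_self (by linarith) (by linarith)).trans hyZ.le
    rw [hEr, mul_add, add_comm]
    gcongr
  rw [hmain] at hdiff
  rw [hsplit] at hR
  have hfinal : 4 * Λ * (Er + 258 * (Λ * y)) ≤
      4 * Λ * Z * (|sawErr K y| + |sawErr K (y / Z)|) + 1032 * Λ ^ 2 * y := by
    have := mul_le_mul_of_nonneg_left hEr' (by positivity : 0 ≤ 4 * Λ)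
    nlinarith
  have h33 : 33 * y ≤ 33 * Λ ^ 2 * y := by
    have : 1 ≤ Λ ^ 2 := one_le_pow₀ hΛ1
    nlinarith
  have hpos : 0 ≤ Λ ^ 2 * y := by positivity
  rw [voronoiErr]
  rw [abs_le] at hR hdiff herr ⊢
  constructor <;> linarith [hR.1, hR.2, hdiff.1, hdiff.2, herr.1, herr.2]

theorem measurable_sawArg (c : ℝ) : Measurable fun x => sawArg x c := by
  unfold sawArg; fun_prop

theorem measurable_voronoiErr (Z : ℕ) : Measurable (voronoiErr Z) := by
  have h1 := measurable_sawErr (Z ^ 6)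
  have h2 := measurable_sawErr ((Z ^ 9) ^ 2)
  have h3 : Measurable fun x : ℝ => √x := Real.continuous_sqrt.measurable
  unfold voronoiErr
  refine ((Finset.measurable_sum _ fun i _ => ?_).const_mul _).add (Measurable.const_mul ?_ _)
  · exact ((h1.comp (measurable_sawArg _)).abs).const_mul _
  · exact (h2.comp h3).abs.add (h2.comp (h3.div_const _)).abs

theorem voronoiErr_nonneg (Z : ℕ) (x : ℝ) : 0 ≤ voronoiErr Z x := by
  have := log_natCast_nonneg Z
  unfold voronoiErr
  positivity

theorem voronoiErr_le (Z : ℕ) (x : ℝ) :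
    voronoiErr Z x ≤ 160 * (1 + Real.log Z) ^ 2 * Z ^ 2 := by
  have hl := log_natCast_nonneg Z
  rcases Nat.eq_zero_or_pos Z with rfl | hZ
  · simp [voronoiErr]
  have hZ1 : (1 : ℝ) ≤ Z := by exact_mod_cast hZ
  set Λ := 1 + Real.log Z with hΛ
  have hΛ1 : 1 ≤ Λ := by linarith
  have h1 : ∀ u, |sawErr (Z ^ 6) u| ≤ 6 * Λ := by
    intro u
    refine (abs_sawErr_le _ _).trans ?_
    rw [log_natCast_pow]; push_cast; linarith
  have h2 : ∀ u, |sawErr ((Z ^ 9) ^ 2) u| ≤ 18 * Λ := by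
    intro u
    refine (abs_sawErr_le _ _).trans ?_
    rw [← pow_mul, log_natCast_pow]; push_cast; linarith
  have h3 : ∑ i ∈ Finset.range Z, ((i : ℝ) + 1) * |sawErr (Z ^ 6) (sawArg x (i + 1))| ≤
      ∑ _i ∈ Finset.range Z, (Z : ℝ) * (6 * Λ) := by
    apply Finset.sum_le_sum
    intro i hi
    have : (i : ℝ) + 1 ≤ Z := by exact_mod_cast Finset.mem_range.1 hi
    exact mul_le_mul this (h1 _) (abs_nonneg _) (by positivity)
  rw [Finset.sum_const, Finset.card_range, nsmul_eq_mul] at h3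
  have h4 : 4 * Λ * Z * (|sawErr ((Z ^ 9) ^ 2) √x| + |sawErr ((Z ^ 9) ^ 2) (√x / Z)|) ≤
      4 * Λ * Z * (18 * Λ + 18 * Λ) := by
    gcongr <;> exact h2 _
  unfold voronoiErr
  have h5 : Λ * (Z : ℝ) ^ 2 ≤ Λ ^ 2 * (Z : ℝ) ^ 2 := by
    gcongr; nlinarith
  have h6 : Λ ^ 2 * (Z : ℝ) ≤ Λ ^ 2 * (Z : ℝ) ^ 2 := by
    gcongr; nlinarith
  nlinarith

theorem integral_sawErr_sawArg_sq_le {K : ℕ} (hK : 0 < K) {c X : ℝ} (hc : 0 < c) (hX : 1 ≤ X) :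
    ∫ x in (1 : ℝ)..X, sawErr K (sawArg x c) ^ 2 ≤ (X + 2 * c) / K := by
  have e : ∀ x, sawArg x c = (2 * c)⁻¹ * x + (1 - c) / 2 := by
    intro x; rw [sawArg]; field_simp; ring
  simp_rw [e]
  rw [intervalIntegral.integral_comp_mul_add (fun u => sawErr K u ^ 2) (by positivity), inv_inv, smul_eq_mul]
  have hK' : (0 : ℝ) < K := by exact_mod_cast hK
  have hc2 : 0 < (2 * c)⁻¹ := by positivity
  have := integral_sawErr_sq_interval_le hK (a := (2 * c)⁻¹ * 1 + (1 - c) / 2)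
    (b := (2 * c)⁻¹ * X + (1 - c) / 2) (by gcongr)
  calc _ ≤ 2 * c * (((2 * c)⁻¹ * X + (1 - c) / 2 - ((2 * c)⁻¹ * 1 + (1 - c) / 2) + 1) / K) := by gcongr
    _ = (X - 1 + 2 * c) / K := by field_simp; ring
    _ ≤ _ := by gcongr; linarith

theorem integral_sawErr_sqrt_sq_le {K : ℕ} (hK : 0 < K) {s X : ℝ} (hs : 0 < s) (hX : 1 ≤ X) :
    ∫ x in (1 : ℝ)..X, sawErr K (√x / s) ^ 2 ≤ 2 * (X + √X * s) / K := by
  have hX0 : 0 < X := by linarith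
  have hy1 : 1 ≤ √X := Real.one_le_sqrt.2 hX
  have hK' : (0 : ℝ) < K := by exact_mod_cast hK
  have hsub := intervalIntegral.integral_comp_mul_deriv_of_deriv_nonneg (a := 1) (b := √X)
    (f := fun u : ℝ => u ^ 2) (f' := fun u => 2 * u) (g := fun x => sawErr K (√x / s) ^ 2)
    (by fun_prop)
    (by
      intro u _
      simpa using hasDerivAt_pow 2 u)
    (by
      intro u hu
      rw [min_eq_left hy1] at hu
      linarith [hu.1])
  rw [one_pow, Real.sq_sqrt hX0.le] at hsub
  rw [← hsub]
  have hm : Measurable fun u : ℝ => sawErr K (u / s) :=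
    (measurable_sawErr K).comp (measurable_id.div_const _)
  have hb : ∀ u, |sawErr K (u / s) ^ 2| ≤ (2 + Real.log K) ^ 2 := by
    intro u
    rw [abs_pow]
    exact pow_le_pow_left₀ (abs_nonneg _) (abs_sawErr_le K _) 2
  have hInt := intervalIntegrable_of_bdd (hm.pow_const 2) hb 1 √X
  have hle : ∫ u in (1 : ℝ)..√X, ((fun x => sawErr K (√x / s) ^ 2) ∘ fun u => u ^ 2) u * (2 * u) ≤
      ∫ u in (1 : ℝ)..√X, (2 * √X) * sawErr K (u / s) ^ 2 := by
    have hsq : ∀ u ∈ Set.uIcc 1 √X, ((fun x => sawErr K (√x / s) ^ 2) ∘ fun u => u ^ 2) u * (2 * u) =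
        sawErr K (u / s) ^ 2 * (2 * u) := by
      intro u hu
      rw [Set.uIcc_of_le hy1] at hu
      simp only [Function.comp]
      rw [Real.sqrt_sq (by linarith [hu.1])]
    rw [intervalIntegral.integral_congr hsq]
    apply intervalIntegral.integral_mono_on hy1
    · exact hInt.mul_continuousOn (by fun_prop)
    · exact hInt.const_mul _
    · intro u hu
      nlinarith [sq_nonneg (sawErr K (u / s)), hu.2]
  refine hle.trans ?_
  rw [intervalIntegral.integral_const_mul]
  have h2 := intervalIntegral.integral_comp_div (a := 1) (b := √X) (fun u => sawErr K u ^ 2) hs.ne'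
  rw [h2, smul_eq_mul]
  have h3 := integral_sawErr_sq_interval_le hK (a := 1 / s) (b := √X / s) (by gcongr)
  calc _ ≤ 2 * √X * (s * ((√X / s - 1 / s + 1) / K)) := by gcongr
    _ = 2 * (√X * (√X - 1 + s)) / K := by field_simp
    _ ≤ _ := by
      gcongr
      nlinarith [Real.mul_self_sqrt hX0.le]

theorem integral_voronoiErr_sq_le {Z : ℕ} (hZ : 2 ≤ Z) {X : ℝ} (hX : 1 ≤ X) (hXZ : X ≤ (Z : ℝ) ^ 2) :
    ∫ x in (1 : ℝ)..X, voronoiErr Z x ^ 2 ≤ 1000 * (1 + Real.log Z) ^ 2 := by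
  have hl := log_natCast_nonneg Z
  have hZ2 : (2 : ℝ) ≤ Z := by exact_mod_cast hZ
  have hZ0 : (0 : ℝ) < Z := by linarith
  have hyZ : √X ≤ Z := by rw [Real.sqrt_le_left hZ0.le]; exact hXZ
  set Λ := 1 + Real.log Z with hΛ
  have hΛ1 : 1 ≤ Λ := by linarith
  set e1 : ℝ → ℝ := fun x => sawErr ((Z ^ 9) ^ 2) (√x / (1 : ℝ)) ^ 2
  set e2 : ℝ → ℝ := fun x => sawErr ((Z ^ 9) ^ 2) (√x / Z) ^ 2
  set f : ℕ → ℝ → ℝ := fun i x => sawErr (Z ^ 6) (sawArg x ((i : ℝ) + 1)) ^ 2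
  have h3 : Measurable fun x : ℝ => √x := Real.continuous_sqrt.measurable
  have hb : ∀ (K : ℕ) u, |sawErr K u ^ 2| ≤ (2 + Real.log K) ^ 2 := by
    intro K u
    rw [abs_pow]
    exact pow_le_pow_left₀ (abs_nonneg _) (abs_sawErr_le K _) 2
  have i1 : IntervalIntegrable e1 volume 1 X :=
    intervalIntegrable_of_bdd (((measurable_sawErr _).comp (h3.div_const _)).pow_const 2) (fun x => hb _ _) 1 X
  have i2 : IntervalIntegrable e2 volume 1 X :=
    intervalIntegrable_of_bdd (((measurable_sawErr _).comp (h3.div_const _)).pow_const 2) (fun x => hb _ _) 1 X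
  have i3 : ∀ i ∈ Finset.range Z, IntervalIntegrable (f i) volume 1 X := fun i _ =>
    intervalIntegrable_of_bdd (((measurable_sawErr _).comp (measurable_sawArg _)).pow_const 2) (fun x => hb _ _) 1 X
  have i3' : IntervalIntegrable (fun x => ∑ i ∈ Finset.range Z, f i x) volume 1 X := by
    have := IntervalIntegrable.sum _ i3
    rwa [Finset.sum_fn] at this
  have hpt : ∀ x, voronoiErr Z x ^ 2 ≤ 12 * (Z : ℝ) ^ 3 * (∑ i ∈ Finset.range Z, f i x) +
      48 * Λ ^ 2 * (Z : ℝ) ^ 2 * (e1 x + e2 x) := by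
    intro x
    have hcs : (∑ i ∈ Finset.range Z, ((i : ℝ) + 1) * |sawErr (Z ^ 6) (sawArg x (i + 1))|) ^ 2 ≤
        (Z : ℝ) ^ 3 * ∑ i ∈ Finset.range Z, f i x := by
      refine (Finset.sum_mul_sq_le_sq_mul_sq _ _ _).trans ?_
      have a : ∑ i ∈ Finset.range Z, ((i : ℝ) + 1) ^ 2 ≤ (Z : ℝ) ^ 3 := by
        have : ∑ i ∈ Finset.range Z, ((i : ℝ) + 1) ^ 2 ≤ ∑ _i ∈ Finset.range Z, (Z : ℝ) ^ 2 := by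
          apply Finset.sum_le_sum
          intro i hi
          have : (i : ℝ) + 1 ≤ Z := by exact_mod_cast Finset.mem_range.1 hi
          gcongr
        rw [Finset.sum_const, Finset.card_range, nsmul_eq_mul] at this
        linarith
      have b : ∑ i ∈ Finset.range Z, |sawErr (Z ^ 6) (sawArg x (i + 1))| ^ 2 = ∑ i ∈ Finset.range Z, f i x := by
        simp_rw [sq_abs]; rfl
      rw [b]
      have : 0 ≤ ∑ i ∈ Finset.range Z, f i x := Finset.sum_nonneg fun i _ => sq_nonneg _
      gcongr
    have he1 : |sawErr ((Z ^ 9) ^ 2) √x| ^ 2 = e1 x := by simp only [e1]; rw [sq_abs, div_one]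
    have he2 : |sawErr ((Z ^ 9) ^ 2) (√x / Z)| ^ 2 = e2 x := by simp only [e2]; rw [sq_abs]
    rw [← he1, ← he2, voronoiErr]
    generalize (∑ i ∈ Finset.range Z, ((i : ℝ) + 1) * |sawErr (Z ^ 6) (sawArg x (i + 1))|) = S at *
    generalize |sawErr ((Z ^ 9) ^ 2) √x| = p
    generalize |sawErr ((Z ^ 9) ^ 2) (√x / Z)| = q
    have h0 : (2 * S + 4 * Λ * Z * (p + q)) ^ 2 ≤ 12 * S ^ 2 + 48 * Λ ^ 2 * (Z : ℝ) ^ 2 * (p ^ 2 + q ^ 2) := by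
      nlinarith [sq_nonneg (2 * S - 4 * Λ * Z * p), sq_nonneg (2 * S - 4 * Λ * Z * q),
        sq_nonneg (4 * Λ * Z * p - 4 * Λ * Z * q)]
    rw [← hΛ]
    linarith
  have hvi : IntervalIntegrable (fun x => voronoiErr Z x ^ 2) volume 1 X := by
    refine intervalIntegrable_of_bdd ((measurable_voronoiErr Z).pow_const 2)
      (B := (160 * (1 + Real.log Z) ^ 2 * Z ^ 2) ^ 2) (fun x => ?_) 1 X
    rw [abs_pow, abs_of_nonneg (voronoiErr_nonneg Z x)]
    exact pow_le_pow_left₀ (voronoiErr_nonneg Z x) (voronoiErr_le Z x) 2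
  have hle := intervalIntegral.integral_mono_on hX hvi
    ((i3'.const_mul (12 * (Z : ℝ) ^ 3)).add ((i1.add i2).const_mul (48 * Λ ^ 2 * (Z : ℝ) ^ 2))) (fun x _ => hpt x)
  refine hle.trans ?_
  rw [intervalIntegral.integral_add (i3'.const_mul _) ((i1.add i2).const_mul _),
    intervalIntegral.integral_const_mul, intervalIntegral.integral_const_mul,
    intervalIntegral.integral_finsetSum i3, intervalIntegral.integral_add i1 i2]
  have b1 := integral_sawErr_sqrt_sq_le (K := (Z ^ 9) ^ 2) (by positivity) one_pos hX
  have b2 := integral_sawErr_sqrt_sq_le (K := (Z ^ 9) ^ 2) (by positivity) hZ0 hX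
  have b3 : ∀ i ∈ Finset.range Z, ∫ x in (1 : ℝ)..X, f i x ≤ 2 * (Z : ℝ) ^ 2 / (Z : ℝ) ^ 6 := by
    intro i hi
    have hi' : (i : ℝ) + 1 ≤ Z := by exact_mod_cast Finset.mem_range.1 hi
    have := integral_sawErr_sawArg_sq_le (K := Z ^ 6) (by positivity) (c := (i : ℝ) + 1) (by positivity) hX
    refine this.trans ?_
    push_cast
    gcongr
    nlinarith
  have b3' := Finset.sum_le_sum b3
  rw [Finset.sum_const, Finset.card_range, nsmul_eq_mul] at b3'
  have c1 : 2 * (X + √X * 1) / (((Z ^ 9) ^ 2 : ℕ) : ℝ) ≤ 4 / (Z : ℝ) ^ 16 := by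
    push_cast
    rw [div_le_div_iff₀ (by positivity) (by positivity)]
    have : (X + √X * 1) ≤ 2 * (Z : ℝ) ^ 2 := by nlinarith
    calc 2 * (X + √X * 1) * (Z : ℝ) ^ 16 ≤ 2 * (2 * (Z : ℝ) ^ 2) * (Z : ℝ) ^ 16 := by gcongr
      _ = _ := by ring
  have c2 : 2 * (X + √X * Z) / (((Z ^ 9) ^ 2 : ℕ) : ℝ) ≤ 4 / (Z : ℝ) ^ 16 := by
    push_cast
    rw [div_le_div_iff₀ (by positivity) (by positivity)]
    have : (X + √X * Z) ≤ 2 * (Z : ℝ) ^ 2 := by nlinarith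
    calc 2 * (X + √X * Z) * (Z : ℝ) ^ 16 ≤ 2 * (2 * (Z : ℝ) ^ 2) * (Z : ℝ) ^ 16 := by gcongr
      _ = _ := by ring
  have d1 : 12 * (Z : ℝ) ^ 3 * ∑ i ∈ Finset.range Z, ∫ x in (1 : ℝ)..X, f i x ≤ 24 := by
    calc _ ≤ 12 * (Z : ℝ) ^ 3 * ((Z : ℝ) * (2 * (Z : ℝ) ^ 2 / (Z : ℝ) ^ 6)) := by gcongr
      _ = 24 := by field_simp; norm_num
  have d2 : 48 * Λ ^ 2 * (Z : ℝ) ^ 2 * ((∫ x in (1 : ℝ)..X, e1 x) + ∫ x in (1 : ℝ)..X, e2 x) ≤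
      384 * Λ ^ 2 := by
    calc _ ≤ 48 * Λ ^ 2 * (Z : ℝ) ^ 2 * (4 / (Z : ℝ) ^ 16 + 4 / (Z : ℝ) ^ 16) := by
          refine mul_le_mul_of_nonneg_left ?_ (by positivity)
          exact add_le_add (b1.trans c1) (b2.trans c2)
      _ = 384 * Λ ^ 2 / (Z : ℝ) ^ 14 := by field_simp; norm_num
      _ ≤ _ := div_le_self (by positivity) (one_le_pow₀ (by linarith))
  nlinarith

/-- The divisor bound `d(n) ≪ n^ε`. -/
theorem exists_card_divisors_le {ε : ℝ} (hε : 0 < ε) :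
    ∃ C : ℝ, 0 < C ∧ ∀ n : ℕ, 1 ≤ n → (n.divisors.card : ℝ) ≤ C * (n : ℝ) ^ ε := by
  set K : ℝ := 1 + 1 / (ε * Real.log 2) with hK
  have hl2 : 0 < Real.log 2 := Real.log_pos one_lt_two
  have hK1 : 1 ≤ K := by rw [hK]; have : 0 ≤ 1 / (ε * Real.log 2) := by positivity
                         linarith
  set P : ℕ := ⌈(2 : ℝ) ^ (1 / ε)⌉₊ with hP
  refine ⟨K ^ P, by positivity, fun n hn => ?_⟩
  have hn0 : n ≠ 0 := by omega
  have hterm : ∀ p ∈ n.primeFactors, ((n.factorization p + 1 : ℕ) : ℝ) ≤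
      (if p < P then K else 1) * ((p : ℝ) ^ (n.factorization p)) ^ ε := by
    intro p hp
    have hp2 : (2 : ℝ) ≤ p := by exact_mod_cast (Nat.prime_of_mem_primeFactors hp).two_le
    generalize n.factorization p = v
    have hp0 : (0 : ℝ) ≤ p := by linarith
    rw [← Real.rpow_natCast, ← Real.rpow_mul hp0]
    split_ifs with h
    · have h1 : (2 : ℝ) ^ (v * ε) ≤ (p : ℝ) ^ ((v : ℝ) * ε) := by gcongr
      have h2 : (v : ℝ) * ε * Real.log 2 + 1 ≤ (2 : ℝ) ^ (v * ε) := by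
        rw [Real.rpow_def_of_pos two_pos]
        have := Real.add_one_le_exp (Real.log 2 * (v * ε))
        linarith
      have h3 : ((v + 1 : ℕ) : ℝ) ≤ K * ((v : ℝ) * ε * Real.log 2 + 1) := by
        have e : K * ((v : ℝ) * ε * Real.log 2 + 1) =
            v + 1 + (v * ε * Real.log 2 + 1 / (ε * Real.log 2)) := by rw [hK]; field_simp; ring
        rw [e]; push_cast
        have : 0 ≤ v * ε * Real.log 2 + 1 / (ε * Real.log 2) := by positivity
        linarith
      refine h3.trans ?_
      gcongr
      exact h2.trans h1
    · rw [one_mul]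
      have h1 : (2 : ℝ) ^ (1 / ε) ≤ p := (Nat.le_ceil _).trans (by exact_mod_cast not_lt.1 h)
      have h2 : (2 : ℝ) ≤ (p : ℝ) ^ ε := by
        calc (2 : ℝ) = ((2 : ℝ) ^ (1 / ε)) ^ ε := by
              rw [← Real.rpow_mul two_pos.le, one_div_mul_cancel hε.ne', Real.rpow_one]
          _ ≤ _ := by gcongr
      rw [mul_comm, Real.rpow_mul hp0, Real.rpow_natCast]
      have h3 : ((v + 1 : ℕ) : ℝ) ≤ (2 : ℝ) ^ v := by exact_mod_cast Nat.lt_two_pow_self (n := v)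
      exact h3.trans (by gcongr)
  rw [Nat.card_divisors hn0, Nat.cast_prod]
  refine (Finset.prod_le_prod (fun _ _ => Nat.cast_nonneg _) hterm).trans ?_
  rw [Finset.prod_mul_distrib, Real.finsetProd_rpow _ _ (fun _ _ => by positivity)]
  have e : ∏ i ∈ n.primeFactors, (i : ℝ) ^ n.factorization i = n := by
    exact_mod_cast Nat.prod_factorization_pow_eq_self hn0
  rw [e]
  gcongr
  rw [Finset.prod_ite, Finset.prod_const, Finset.prod_const_one, mul_one]
  apply pow_le_pow_right₀ hK1
  calc _ ≤ (Finset.range P).card := Finset.card_le_card (by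
        intro p hp; rw [Finset.mem_filter] at hp; exact Finset.mem_range.2 hp.2)
    _ = P := Finset.card_range P

/-- Coefficients of the Voronoi-type expansion, before grouping by `h * r`. -/
noncomputable def coefPairLim (h r : ℕ) : ℝ :=
  if r % 2 = h % 2 then
    (-1) ^ h * saddleWt h r * ((h : ℝ) ^ (-(1 / 4) : ℝ) * (r : ℝ) ^ (-(5 / 4) : ℝ))
  else 0

/-- Coefficients of the Voronoi-type expansion. -/
noncomputable def coef (n : ℕ) : ℝ := ∑ p ∈ n.divisorsAntidiagonal, coefPairLim p.1 p.2

theorem coefTrunc_eq_coef {Z n : ℕ} (hn : n < Z ^ 2) : coefTrunc Z n = coef n := by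
  rw [coefTrunc, coef]
  apply Finset.sum_congr rfl
  rintro ⟨h, r⟩ hp
  rw [Nat.mem_divisorsAntidiagonal] at hp
  obtain ⟨hhr, hn0⟩ := hp
  dsimp only at hhr ⊢
  have hpos : 0 < h * r := by rw [hhr]; omega
  have h1 : 0 < h := Nat.pos_of_mul_pos_right hpos
  have h2 : 0 < r := Nat.pos_of_mul_pos_left hpos
  have hZ : 0 < Z := by
    rcases Nat.eq_zero_or_pos Z with rfl | h
    · simp at hn
    · exact h
  have hrn : r ≤ n := by rw [← hhr]; exact Nat.le_mul_of_pos_left _ h1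
  have hhn : h ≤ n := by rw [← hhr]; exact Nat.le_mul_of_pos_right _ h2
  have h6 : Z ^ 2 ≤ Z ^ 6 := Nat.pow_le_pow_right hZ (by norm_num)
  have h7 : r < h * Z ^ 2 := (hrn.trans_lt hn).trans_le (Nat.le_mul_of_pos_left _ h1)
  have h7' : (r : ℝ) < (h : ℝ) * (Z : ℝ) ^ 2 := by exact_mod_cast h7
  rw [coefPair, coefPairLim, saddleWt_of_lt h7', sub_zero]
  have : h ≤ Z ^ 6 := by omega
  simp only [this, and_true]

theorem wt_mul_rpow_le {h r : ℕ} {W : ℝ} (hr : 0 < h) (hW0 : 0 ≤ W) (hW1 : W ≤ saddleWt h r) :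
    W * ((h : ℝ) ^ (-(1 / 4) : ℝ) * (r : ℝ) ^ (-(5 / 4) : ℝ)) ≤ ((h * r : ℕ) : ℝ) ^ (-(3 / 4) : ℝ) := by
  rcases lt_or_ge r h with hlt | hle
  · have : saddleWt h r = 0 := saddleWt_of_lt (by exact_mod_cast hlt)
    have hW : W = 0 := le_antisymm (hW1.trans this.le) hW0
    rw [hW, zero_mul]; positivity
  · have hh : (0 : ℝ) < h := by exact_mod_cast hr
    have hr' : (h : ℝ) ≤ r := by exact_mod_cast hle
    have hr0 : (0 : ℝ) < r := by linarith
    have e : (h : ℝ) ^ (-(1 / 4) : ℝ) * (r : ℝ) ^ (-(5 / 4) : ℝ) ≤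
        (h : ℝ) ^ (-(3 / 4) : ℝ) * (r : ℝ) ^ (-(3 / 4) : ℝ) := by
      have e1 : (h : ℝ) ^ (-(1 / 4) : ℝ) = (h : ℝ) ^ (-(3 / 4) : ℝ) * (h : ℝ) ^ (1 / 2 : ℝ) := by
        rw [← Real.rpow_add hh]; norm_num
      have e2 : (r : ℝ) ^ (-(3 / 4) : ℝ) = (r : ℝ) ^ (1 / 2 : ℝ) * (r : ℝ) ^ (-(5 / 4) : ℝ) := by
        rw [← Real.rpow_add hr0]; norm_num
      rw [e1, e2, mul_assoc]
      gcongr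
    push_cast
    rw [Real.mul_rpow hh.le hr0.le]
    calc _ ≤ 1 * ((h : ℝ) ^ (-(1 / 4) : ℝ) * (r : ℝ) ^ (-(5 / 4) : ℝ)) := by
          gcongr; exact hW1.trans (saddleWt_le_one _ _)
      _ ≤ _ := by rw [one_mul]; exact e

theorem abs_sum_antidiagonal_le {f : ℕ → ℕ → ℝ} {n : ℕ} (hn : 1 ≤ n)
    (hf : ∀ h r, 0 < h → |f h r| ≤ ((h * r : ℕ) : ℝ) ^ (-(3 / 4) : ℝ)) :
    |∑ p ∈ n.divisorsAntidiagonal, f p.1 p.2| ≤ n.divisors.card * (n : ℝ) ^ (-(3 / 4) : ℝ) := by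
  refine (Finset.abs_sum_le_sum_abs _ _).trans ?_
  have : ∀ p ∈ n.divisorsAntidiagonal, |f p.1 p.2| ≤ (n : ℝ) ^ (-(3 / 4) : ℝ) := by
    intro p hp
    rw [Nat.mem_divisorsAntidiagonal] at hp
    have hpos : 0 < p.1 * p.2 := by rw [hp.1]; omega
    have := hf p.1 p.2 (Nat.pos_of_mul_pos_right hpos)
    rwa [hp.1] at this
  refine (Finset.sum_le_sum this).trans ?_
  rw [Finset.sum_const, nsmul_eq_mul, ← Nat.map_div_right_divisors, Finset.card_map]

theorem abs_coef_le {n : ℕ} (hn : 1 ≤ n) :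
    |coef n| ≤ n.divisors.card * (n : ℝ) ^ (-(3 / 4) : ℝ) := by
  refine abs_sum_antidiagonal_le hn fun h r hh => ?_
  rw [coefPairLim]
  split_ifs
  · rw [abs_mul, abs_mul, abs_pow, abs_neg, abs_one, one_pow, one_mul,
      abs_of_nonneg (saddleWt_nonneg _ _), abs_of_nonneg (by positivity)]
    exact wt_mul_rpow_le hh (saddleWt_nonneg _ _) le_rfl
  · rw [abs_zero]; positivity

theorem abs_coefTrunc_le {Z n : ℕ} (hZ : 1 ≤ Z) (hn : 1 ≤ n) :
    |coefTrunc Z n| ≤ n.divisors.card * (n : ℝ) ^ (-(3 / 4) : ℝ) := by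
  refine abs_sum_antidiagonal_le hn fun h r hh => ?_
  rw [coefPair]
  split_ifs
  · have hZ' : (1 : ℝ) ≤ Z := by exact_mod_cast hZ
    have hle : (h : ℝ) ≤ h * (Z : ℝ) ^ 2 := by
      have : (1 : ℝ) ≤ (Z : ℝ) ^ 2 := one_le_pow₀ hZ'
      nlinarith [(Nat.cast_nonneg h : (0 : ℝ) ≤ h)]
    have h1 : 0 ≤ saddleWt h r - saddleWt (h * (Z : ℝ) ^ 2) r := sub_nonneg.2 (saddleWt_antitone_left hle)
    rw [abs_mul, abs_mul, abs_pow, abs_neg, abs_one, one_pow, one_mul,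
      abs_of_nonneg h1, abs_of_nonneg (by positivity)]
    exact wt_mul_rpow_le hh h1 (by linarith [saddleWt_nonneg (h * (Z : ℝ) ^ 2) r])
  · rw [abs_zero]; positivity

theorem coef_nonpos_of_odd {n : ℕ} (hn : n % 2 = 1) : coef n ≤ 0 := by
  apply Finset.sum_nonpos
  rintro ⟨h, r⟩ hp
  rw [Nat.mem_divisorsAntidiagonal] at hp
  have hh : Odd h := by
    have : Odd (h * r) := by rw [hp.1]; exact Nat.odd_iff.2 hn
    exact (Nat.odd_mul.1 this).1
  rw [coefPairLim]
  split_ifs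
  · rw [hh.neg_one_pow]
    have := saddleWt_nonneg h r
    have h2 : 0 ≤ saddleWt (h : ℝ) r * ((h : ℝ) ^ (-(1 / 4) : ℝ) * (r : ℝ) ^ (-(5 / 4) : ℝ)) := by positivity
    dsimp only
    linarith
  · exact le_rfl

theorem coefPairLim_nonneg {h r : ℕ} (hn : h * r % 2 = 0) : 0 ≤ coefPairLim h r := by
  rw [coefPairLim]
  split_ifs with hc
  · have hh : Even h := by
      have : Even (h * r) := Nat.even_iff.2 hn
      rcases Nat.even_mul.1 this with h1 | h1
      · exact h1
      · rw [Nat.even_iff] at h1 ⊢; omega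
    rw [hh.neg_one_pow]
    have := saddleWt_nonneg h r
    positivity
  · exact le_rfl

theorem coef_nonneg_of_even {n : ℕ} (hn : n % 2 = 0) : 0 ≤ coef n := by
  apply Finset.sum_nonneg
  rintro ⟨h, r⟩ hp
  rw [Nat.mem_divisorsAntidiagonal] at hp
  exact coefPairLim_nonneg (by rw [hp.1]; exact hn)

theorem coef_one_neg : coef 1 < 0 := by
  rw [coef, Nat.divisorsAntidiagonal_one, Finset.sum_singleton, coefPairLim, if_pos rfl, saddleWt,
    if_neg (lt_irrefl _), if_pos rfl]
  norm_num

theorem coef_four_pos : 0 < coef 4 := by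
  have hmem : ((2, 2) : ℕ × ℕ) ∈ Nat.divisorsAntidiagonal 4 := by
    rw [Nat.mem_divisorsAntidiagonal]; norm_num
  refine lt_of_lt_of_le ?_ (Finset.single_le_sum (f := fun p : ℕ × ℕ => coefPairLim p.1 p.2) ?_ hmem)
  · simp only [coefPairLim, saddleWt, if_neg (lt_irrefl _), if_true]
    positivity
  · rintro ⟨h, r⟩ hp
    rw [Nat.mem_divisorsAntidiagonal] at hp
    exact coefPairLim_nonneg (by rw [hp.1])

/-- The contribution of the pair `(m, n)` to the diagonal part of the third moment. -/
noncomputable def resonance (m n : ℕ) : ℝ :=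
  coef m * coef n *
    ∑ k ∈ Finset.Icc 1 (2 * (m + n)), if √(m : ℝ) + √(n : ℝ) = √(k : ℝ) then coef k else 0

theorem add_add_two_mul_sqrt {m n k : ℕ} (h : √(m : ℝ) + √(n : ℝ) = √(k : ℝ)) :
    (k : ℝ) = m + n + 2 * (√(m : ℝ) * √(n : ℝ)) := by
  have h1 : (√(m : ℝ) + √(n : ℝ)) ^ 2 = (k : ℝ) := by rw [h]; exact Real.sq_sqrt (Nat.cast_nonneg k)
  have h2 := Real.sq_sqrt (Nat.cast_nonneg m : (0 : ℝ) ≤ m)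
  have h3 := Real.sq_sqrt (Nat.cast_nonneg n : (0 : ℝ) ≤ n)
  nlinarith

theorem le_two_mul_add_of_sqrt_add_eq {m n k : ℕ} (h : √(m : ℝ) + √(n : ℝ) = √(k : ℝ)) :
    k ≤ 2 * (m + n) := by
  have h1 := add_add_two_mul_sqrt h
  have h2 := Real.sq_sqrt (Nat.cast_nonneg m : (0 : ℝ) ≤ m)
  have h3 := Real.sq_sqrt (Nat.cast_nonneg n : (0 : ℝ) ≤ n)
  have : (k : ℝ) ≤ 2 * (m + n) := by nlinarith [sq_nonneg (√(m : ℝ) - √(n : ℝ))]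
  exact_mod_cast this

theorem add_mod_two_of_sqrt_add_eq {m n k : ℕ} (h : √(m : ℝ) + √(n : ℝ) = √(k : ℝ)) :
    k % 2 = (m + n) % 2 := by
  have h1 := add_add_two_mul_sqrt h
  have h2 := Real.sq_sqrt (Nat.cast_nonneg m : (0 : ℝ) ≤ m)
  have h3 := Real.sq_sqrt (Nat.cast_nonneg n : (0 : ℝ) ≤ n)
  have h4 : ((k : ℝ) - m - n) ^ 2 = 4 * (m * n) := by
    rw [h1]
    calc _ = 4 * (√(m : ℝ) ^ 2 * √(n : ℝ) ^ 2) := by ring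
      _ = _ := by rw [h2, h3]
  have h5 : ((k : ℤ) - m - n) ^ 2 = 4 * (m * n) := by exact_mod_cast h4
  have h6 : Even (((k : ℤ) - m - n) ^ 2) := by rw [h5]; exact ⟨2 * (m * n), by ring⟩
  have h7 : Even ((k : ℤ) - m - n) := (Int.even_pow' two_ne_zero).1 h6
  obtain ⟨r, hr⟩ := h7
  omega

theorem resonance_eq {m n : ℕ} : resonance m n = 0 ∨
    ∃ k : ℕ, 1 ≤ k ∧ √(m : ℝ) + √(n : ℝ) = √(k : ℝ) ∧ resonance m n = coef m * coef n * coef k := by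
  by_cases h : ∃ k ∈ Finset.Icc 1 (2 * (m + n)), √(m : ℝ) + √(n : ℝ) = √(k : ℝ)
  · obtain ⟨k, hk, he⟩ := h
    refine Or.inr ⟨k, (Finset.mem_Icc.1 hk).1, he, ?_⟩
    rw [resonance, Finset.sum_eq_single_of_mem k hk, if_pos he]
    intro j _ hj
    rw [if_neg]
    intro h2
    rw [he] at h2
    apply hj
    have := Real.sqrt_inj (Nat.cast_nonneg k) (Nat.cast_nonneg j) |>.1 h2
    exact_mod_cast this.symm
  · push Not at h
    left
    rw [resonance, Finset.sum_eq_zero, mul_zero]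
    intro k hk
    rw [if_neg (h k hk)]

theorem resonance_nonneg (m n : ℕ) : 0 ≤ resonance m n := by
  rcases @resonance_eq m n with h | ⟨k, _, he, h⟩
  · rw [h]
  · rw [h]
    have hp := add_mod_two_of_sqrt_add_eq he
    rcases Nat.mod_two_eq_zero_or_one m with hm | hm <;>
      rcases Nat.mod_two_eq_zero_or_one n with hn | hn
    · exact mul_nonneg (mul_nonneg (coef_nonneg_of_even hm) (coef_nonneg_of_even hn))
        (coef_nonneg_of_even (by omega))
    · exact mul_nonneg_of_nonpos_of_nonpos
        (mul_nonpos_of_nonneg_of_nonpos (coef_nonneg_of_even hm) (coef_nonpos_of_odd hn))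
        (coef_nonpos_of_odd (by omega))
    · exact mul_nonneg_of_nonpos_of_nonpos
        (mul_nonpos_of_nonpos_of_nonneg (coef_nonpos_of_odd hm) (coef_nonneg_of_even hn))
        (coef_nonpos_of_odd (by omega))
    · exact mul_nonneg (mul_nonneg_of_nonpos_of_nonpos (coef_nonpos_of_odd hm) (coef_nonpos_of_odd hn))
        (coef_nonneg_of_even (by omega))

theorem resonance_one_one_pos : 0 < resonance 1 1 := by
  rw [resonance, Finset.sum_eq_single_of_mem 4 (by decide)]
  · have : √((1 : ℕ) : ℝ) + √((1 : ℕ) : ℝ) = √((4 : ℕ) : ℝ) := by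
      have : √(4 : ℝ) = 2 := by
        rw [show (4 : ℝ) = 2 ^ 2 by norm_num]; exact Real.sqrt_sq (by norm_num)
      push_cast
      rw [Real.sqrt_one, this]; norm_num
    rw [if_pos this]
    exact mul_pos (mul_pos_of_neg_of_neg coef_one_neg coef_one_neg) coef_four_pos
  · intro j hj hj4
    rw [if_neg]
    intro h
    have := add_add_two_mul_sqrt h
    rw [Nat.cast_one, Real.sqrt_one] at this
    apply hj4
    have h5 : (j : ℝ) = 4 := by linarith
    exact_mod_cast h5

theorem coef_zero : coef 0 = 0 := by rw [coef]; simp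

theorem exists_abs_coef_le {ε : ℝ} (hε : 0 < ε) :
    ∃ C > 0, ∀ n : ℕ, 1 ≤ n → |coef n| ≤ C * (n : ℝ) ^ (ε - 3 / 4) := by
  obtain ⟨C, hC, h⟩ := exists_card_divisors_le hε
  refine ⟨C, hC, fun n hn => (abs_coef_le hn).trans ?_⟩
  have hn0 : (0 : ℝ) < n := by exact_mod_cast hn
  calc _ ≤ C * (n : ℝ) ^ ε * (n : ℝ) ^ (-(3 / 4) : ℝ) := by gcongr; exact h n hn
    _ = _ := by rw [mul_assoc, ← Real.rpow_add hn0, sub_eq_add_neg]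

theorem exists_resonance_le : ∃ C > 0, ∀ m n : ℕ, 1 ≤ m → 1 ≤ n →
    resonance m n ≤ C * ((max m n : ℕ) : ℝ) ^ (-(1 / 8) : ℝ) *
      ((m : ℝ) ^ (-(41 / 40) : ℝ) * (n : ℝ) ^ (-(41 / 40) : ℝ)) := by
  obtain ⟨C, hC, h⟩ := exists_abs_coef_le (ε := 1 / 40) (by norm_num)
  refine ⟨C ^ 3, by positivity, fun m n hm hn => ?_⟩
  have hm0 : (0 : ℝ) < m := by exact_mod_cast hm
  have hn0 : (0 : ℝ) < n := by exact_mod_cast hn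
  rcases @resonance_eq m n with h0 | ⟨k, hk, he, h1⟩
  · rw [h0]; positivity
  have hk0 : (0 : ℝ) < k := by exact_mod_cast hk
  have h2 := add_add_two_mul_sqrt he
  have hs : 0 < √(m : ℝ) := Real.sqrt_pos.2 hm0
  have hs' : 0 < √(n : ℝ) := Real.sqrt_pos.2 hn0
  have h3 : ((max m n : ℕ) : ℝ) ≤ k := by
    rw [Nat.cast_max]; apply max_le <;> nlinarith
  have hmx : (0 : ℝ) < ((max m n : ℕ) : ℝ) := by rw [Nat.cast_max]; exact lt_max_of_lt_left hm0
  have h4 : √(m : ℝ) * √(n : ℝ) ≤ k := by nlinarith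
  have h5 : (k : ℝ) ^ (1 / 40 - 3 / 4 : ℝ) ≤ ((max m n : ℕ) : ℝ) ^ (-(1 / 8) : ℝ) *
      ((m : ℝ) ^ (-(3 / 10) : ℝ) * (n : ℝ) ^ (-(3 / 10) : ℝ)) := by
    have e : (1 / 40 - 3 / 4 : ℝ) = -(1 / 8) + -(6 / 10) := by norm_num
    rw [e, Real.rpow_add hk0]
    have a1 : (k : ℝ) ^ (-(1 / 8) : ℝ) ≤ ((max m n : ℕ) : ℝ) ^ (-(1 / 8) : ℝ) :=
      Real.rpow_le_rpow_of_nonpos hmx h3 (by norm_num)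
    have a2 : (k : ℝ) ^ (-(6 / 10) : ℝ) ≤ (√(m : ℝ) * √(n : ℝ)) ^ (-(6 / 10) : ℝ) :=
      Real.rpow_le_rpow_of_nonpos (by positivity) h4 (by norm_num)
    have a3 : (√(m : ℝ) * √(n : ℝ)) ^ (-(6 / 10) : ℝ)
        = (m : ℝ) ^ (-(3 / 10) : ℝ) * (n : ℝ) ^ (-(3 / 10) : ℝ) := by
      rw [Real.mul_rpow hs.le hs'.le, Real.sqrt_eq_rpow, Real.sqrt_eq_rpow, ← Real.rpow_mul hm0.le,
        ← Real.rpow_mul hn0.le]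
      norm_num
    rw [← a3]
    gcongr
  calc resonance m n ≤ |coef m| * |coef n| * |coef k| := by
        rw [h1, ← abs_mul, ← abs_mul]; exact le_abs_self _
    _ ≤ (C * (m : ℝ) ^ (1 / 40 - 3 / 4 : ℝ)) * (C * (n : ℝ) ^ (1 / 40 - 3 / 4 : ℝ)) *
        (C * (((max m n : ℕ) : ℝ) ^ (-(1 / 8) : ℝ) *
      ((m : ℝ) ^ (-(3 / 10) : ℝ) * (n : ℝ) ^ (-(3 / 10) : ℝ)))) := by
        have := h m hm
        have := h n hn
        have := (h k hk).trans (mul_le_mul_of_nonneg_left h5 hC.le)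
        gcongr
    _ = C ^ 3 * ((max m n : ℕ) : ℝ) ^ (-(1 / 8) : ℝ) *
        (((m : ℝ) ^ (1 / 40 - 3 / 4 : ℝ) * (m : ℝ) ^ (-(3 / 10) : ℝ)) *
          ((n : ℝ) ^ (1 / 40 - 3 / 4 : ℝ) * (n : ℝ) ^ (-(3 / 10) : ℝ))) := by ring
    _ = _ := by
        rw [← Real.rpow_add hm0, ← Real.rpow_add hn0]; norm_num

theorem resonance_zero_left (n : ℕ) : resonance 0 n = 0 := by rw [resonance, coef_zero]; ring

theorem resonance_zero_right (m : ℕ) : resonance m 0 = 0 := by rw [resonance, coef_zero]; ring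

theorem summable_rpow_prod : Summable fun p : ℕ × ℕ =>
    (p.1 : ℝ) ^ (-(41 / 40) : ℝ) * (p.2 : ℝ) ^ (-(41 / 40) : ℝ) := by
  have h : Summable fun n : ℕ => (n : ℝ) ^ (-(41 / 40) : ℝ) :=
    Real.summable_nat_rpow.2 (by norm_num)
  exact h.mul_of_nonneg h (fun n => by positivity) (fun n => by positivity)

theorem exists_resonance_sum : ∃ D > 0, ∃ C > 0, ∀ M : ℕ, 1 ≤ M →
    |(∑ m ∈ Finset.Icc 1 M, ∑ n ∈ Finset.Icc 1 M, resonance m n) - D|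
      ≤ C * (M : ℝ) ^ (-(1 / 8) : ℝ) := by
  obtain ⟨C, hC, h⟩ := exists_resonance_le
  set g : ℕ × ℕ → ℝ := fun p => (p.1 : ℝ) ^ (-(41 / 40) : ℝ) * (p.2 : ℝ) ^ (-(41 / 40) : ℝ) with hg
  have hgs : Summable g := summable_rpow_prod
  have hg0 : ∀ p, 0 ≤ g p := fun p => by positivity
  set q : ℕ × ℕ → ℝ := fun p => resonance p.1 p.2 with hq
  have hq0 : ∀ p, 0 ≤ q p := fun p => resonance_nonneg _ _
  have hqM : ∀ M : ℕ, 1 ≤ M → ∀ p : ℕ × ℕ, M ≤ max p.1 p.2 →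
      q p ≤ C * (M : ℝ) ^ (-(1 / 8) : ℝ) * g p := by
    intro M hM p hp
    have hM0 : (0 : ℝ) < M := by exact_mod_cast hM
    rcases Nat.eq_zero_or_pos p.1 with h1 | h1
    · simp only [hq, h1, resonance_zero_left]; positivity
    rcases Nat.eq_zero_or_pos p.2 with h2 | h2
    · simp only [hq, h2, resonance_zero_right]; positivity
    refine (h p.1 p.2 h1 h2).trans ?_
    have : ((max p.1 p.2 : ℕ) : ℝ) ^ (-(1 / 8) : ℝ) ≤ (M : ℝ) ^ (-(1 / 8) : ℝ) :=
      Real.rpow_le_rpow_of_nonpos hM0 (by exact_mod_cast hp) (by norm_num)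
    have := hg0 p
    gcongr
  have hqs : Summable q := by
    refine Summable.of_nonneg_of_le hq0 (fun p => ?_) (hgs.mul_left C)
    rcases Nat.eq_zero_or_pos p.1 with h1 | h1
    · simp only [hq, h1, resonance_zero_left]; positivity
    have := hqM 1 le_rfl p (le_max_of_le_left h1)
    simpa using this
  refine ⟨∑' p, q p, hqs.tsum_pos hq0 (1, 1) resonance_one_one_pos, C * (∑' p, g p) + 1, ?_, ?_⟩
  · have : 0 ≤ ∑' p, g p := tsum_nonneg hg0
    positivity
  intro M hM
  rw [← Finset.sum_product' (f := fun m n => resonance m n),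
    ← hqs.sum_add_tsum_subtype_compl (Finset.Icc 1 M ×ˢ Finset.Icc 1 M)]
  rw [show ∀ a b : ℝ, |a - (a + b)| = |b| by intro a b; rw [← abs_neg]; ring_nf]
  have hnn : 0 ≤ ∑' p : {p // p ∉ Finset.Icc 1 M ×ˢ Finset.Icc 1 M}, q p := tsum_nonneg fun p => hq0 _
  rw [abs_of_nonneg hnn]
  have hM0 : (0 : ℝ) < M := by exact_mod_cast hM
  calc _ ≤ ∑' p : {p // p ∉ Finset.Icc 1 M ×ˢ Finset.Icc 1 M},
        C * (M : ℝ) ^ (-(1 / 8) : ℝ) * g p := by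
        refine Summable.tsum_le_tsum ?_ (hqs.subtype _) ((hgs.mul_left _).subtype _)
        rintro ⟨p, hp⟩
        rcases Nat.eq_zero_or_pos p.1 with h1 | h1
        · simp only [hq, h1, resonance_zero_left]; positivity
        rcases Nat.eq_zero_or_pos p.2 with h2 | h2
        · simp only [hq, h2, resonance_zero_right]; positivity
        refine hqM M hM p ?_
        by_contra hlt
        push Not at hlt
        rw [max_lt_iff] at hlt
        apply hp
        rw [Finset.mem_product, Finset.mem_Icc, Finset.mem_Icc]
        omega
    _ = C * (M : ℝ) ^ (-(1 / 8) : ℝ) * ∑' p : {p // p ∉ Finset.Icc 1 M ×ˢ Finset.Icc 1 M}, g p :=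
        tsum_mul_left
    _ ≤ C * (M : ℝ) ^ (-(1 / 8) : ℝ) * ∑' p, g p := by
        gcongr
        exact hgs.tsum_subtype_le g _ hg0
    _ ≤ _ := by
        have : 0 ≤ (M : ℝ) ^ (-(1 / 8) : ℝ) := by positivity
        nlinarith

/-- The weighted oscillatory integral `∫₁^X x^k sin(2πs√x + ψ) dx`. -/
noncomputable def oscInt (k X s ψ : ℝ) : ℝ := ∫ x in (1 : ℝ)..X, x ^ k * Real.sin (2 * π * s * √x + ψ)

theorem abs_oscInt_le_of_pos {k X s : ℝ} (hk : 0 ≤ k) (hX : 1 ≤ X) (hs : 0 < s) (ψ : ℝ) :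
    |oscInt k X s ψ| ≤ X ^ (k + 1 / 2) * s⁻¹ := by
  have hpi := Real.pi_pos
  have hpi3 := Real.pi_gt_three
  have key := norm_integral_osc_le hX (w := fun x => x ^ (k + 1 / 2) / (π * s))
    (w' := fun x => (k + 1 / 2) * x ^ (k + 1 / 2 - 1) / (π * s))
    (θ := fun x => 2 * π * s * √x + ψ) (θ' := fun x => 2 * π * s * (1 / (2 * √x)))
    (fun x hx => ((Real.hasDerivAt_rpow_const (Or.inl (by linarith [hx.1] : x ≠ 0))).div_const _))
    (fun x hx => ((Real.hasDerivAt_sqrt (by linarith [hx.1] : x ≠ 0)).const_mul _).add_const _)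
    (by
      refine ContinuousOn.div_const (ContinuousOn.mul continuousOn_const ?_) _
      exact ContinuousOn.rpow_const continuousOn_id fun x hx => Or.inl (by simpa using (by linarith [hx.1] : x ≠ 0)))
    (by
      refine ContinuousOn.mul continuousOn_const ?_
      refine ContinuousOn.div continuousOn_const (by fun_prop) fun x hx => ?_
      have : 0 < √x := Real.sqrt_pos.2 (by linarith [hx.1])
      positivity)
    (fun x hx => by
      have : 0 < x := by linarith [hx.1]
      positivity)
  have e : oscInt k X s ψ = (∫ x in (1 : ℝ)..X, ((x ^ (k + 1 / 2) / (π * s) *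
      (2 * π * s * (1 / (2 * √x))) : ℝ) : ℂ) * Complex.exp (I * ((2 * π * s * √x + ψ : ℝ) : ℂ))).im := by
    have hInt : IntervalIntegrable (fun x : ℝ => ((x ^ (k + 1 / 2) / (π * s) *
      (2 * π * s * (1 / (2 * √x))) : ℝ) : ℂ) * Complex.exp (I * ((2 * π * s * √x + ψ : ℝ) : ℂ))) volume 1 X := by
      apply ContinuousOn.intervalIntegrable
      rw [Set.uIcc_of_le hX]
      refine ContinuousOn.mul ?_ (by fun_prop)
      refine Complex.continuous_ofReal.comp_continuousOn ?_
      refine ContinuousOn.mul (ContinuousOn.div_const ?_ _) (ContinuousOn.mul continuousOn_const ?_)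
      · exact ContinuousOn.rpow_const continuousOn_id fun x hx => Or.inl (by simpa using (by linarith [hx.1] : x ≠ 0))
      · refine ContinuousOn.div continuousOn_const (by fun_prop) fun x hx => ?_
        have : 0 < √x := Real.sqrt_pos.2 (by linarith [hx.1])
        positivity
    have := Complex.imCLM.intervalIntegral_comp_comm hInt
    rw [← Complex.imCLM_apply, ← this, oscInt]
    apply intervalIntegral.integral_congr
    intro x hx
    rw [Set.uIcc_of_le hX] at hx
    have hx0 : 0 < x := by linarith [hx.1]
    have hsq : 0 < √x := Real.sqrt_pos.2 hx0
    have hss : √x * √x = x := Real.mul_self_sqrt hx0.le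
    beta_reduce
    rw [Complex.imCLM_apply, mul_comm I, Complex.im_ofReal_mul, Complex.exp_ofReal_mul_I_im]
    congr 1
    rw [Real.rpow_add hx0, ← Real.sqrt_eq_rpow]
    field_simp
  rw [e]
  refine (Complex.abs_im_le_norm _).trans (key.trans ?_)
  have hX0 : (0 : ℝ) < X := by linarith
  rw [Real.one_rpow, abs_of_nonneg (by positivity), abs_of_nonneg (by positivity)]
  rw [show ∀ a b : ℝ, a + b + (b - a) = 2 * b by intro a b; ring]
  rw [show 2 * (X ^ (k + 1 / 2) / (π * s)) = (2 / π) * (X ^ (k + 1 / 2) * s⁻¹) by field_simp]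
  have : 2 / π ≤ 1 := by rw [div_le_one hpi]; linarith
  have h0 : 0 ≤ X ^ (k + 1 / 2) * s⁻¹ := by positivity
  nlinarith

theorem abs_oscInt_le {k X s : ℝ} (hk : 0 ≤ k) (hX : 1 ≤ X) (hs : s ≠ 0) (ψ : ℝ) :
    |oscInt k X s ψ| ≤ X ^ (k + 1 / 2) * |s|⁻¹ := by
  rcases lt_or_gt_of_ne hs with h | h
  · rw [abs_of_neg h]
    have := abs_oscInt_le_of_pos hk hX (neg_pos.2 h) (-ψ)
    have e : oscInt k X (-s) (-ψ) = - oscInt k X s ψ := by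
      rw [oscInt, oscInt, ← intervalIntegral.integral_neg]
      congr 1; ext x
      rw [show 2 * π * -s * √x + -ψ = -(2 * π * s * √x + ψ) by ring, Real.sin_neg]; ring
    rwa [e, abs_neg] at this
  · rw [abs_of_pos h]; exact abs_oscInt_le_of_pos hk hX h ψ

theorem oscInt_zero {k X : ℝ} (hk : 0 ≤ k) (ψ : ℝ) :
    oscInt k X 0 ψ = Real.sin ψ * ((X ^ (k + 1) - 1) / (k + 1)) := by
  rw [oscInt]
  simp only [mul_zero, zero_mul, zero_add]
  rw [intervalIntegral.integral_mul_const, integral_rpow (Or.inl (by linarith)), Real.one_rpow, mul_comm]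

theorem abs_oscInt_sub_le {k X : ℝ} (hk : 0 ≤ k) (hX : 1 ≤ X) (s ψ : ℝ) :
    |oscInt k X s ψ - if s = 0 then Real.sin ψ * ((X ^ (k + 1) - 1) / (k + 1)) else 0|
      ≤ X ^ (k + 1 / 2) * |s|⁻¹ := by
  split_ifs with h
  · rw [h, oscInt_zero hk, sub_self, abs_zero]; simp
  · rw [sub_zero]; exact abs_oscInt_le hk hX h ψ

theorem sum_rpow_neg_le {α : ℝ} (h0 : 0 ≤ α) (h1 : α < 1) (K : ℕ) :
    ∑ n ∈ Finset.Icc 1 K, (n : ℝ) ^ (-α) ≤ (K : ℝ) ^ (1 - α) / (1 - α) := by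
  have hα : 0 < 1 - α := by linarith
  induction K with
  | zero => simp [Real.zero_rpow hα.ne']
  | succ K ih =>
    rw [Finset.sum_Icc_succ_top (by omega)]
    have hK : (0 : ℝ) < ((K + 1 : ℕ) : ℝ) := by positivity
    have hs : (-1 : ℝ) ≤ -(1 / ((K + 1 : ℕ) : ℝ)) := by
      rw [neg_le_neg_iff, div_le_one hK]; push_cast; linarith [(Nat.cast_nonneg K : (0 : ℝ) ≤ K)]
    have hb := rpow_one_add_le_one_add_mul_self hs hα.le (by linarith : 1 - α ≤ 1)
    have e : (K : ℝ) ^ (1 - α) = ((K + 1 : ℕ) : ℝ) ^ (1 - α) * (1 + -(1 / ((K + 1 : ℕ) : ℝ))) ^ (1 - α) := by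
      rw [← Real.mul_rpow hK.le (by linarith)]
      congr 1; field_simp; push_cast; ring
    have e2 : ((K + 1 : ℕ) : ℝ) ^ (-α) = ((K + 1 : ℕ) : ℝ) ^ (1 - α) * (1 / ((K + 1 : ℕ) : ℝ)) := by
      rw [show -α = (1 - α) - 1 by ring, Real.rpow_sub_one hK.ne']; ring_nf
    rw [le_div_iff₀ hα] at ih ⊢
    have hp : 0 ≤ ((K + 1 : ℕ) : ℝ) ^ (1 - α) := by positivity
    have := mul_le_mul_of_nonneg_left hb hp
    rw [← e] at this
    rw [e2]
    nlinarith

theorem rpow_neg_three_halves_le {N : ℕ} (hN : 1 ≤ N) :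
    ((N + 1 : ℕ) : ℝ) ^ (-(3 / 2) : ℝ) ≤ 2 * (1 / √(N : ℝ)) - 2 * (1 / √((N + 1 : ℕ) : ℝ)) := by
  have hn0 : (0 : ℝ) < N := by exact_mod_cast hN
  have a := Real.sqrt_pos.2 hn0
  have a2 : 0 < √((N + 1 : ℕ) : ℝ) := Real.sqrt_pos.2 (by positivity)
  have s1 := Real.sq_sqrt hn0.le
  have s2 := Real.sq_sqrt (by positivity : (0 : ℝ) ≤ ((N + 1 : ℕ) : ℝ))
  have e : ((N + 1 : ℕ) : ℝ) ^ (-(3 / 2) : ℝ) = 1 / √((N + 1 : ℕ) : ℝ) ^ 3 := by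
    rw [Real.sqrt_eq_rpow, ← Real.rpow_natCast, ← Real.rpow_mul (by positivity), Real.rpow_neg (by positivity)]
    norm_num
  rw [e]
  have hle : √(N : ℝ) ≤ √((N + 1 : ℕ) : ℝ) := Real.sqrt_le_sqrt (by push_cast; linarith)
  push_cast at s2
  push_cast at hle a2 ⊢
  set u := √(N : ℝ)
  set v := √((N : ℝ) + 1)
  have : (v - u) * (v + u) = 1 := by nlinarith
  have e3 : 2 * (1 / u) - 2 * (1 / v) = 2 * (v - u) / (u * v) := by field_simp
  rw [e3, div_le_div_iff₀ (by positivity) (by positivity), ← this]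
  have : 0 ≤ v - u := by linarith
  have h4 : (v + u) * (u * v) ≤ 2 * v ^ 3 := by
    calc (v + u) * (u * v) ≤ (v + v) * (v * v) := by gcongr
      _ = _ := by ring
  nlinarith

theorem sum_rpow_tail_le {N : ℕ} (hN : 1 ≤ N) (K : ℕ) :
    ∑ n ∈ Finset.Ioc N K, (n : ℝ) ^ (-(3 / 2) : ℝ) ≤ 2 * (N : ℝ) ^ (-(1 / 2) : ℝ) := by
  rcases lt_or_ge K N with h | h
  · rw [Finset.Ioc_eq_empty (by omega)]; simp; positivity
  suffices h2 : ∑ n ∈ Finset.Ioc N K, (n : ℝ) ^ (-(3 / 2) : ℝ)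
      ≤ 2 * (1 / √(N : ℝ)) - 2 * (1 / √(K : ℝ)) by
    have e : (N : ℝ) ^ (-(1 / 2) : ℝ) = 1 / √(N : ℝ) := by
      rw [Real.rpow_neg (by positivity), ← Real.sqrt_eq_rpow, one_div]
    rw [e]
    have : 0 ≤ 2 * (1 / √(K : ℝ)) := by positivity
    linarith
  induction K, h using Nat.le_induction with
  | base => simp
  | succ K hK ih =>
    rw [Finset.sum_Ioc_succ_top hK]
    have := rpow_neg_three_halves_le (hN.trans hK)
    linarith

/-- The trigonometric sums occurring in the Voronoi-type expansion. -/
noncomputable def sinSum (b : ℕ → ℝ) (P : Finset ℕ) (x : ℝ) : ℝ :=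
  ∑ n ∈ P, b n * Real.sin (2 * π * √(n : ℝ) * √x + π / 4)

theorem continuous_sinSum (b : ℕ → ℝ) (P : Finset ℕ) : Continuous (sinSum b P) := by
  unfold sinSum; fun_prop

theorem sum_Icc_inv_le_log (K : ℕ) : ∑ j ∈ Finset.Icc 1 K, ((j : ℝ))⁻¹ ≤ 1 + Real.log K := by
  refine le_trans (le_of_eq ?_) (sum_inv_le_log K)
  rw [Finset.range_eq_Ico, ← Finset.Ico_add_one_right_eq_Icc, Finset.sum_Ico_eq_sum_range, Finset.range_eq_Ico]
  apply Finset.sum_congr rfl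
  intro k _
  push_cast
  rw [one_div, add_comm]

theorem sum_inv_abs_sub_le {K n : ℕ} (hn : n ≤ K) :
    ∑ m ∈ Finset.Icc 1 K, |(m : ℝ) - n|⁻¹ ≤ 2 * (1 + Real.log K) := by
  have h1 : ∀ m ∈ Finset.Icc 1 K, |(m : ℝ) - n|⁻¹ ≤ ∑ j ∈ Finset.Icc 1 K,
      ((j : ℝ)⁻¹ * (if m + j = n then 1 else 0) + (j : ℝ)⁻¹ * (if n + j = m then 1 else 0)) := by
    intro m hm
    rw [Finset.mem_Icc] at hm
    rcases lt_trichotomy m n with h | h | h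
    · obtain ⟨j, rfl⟩ := Nat.exists_eq_add_of_lt h
      refine le_trans ?_ (Finset.single_le_sum (fun i _ => by positivity) (Finset.mem_Icc.2
        ⟨by omega, by omega⟩ : j + 1 ∈ Finset.Icc 1 K))
      rw [if_pos (by omega), if_neg (by omega)]
      push_cast
      rw [show (m : ℝ) - (m + j + 1) = -(j + 1) by ring, abs_neg, abs_of_nonneg (by positivity)]
      simp
    · rw [h]; simp; exact Finset.sum_nonneg fun i _ => by positivity
    · obtain ⟨j, rfl⟩ := Nat.exists_eq_add_of_lt h
      refine le_trans ?_ (Finset.single_le_sum (fun i _ => by positivity) (Finset.mem_Icc.2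
        ⟨by omega, by omega⟩ : j + 1 ∈ Finset.Icc 1 K))
      rw [if_neg (by omega), if_pos (by omega)]
      push_cast
      rw [show (n + j + 1 : ℝ) - n = (j + 1) by ring, abs_of_nonneg (by positivity)]
      simp
  refine (Finset.sum_le_sum h1).trans ?_
  rw [Finset.sum_comm]
  have h2 : ∀ j ∈ Finset.Icc 1 K, ∑ m ∈ Finset.Icc 1 K,
      ((j : ℝ)⁻¹ * (if m + j = n then 1 else 0) + (j : ℝ)⁻¹ * (if n + j = m then 1 else 0))
      ≤ (j : ℝ)⁻¹ * 2 := by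
    intro j _
    rw [Finset.sum_add_distrib, ← Finset.mul_sum, ← Finset.mul_sum, ← mul_add]
    apply mul_le_mul_of_nonneg_left _ (by positivity)
    rw [Finset.sum_boole, Finset.sum_boole]
    have a : (Finset.filter (fun m => m + j = n) (Finset.Icc 1 K)).card ≤ 1 :=
      Finset.card_le_one.2 fun a ha b hb => by
        rw [Finset.mem_filter] at ha hb; omega
    have b : (Finset.filter (fun m => n + j = m) (Finset.Icc 1 K)).card ≤ 1 :=
      Finset.card_le_one.2 fun a ha b hb => by
        rw [Finset.mem_filter] at ha hb; omega
    have a' : ((Finset.filter (fun m => m + j = n) (Finset.Icc 1 K)).card : ℝ) ≤ 1 := by exact_mod_cast a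
    have b' : ((Finset.filter (fun m => n + j = m) (Finset.Icc 1 K)).card : ℝ) ≤ 1 := by exact_mod_cast b
    linarith
  refine (Finset.sum_le_sum h2).trans ?_
  rw [← Finset.sum_mul]
  linarith [sum_Icc_inv_le_log K]

theorem sum_sum_inv_mul_inv_le (K : ℕ) :
    ∑ m ∈ Finset.Icc 1 K, ∑ n ∈ Finset.Icc 1 K, ((m : ℝ)⁻¹ + (n : ℝ)⁻¹) * |(m : ℝ) - n|⁻¹
      ≤ 4 * (1 + Real.log K) ^ 2 := by
  have h1 : ∑ m ∈ Finset.Icc 1 K, ∑ n ∈ Finset.Icc 1 K, (n : ℝ)⁻¹ * |(m : ℝ) - n|⁻¹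
      ≤ 2 * (1 + Real.log K) ^ 2 := by
    rw [Finset.sum_comm]
    calc _ ≤ ∑ n ∈ Finset.Icc 1 K, (n : ℝ)⁻¹ * (2 * (1 + Real.log K)) := by
          apply Finset.sum_le_sum
          intro n hn
          rw [← Finset.mul_sum]
          exact mul_le_mul_of_nonneg_left (sum_inv_abs_sub_le (Finset.mem_Icc.1 hn).2) (by positivity)
      _ ≤ _ := by
          rw [← Finset.sum_mul]
          nlinarith [sum_Icc_inv_le_log K, log_natCast_nonneg K]
  have h2 : ∑ m ∈ Finset.Icc 1 K, ∑ n ∈ Finset.Icc 1 K, (m : ℝ)⁻¹ * |(m : ℝ) - n|⁻¹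
      = ∑ m ∈ Finset.Icc 1 K, ∑ n ∈ Finset.Icc 1 K, (n : ℝ)⁻¹ * |(m : ℝ) - n|⁻¹ := by
    rw [Finset.sum_comm]
    refine Finset.sum_congr rfl fun i _ => Finset.sum_congr rfl fun j _ => ?_
    rw [abs_sub_comm]
  simp only [add_mul, Finset.sum_add_distrib]
  rw [h2]
  linarith

theorem rpow_mul_inv_sqrt_sub_le {m n : ℕ} (hm : 1 ≤ m) (hn : 1 ≤ n) :
    (m : ℝ) ^ (-(3 / 4) : ℝ) * (n : ℝ) ^ (-(3 / 4) : ℝ) * |√(m : ℝ) - √(n : ℝ)|⁻¹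
      ≤ 2 * (((m : ℝ)⁻¹ + (n : ℝ)⁻¹) * |(m : ℝ) - n|⁻¹) := by
  have hm0 : (0 : ℝ) < m := by exact_mod_cast hm
  have hn0 : (0 : ℝ) < n := by exact_mod_cast hn
  rcases eq_or_ne m n with rfl | hne
  · simp
  have s1 := Real.sq_sqrt hm0.le
  have s2 := Real.sq_sqrt hn0.le
  have hd : |(m : ℝ) - n| = |√(m : ℝ) - √(n : ℝ)| * (√(m : ℝ) + √(n : ℝ)) := by
    rw [← abs_of_nonneg (by positivity : 0 ≤ √(m : ℝ) + √(n : ℝ)), ← abs_mul]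
    congr 1; nlinarith
  have hdp : 0 < |(m : ℝ) - n| := abs_pos.2 (sub_ne_zero.2 (by exact_mod_cast hne))
  have hsum : 0 < √(m : ℝ) + √(n : ℝ) := by
    have := Real.sqrt_pos.2 hm0
    positivity
  have hinv : |√(m : ℝ) - √(n : ℝ)|⁻¹ = (√(m : ℝ) + √(n : ℝ)) * |(m : ℝ) - n|⁻¹ := by
    rw [hd]
    have : |√(m : ℝ) - √(n : ℝ)| ≠ 0 := by
      intro h; rw [h, zero_mul] at hd; exact hdp.ne' hd
    field_simp
  have key : ∀ a b : ℝ, 0 < a → 0 < b → a ^ (-(3 / 4) : ℝ) * b ^ (-(3 / 4) : ℝ) * √a ≤ a⁻¹ + b⁻¹ := by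
    intro a b ha hb
    have e : a ^ (-(3 / 4) : ℝ) * b ^ (-(3 / 4) : ℝ) * √a = (a⁻¹) ^ (1 / 4 : ℝ) * (b⁻¹) ^ (3 / 4 : ℝ) := by
      rw [Real.sqrt_eq_rpow, Real.inv_rpow ha.le, Real.inv_rpow hb.le, ← Real.rpow_neg ha.le,
        ← Real.rpow_neg hb.le, mul_right_comm, ← Real.rpow_add ha]
      norm_num
    rw [e]
    have := Real.geom_mean_le_arith_mean2_weighted (w₁ := 1 / 4) (w₂ := 3 / 4) (p₁ := a⁻¹) (p₂ := b⁻¹)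
      (by norm_num) (by norm_num) (by positivity) (by positivity) (by norm_num)
    have h1 : 0 < a⁻¹ := by positivity
    have h2 : 0 < b⁻¹ := by positivity
    linarith
  have k1 := key m n hm0 hn0
  have k2 := key n m hn0 hm0
  rw [hinv]
  have h3 : 0 ≤ |(m : ℝ) - n|⁻¹ := by positivity
  calc _ = ((m : ℝ) ^ (-(3 / 4) : ℝ) * (n : ℝ) ^ (-(3 / 4) : ℝ) * √(m : ℝ) +
        (n : ℝ) ^ (-(3 / 4) : ℝ) * (m : ℝ) ^ (-(3 / 4) : ℝ) * √(n : ℝ)) * |(m : ℝ) - n|⁻¹ := by ring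
    _ ≤ (2 * ((m : ℝ)⁻¹ + (n : ℝ)⁻¹)) * |(m : ℝ) - n|⁻¹ := by
        apply mul_le_mul_of_nonneg_right _ h3; linarith
    _ = _ := by ring

theorem integral_rpow_mul_sin_mul_sin {k X : ℝ} (hX : 1 ≤ X) (s t : ℝ) :
    ∫ x in (1 : ℝ)..X, x ^ k * (Real.sin (2 * π * s * √x + π / 4) * Real.sin (2 * π * t * √x + π / 4))
      = (oscInt k X (s - t) (π / 2) - oscInt k X (s + t) π) / 2 := by
  have hc : ∀ u ψ : ℝ, IntervalIntegrable (fun x : ℝ => x ^ k * Real.sin (2 * π * u * √x + ψ)) volume 1 X := by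
    intro u ψ
    apply ContinuousOn.intervalIntegrable
    rw [Set.uIcc_of_le hX]
    refine ContinuousOn.mul ?_ (by fun_prop)
    exact ContinuousOn.rpow_const continuousOn_id fun x hx => Or.inl (by simpa using (by linarith [hx.1] : x ≠ 0))
  rw [oscInt, oscInt, ← intervalIntegral.integral_sub (hc _ _) (hc _ _), ← intervalIntegral.integral_div]
  congr 1; ext x
  have h1 : Real.sin (2 * π * (s - t) * √x + π / 2) =
      Real.cos ((2 * π * s * √x + π / 4) - (2 * π * t * √x + π / 4)) := by
    rw [Real.sin_add_pi_div_two]; ring_nf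
  have h2 : Real.sin (2 * π * (s + t) * √x + π) =
      Real.cos ((2 * π * s * √x + π / 4) + (2 * π * t * √x + π / 4)) := by
    rw [← Real.sin_add_pi_div_two]; ring_nf
  rw [h1, h2]
  generalize 2 * π * s * √x + π / 4 = u
  generalize 2 * π * t * √x + π / 4 = v
  rw [Real.cos_sub, Real.cos_add]; ring

theorem abs_integral_sin_mul_sin_le {X : ℝ} (hX : 1 ≤ X) {m n : ℕ} (hm : 1 ≤ m) (hn : 1 ≤ n) :
    |∫ x in (1 : ℝ)..X, x ^ (3 / 2 : ℝ) * (Real.sin (2 * π * √(m : ℝ) * √x + π / 4) *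
      Real.sin (2 * π * √(n : ℝ) * √x + π / 4))|
      ≤ (if m = n then X ^ (5 / 2 : ℝ) else 0) + X ^ 2 * |√(m : ℝ) - √(n : ℝ)|⁻¹ := by
  rw [integral_rpow_mul_sin_mul_sin hX]
  have hm1 : 1 ≤ √(m : ℝ) := Real.one_le_sqrt.2 (by exact_mod_cast hm)
  have hn1 : 1 ≤ √(n : ℝ) := Real.one_le_sqrt.2 (by exact_mod_cast hn)
  have hX0 : (0 : ℝ) < X := by linarith
  have e2 : X ^ (3 / 2 + 1 / 2 : ℝ) = X ^ 2 := by
    rw [show (3 / 2 + 1 / 2 : ℝ) = ((2 : ℕ) : ℝ) by norm_num, Real.rpow_natCast]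
  have a1 := abs_oscInt_sub_le (k := 3 / 2) (by norm_num) hX (√(m : ℝ) - √(n : ℝ)) (π / 2)
  have a2 := abs_oscInt_le (k := 3 / 2) (by norm_num) hX (s := √(m : ℝ) + √(n : ℝ)) (by positivity) π
  rw [e2] at a1 a2
  have hiff : √(m : ℝ) - √(n : ℝ) = 0 ↔ m = n := by
    rw [sub_eq_zero, Real.sqrt_inj (by positivity) (by positivity)]; norm_cast
  rw [Real.sin_pi_div_two] at a1
  norm_num only at a1
  rw [abs_of_pos (by positivity : 0 < √(m : ℝ) + √(n : ℝ))] at a2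
  have h22 : X ^ 2 ≤ X ^ (5 / 2 : ℝ) := by
    rw [← Real.rpow_natCast]; exact Real.rpow_le_rpow_of_exponent_le hX (by norm_num)
  rw [abs_div, abs_two, div_le_iff₀ two_pos]
  refine (abs_sub _ _).trans ?_
  by_cases h : m = n
  · rw [if_pos (hiff.2 h)] at a1
    rw [if_pos h]
    have : (√(m : ℝ) + √(n : ℝ))⁻¹ ≤ 1 := inv_le_one_of_one_le₀ (by linarith)
    have h5 := mul_le_mul_of_nonneg_left this (sq_nonneg X)
    rw [abs_le] at a1
    have h6 : |oscInt (3 / 2) X (√(m : ℝ) - √(n : ℝ)) (π / 2)| ≤ X ^ (5 / 2 : ℝ) +  X ^ 2 * |√(m : ℝ) - √(n : ℝ)|⁻¹ := by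
      have h7 : 1 ≤ X ^ (5 / 2 : ℝ) := Real.one_le_rpow hX (by norm_num)
      rw [abs_le]
      constructor
      · linarith [a1.1, a1.2]
      · linarith [a1.1, a1.2]
    have h8 : 0 ≤ X ^ 2 * |√(m : ℝ) - √(n : ℝ)|⁻¹ := by positivity
    linarith
  · rw [if_neg (mt hiff.1 h), sub_zero] at a1
    rw [if_neg h]
    have : (√(m : ℝ) + √(n : ℝ))⁻¹ ≤ |√(m : ℝ) - √(n : ℝ)|⁻¹ := by
      apply inv_anti₀ (abs_pos.2 (mt hiff.1 h))
      rw [abs_le]; constructor <;> linarith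
    have h5 := mul_le_mul_of_nonneg_left this (sq_nonneg X)
    linarith

theorem integral_sinSum_sq_le {b : ℕ → ℝ} {P : Finset ℕ} {B X : ℝ} {K : ℕ} (hX : 1 ≤ X)
    (hP : P ⊆ Finset.Icc 1 K) (hb : ∀ n ∈ P, |b n| ≤ B * (n : ℝ) ^ (-(3 / 4) : ℝ)) (hB : 0 ≤ B) :
    ∫ x in (1 : ℝ)..X, x ^ (3 / 2 : ℝ) * sinSum b P x ^ 2
      ≤ B ^ 2 * X ^ (5 / 2 : ℝ) * ∑ n ∈ P, (n : ℝ) ^ (-(3 / 2) : ℝ)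
        + 8 * B ^ 2 * X ^ 2 * (1 + Real.log K) ^ 2 := by
  have hX0 : (0 : ℝ) < X := by linarith
  have hterm : ∀ m n : ℕ, IntervalIntegrable (fun x : ℝ => b m * b n * (x ^ (3 / 2 : ℝ) *
      (Real.sin (2 * π * √(m : ℝ) * √x + π / 4) * Real.sin (2 * π * √(n : ℝ) * √x + π / 4)))) volume 1 X := by
    intro m n
    apply ContinuousOn.intervalIntegrable
    rw [Set.uIcc_of_le hX]
    refine ContinuousOn.mul continuousOn_const (ContinuousOn.mul ?_ (by fun_prop))
    exact ContinuousOn.rpow_const continuousOn_id fun x hx => Or.inl (by simpa using (by linarith [hx.1] : x ≠ 0))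
  have e : ∫ x in (1 : ℝ)..X, x ^ (3 / 2 : ℝ) * sinSum b P x ^ 2 = ∑ m ∈ P, ∑ n ∈ P,
      b m * b n * ∫ x in (1 : ℝ)..X, x ^ (3 / 2 : ℝ) * (Real.sin (2 * π * √(m : ℝ) * √x + π / 4) *
        Real.sin (2 * π * √(n : ℝ) * √x + π / 4)) := by
    simp only [← intervalIntegral.integral_const_mul]
    have h1 : ∀ m ∈ P, ∑ n ∈ P, ∫ x in (1 : ℝ)..X, b m * b n * (x ^ (3 / 2 : ℝ) *
        (Real.sin (2 * π * √(m : ℝ) * √x + π / 4) * Real.sin (2 * π * √(n : ℝ) * √x + π / 4)))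
        = ∫ x in (1 : ℝ)..X, ∑ n ∈ P, b m * b n * (x ^ (3 / 2 : ℝ) *
        (Real.sin (2 * π * √(m : ℝ) * √x + π / 4) * Real.sin (2 * π * √(n : ℝ) * √x + π / 4))) :=
      fun m _ => (intervalIntegral.integral_finsetSum fun n _ => hterm m n).symm
    rw [Finset.sum_congr rfl h1, ← intervalIntegral.integral_finsetSum]
    · congr 1; ext x
      rw [sinSum, sq, Finset.sum_mul_sum, Finset.mul_sum]
      refine Finset.sum_congr rfl fun m _ => ?_
      rw [Finset.mul_sum]
      refine Finset.sum_congr rfl fun n _ => ?_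
      ring
    · intro m _
      have := IntervalIntegrable.sum P fun n _ => hterm m n
      rwa [Finset.sum_fn] at this
  rw [e]
  have hle : ∀ m ∈ P, ∀ n ∈ P, b m * b n * ∫ x in (1 : ℝ)..X, x ^ (3 / 2 : ℝ) *
      (Real.sin (2 * π * √(m : ℝ) * √x + π / 4) * Real.sin (2 * π * √(n : ℝ) * √x + π / 4))
      ≤ (if m = n then B ^ 2 * X ^ (5 / 2 : ℝ) * (n : ℝ) ^ (-(3 / 2) : ℝ) else 0) +
        2 * B ^ 2 * X ^ 2 * (((m : ℝ)⁻¹ + (n : ℝ)⁻¹) * |(m : ℝ) - n|⁻¹) := by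
    intro m hm n hn
    have hm1 := (Finset.mem_Icc.1 (hP hm)).1
    have hn1 := (Finset.mem_Icc.1 (hP hn)).1
    have hn0 : (0 : ℝ) < n := by exact_mod_cast hn1
    have h1 := abs_integral_sin_mul_sin_le hX hm1 hn1
    have h2 := rpow_mul_inv_sqrt_sub_le hm1 hn1
    have h3 : |b m * b n| ≤ B ^ 2 * ((m : ℝ) ^ (-(3 / 4) : ℝ) * (n : ℝ) ^ (-(3 / 4) : ℝ)) := by
      rw [abs_mul]
      calc _ ≤ (B * (m : ℝ) ^ (-(3 / 4) : ℝ)) * (B * (n : ℝ) ^ (-(3 / 4) : ℝ)) := by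
            gcongr
            · exact hb m hm
            · exact hb n hn
        _ = _ := by ring
    refine (le_abs_self _).trans ?_
    rw [abs_mul]
    refine (mul_le_mul h3 h1 (abs_nonneg _) (by positivity)).trans ?_
    rw [mul_add]
    apply add_le_add
    · split_ifs with h
      · rw [h, ← Real.rpow_add hn0]; norm_num
        apply le_of_eq; ring
      · rw [mul_zero]
    · have := mul_le_mul_of_nonneg_left h2 (by positivity : 0 ≤ B ^ 2 * X ^ 2)
      linarith
  refine (Finset.sum_le_sum fun m hm => Finset.sum_le_sum fun n hn => hle m hm n hn).trans ?_
  simp only [Finset.sum_add_distrib]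
  apply add_le_add
  · apply le_of_eq
    rw [Finset.mul_sum]
    refine Finset.sum_congr rfl fun m hm => ?_
    rw [Finset.sum_ite_eq, if_pos hm]
  · simp only [← Finset.mul_sum]
    have h5 : ∑ m ∈ P, ∑ n ∈ P, ((m : ℝ)⁻¹ + (n : ℝ)⁻¹) * |(m : ℝ) - n|⁻¹ ≤
        ∑ m ∈ Finset.Icc 1 K, ∑ n ∈ Finset.Icc 1 K, ((m : ℝ)⁻¹ + (n : ℝ)⁻¹) * |(m : ℝ) - n|⁻¹ := by
      refine (Finset.sum_le_sum fun m _ => Finset.sum_le_sum_of_subset_of_nonneg hP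
        fun n _ _ => by positivity).trans ?_
      exact Finset.sum_le_sum_of_subset_of_nonneg hP fun m _ _ => Finset.sum_nonneg fun n _ => by positivity
    have h6 := h5.trans (sum_sum_inv_mul_inv_le K)
    have := mul_le_mul_of_nonneg_left h6 (by positivity : 0 ≤ 2 * B ^ 2 * X ^ 2)
    linarith

theorem abs_sinSum_le {b : ℕ → ℝ} {P : Finset ℕ} {B : ℝ} {K : ℕ}
    (hP : P ⊆ Finset.Icc 1 K) (hb : ∀ n ∈ P, |b n| ≤ B * (n : ℝ) ^ (-(3 / 4) : ℝ)) (hB : 0 ≤ B) (x : ℝ) :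
    |sinSum b P x| ≤ 4 * B * (K : ℝ) ^ (1 / 4 : ℝ) := by
  rw [sinSum]
  calc _ ≤ ∑ n ∈ P, |b n * Real.sin (2 * π * √(n : ℝ) * √x + π / 4)| := Finset.abs_sum_le_sum_abs _ _
    _ ≤ ∑ n ∈ P, B * (n : ℝ) ^ (-(3 / 4) : ℝ) := by
        apply Finset.sum_le_sum
        intro n hn
        rw [abs_mul]
        exact (mul_le_of_le_one_right (abs_nonneg _) (Real.abs_sin_le_one _)).trans (hb n hn)
    _ ≤ ∑ n ∈ Finset.Icc 1 K, B * (n : ℝ) ^ (-(3 / 4) : ℝ) :=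
        Finset.sum_le_sum_of_subset_of_nonneg hP fun n _ _ => by positivity
    _ ≤ B * ((K : ℝ) ^ (1 - 3 / 4 : ℝ) / (1 - 3 / 4)) := by
        rw [← Finset.mul_sum]
        exact mul_le_mul_of_nonneg_left (sum_rpow_neg_le (by norm_num) (by norm_num) K) hB
    _ = _ := by norm_num; ring

/-- `c` is within distance one of the real number `(√a + √b)²`. -/
def NearSum (a b c : ℕ) : Prop := |(c : ℝ) - (a + b + 2 * (√(a : ℝ) * √(b : ℝ)))| < 1

theorem sqrt_add_sub_mul (a b c : ℕ) :
    (√(a : ℝ) + √(b : ℝ) - √(c : ℝ)) * (√(a : ℝ) + √(b : ℝ) + √(c : ℝ))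
      = a + b + 2 * (√(a : ℝ) * √(b : ℝ)) - c := by
  have h2 := Real.sq_sqrt (Nat.cast_nonneg a : (0 : ℝ) ≤ a)
  have h3 := Real.sq_sqrt (Nat.cast_nonneg b : (0 : ℝ) ≤ b)
  have h4 := Real.sq_sqrt (Nat.cast_nonneg c : (0 : ℝ) ≤ c)
  nlinarith

theorem NearSum.le {a b c : ℕ} (h : NearSum a b c) (ha : 1 ≤ a) (hb : 1 ≤ b) : a ≤ c ∧ b ≤ c := by
  rw [NearSum, abs_lt] at h
  have ha' : (1 : ℝ) ≤ a := by exact_mod_cast ha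
  have hb' : (1 : ℝ) ≤ b := by exact_mod_cast hb
  have h1 : 0 ≤ √(a : ℝ) * √(b : ℝ) := by positivity
  constructor
  · have : (a : ℝ) ≤ c := by linarith [h.1]
    exact_mod_cast this
  · have : (b : ℝ) ≤ c := by linarith [h.1]
    exact_mod_cast this

theorem inv_sqrt_add_sub_le_of_not_near {a b c : ℕ} (h : ¬ NearSum a b c) :
    |√(a : ℝ) + √(b : ℝ) - √(c : ℝ)|⁻¹ ≤ √(a : ℝ) + √(b : ℝ) + √(c : ℝ) := by
  rw [NearSum, not_lt, abs_sub_comm, ← sqrt_add_sub_mul, abs_mul,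
    abs_of_nonneg (by positivity : 0 ≤ √(a : ℝ) + √(b : ℝ) + √(c : ℝ))] at h
  have hs : 0 ≤ √(a : ℝ) + √(b : ℝ) + √(c : ℝ) := by positivity
  have hpos : 0 < |√(a : ℝ) + √(b : ℝ) - √(c : ℝ)| := by
    rcases (abs_nonneg (√(a : ℝ) + √(b : ℝ) - √(c : ℝ))).eq_or_lt with h0 | h0
    · rw [← h0, zero_mul] at h; linarith
    · exact h0
  rw [inv_le_iff_one_le_mul₀ hpos]
  linarith

theorem inv_sqrt_add_sub_le_of_near {a b c : ℕ} (ha : 1 ≤ a) (hb : 1 ≤ b) (h : NearSum a b c) :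
    |√(a : ℝ) + √(b : ℝ) - √(c : ℝ)|⁻¹ ≤ 25 * (√(a : ℝ) * √(b : ℝ)) * √((max a b : ℕ) : ℝ) := by
  have hmul := sqrt_add_sub_mul a b c
  rw [NearSum] at h
  have ha' : (1 : ℝ) ≤ a := by exact_mod_cast ha
  have hb' : (1 : ℝ) ≤ b := by exact_mod_cast hb
  have a1 : 1 ≤ √(a : ℝ) := Real.one_le_sqrt.2 ha'
  have b1 : 1 ≤ √(b : ℝ) := Real.one_le_sqrt.2 hb'
  have sa := Real.sq_sqrt (by linarith : (0 : ℝ) ≤ a)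
  have sb := Real.sq_sqrt (by linarith : (0 : ℝ) ≤ b)
  have sc := Real.sq_sqrt (Nat.cast_nonneg c : (0 : ℝ) ≤ c)
  have hab : 1 ≤ √(a : ℝ) * √(b : ℝ) := by nlinarith
  rcases eq_or_ne (√(a : ℝ) + √(b : ℝ) - √(c : ℝ)) 0 with h0 | h0
  · rw [h0, abs_zero, inv_zero]; positivity
  have hsum : 0 < √(a : ℝ) + √(b : ℝ) + √(c : ℝ) := by positivity
  set u : ℝ := a + b + 2 * (√(a : ℝ) * √(b : ℝ)) - c with hu
  have hu0 : u ≠ 0 := by rw [← hmul]; exact mul_ne_zero h0 hsum.ne'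
  have hu1 : |u| < 1 := by rw [abs_sub_comm] at h; exact h
  -- the integer `4ab - (c-a-b)²` factors through `u`
  have hprod : u * (2 * (√(a : ℝ) * √(b : ℝ)) + (c - a - b)) = 4 * (a * b) - (c - a - b) ^ 2 := by
    have : (√(a : ℝ) * √(b : ℝ)) ^ 2 = a * b := by rw [mul_pow, sa, sb]
    rw [hu]; nlinarith
  have hu1' := abs_lt.1 hu1
  have hfac : 2 * (√(a : ℝ) * √(b : ℝ)) + (c - a - b) ≠ 0 := by
    intro h1
    have : (c : ℝ) - a - b = 2 * (√(a : ℝ) * √(b : ℝ)) - u := by rw [hu]; ring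
    rw [this] at h1
    linarith [hu1'.2]
  have hInt : (1 : ℝ) ≤ |4 * (a * b) - ((c : ℝ) - a - b) ^ 2| := by
    have hne : (4 * (a * b) - ((c : ℤ) - a - b) ^ 2 : ℤ) ≠ 0 := by
      intro h1
      have : (4 * (a * b) - ((c : ℝ) - a - b) ^ 2) = 0 := by exact_mod_cast h1
      rw [← hprod] at this
      exact mul_ne_zero hu0 hfac this
    have := Int.one_le_abs hne
    have h2 : ((1 : ℤ) : ℝ) ≤ ((|4 * (a * b) - ((c : ℤ) - a - b) ^ 2| : ℤ) : ℝ) := by exact_mod_cast this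
    push_cast at h2
    exact h2
  have hlow : 1 ≤ |u| * (5 * (√(a : ℝ) * √(b : ℝ))) := by
    rw [← hprod, abs_mul] at hInt
    refine hInt.trans (mul_le_mul_of_nonneg_left ?_ (abs_nonneg u))
    have : (c : ℝ) - a - b = 2 * (√(a : ℝ) * √(b : ℝ)) - u := by rw [hu]; ring
    rw [this, abs_le]
    constructor <;> linarith [hu1'.1, hu1'.2]
  have hm1 : √(a : ℝ) ≤ √((max a b : ℕ) : ℝ) := Real.sqrt_le_sqrt (by exact_mod_cast le_max_left a b)
  have hm2 : √(b : ℝ) ≤ √((max a b : ℕ) : ℝ) := Real.sqrt_le_sqrt (by exact_mod_cast le_max_right a b)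
  have hc : √(c : ℝ) ≤ √(a : ℝ) + √(b : ℝ) + 1 := by
    apply Real.sqrt_le_iff.2 ⟨by positivity, _⟩
    have : (c : ℝ) = a + b + 2 * (√(a : ℝ) * √(b : ℝ)) - u := by rw [hu]; ring
    rw [this]
    nlinarith [hu1'.1]
  have hsum5 : √(a : ℝ) + √(b : ℝ) + √(c : ℝ) ≤ 5 * √((max a b : ℕ) : ℝ) := by linarith
  have hpos : 0 < |√(a : ℝ) + √(b : ℝ) - √(c : ℝ)| := abs_pos.2 h0
  rw [inv_le_iff_one_le_mul₀ hpos]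
  refine hlow.trans ?_
  rw [← hmul, abs_mul, abs_of_pos hsum]
  calc _ ≤ |√(a : ℝ) + √(b : ℝ) - √(c : ℝ)| * (5 * √((max a b : ℕ) : ℝ)) * (5 * (√(a : ℝ) * √(b : ℝ))) := by
        gcongr
    _ = _ := by ring

/-- The majorant `(abc)^{-3/4}` of the trilinear coefficients. -/
noncomputable def triWt (a b c : ℕ) : ℝ :=
  (a : ℝ) ^ (-(3 / 4) : ℝ) * (b : ℝ) ^ (-(3 / 4) : ℝ) * (c : ℝ) ^ (-(3 / 4) : ℝ)

theorem triWt_nonneg (a b c : ℕ) : 0 ≤ triWt a b c := by rw [triWt]; positivity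

theorem triWt_mul_near_le {a b c : ℕ} (ha : 1 ≤ a) (hb : 1 ≤ b) (h : NearSum a b c) :
    triWt a b c * |√(a : ℝ) + √(b : ℝ) - √(c : ℝ)|⁻¹
      ≤ 25 * ((a : ℝ) ^ (-(3 / 8) : ℝ) * (b : ℝ) ^ (-(3 / 8) : ℝ)) := by
  have h1 := inv_sqrt_add_sub_le_of_near ha hb h
  obtain ⟨hac, hbc⟩ := h.le ha hb
  have ha0 : (0 : ℝ) < a := by exact_mod_cast ha
  have hb0 : (0 : ℝ) < b := by exact_mod_cast hb
  set m : ℝ := ((max a b : ℕ) : ℝ) with hm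
  have hma : (a : ℝ) ≤ m := by rw [hm]; exact_mod_cast le_max_left a b
  have hmb : (b : ℝ) ≤ m := by rw [hm]; exact_mod_cast le_max_right a b
  have hm0 : 0 < m := by linarith
  have hmc : m ≤ c := by rw [hm]; exact_mod_cast max_le hac hbc
  have hc : (c : ℝ) ^ (-(3 / 4) : ℝ) ≤ m ^ (-(3 / 4) : ℝ) := Real.rpow_le_rpow_of_nonpos hm0 hmc (by norm_num)
  calc _ ≤ (a : ℝ) ^ (-(3 / 4) : ℝ) * (b : ℝ) ^ (-(3 / 4) : ℝ) * m ^ (-(3 / 4) : ℝ) *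
        (25 * (√(a : ℝ) * √(b : ℝ)) * √m) := by
        rw [triWt]; gcongr
    _ = 25 * (((a : ℝ) ^ (-(3 / 4) : ℝ) * √(a : ℝ)) * ((b : ℝ) ^ (-(3 / 4) : ℝ) * √(b : ℝ))) *
        (m ^ (-(3 / 4) : ℝ) * √m) := by ring
    _ = 25 * ((a : ℝ) ^ (-(1 / 4) : ℝ) * (b : ℝ) ^ (-(1 / 4) : ℝ)) *
        (m ^ (-(1 / 8) : ℝ) * m ^ (-(1 / 8) : ℝ)) := by
        rw [Real.sqrt_eq_rpow, Real.sqrt_eq_rpow, Real.sqrt_eq_rpow, ← Real.rpow_add ha0, ← Real.rpow_add hb0,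
          ← Real.rpow_add hm0, ← Real.rpow_add hm0]
        norm_num
    _ ≤ 25 * ((a : ℝ) ^ (-(1 / 4) : ℝ) * (b : ℝ) ^ (-(1 / 4) : ℝ)) *
        ((a : ℝ) ^ (-(1 / 8) : ℝ) * (b : ℝ) ^ (-(1 / 8) : ℝ)) := by
        have := Real.rpow_le_rpow_of_nonpos ha0 hma (by norm_num : (-(1 / 8) : ℝ) ≤ 0)
        have := Real.rpow_le_rpow_of_nonpos hb0 hmb (by norm_num : (-(1 / 8) : ℝ) ≤ 0)
        gcongr
    _ = 25 * (((a : ℝ) ^ (-(1 / 4) : ℝ) * (a : ℝ) ^ (-(1 / 8) : ℝ)) *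
        ((b : ℝ) ^ (-(1 / 4) : ℝ) * (b : ℝ) ^ (-(1 / 8) : ℝ))) := by ring
    _ = _ := by rw [← Real.rpow_add ha0, ← Real.rpow_add hb0]; norm_num

theorem card_filter_nearSum_le (a b K : ℕ) :
    ∑ c ∈ Finset.Icc 1 K, (if NearSum a b c then (1 : ℝ) else 0) ≤ 2 := by
  rw [Finset.sum_boole]
  set y : ℝ := a + b + 2 * (√(a : ℝ) * √(b : ℝ)) with hy
  have hy0 : 0 ≤ y := by positivity
  have hsub : Finset.filter (fun c => NearSum a b c) (Finset.Icc 1 K) ⊆ {⌊y⌋₊, ⌊y⌋₊ + 1} := by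
    intro c hc
    have h := (Finset.mem_filter.1 hc).2
    rw [NearSum, ← hy, abs_lt] at h
    have h1 := Nat.floor_le hy0
    have h2 := Nat.lt_floor_add_one y
    have h3 : (⌊y⌋₊ : ℝ) < (c : ℝ) + 1 := by linarith [h.1]
    have h4 : (c : ℝ) < (⌊y⌋₊ : ℝ) + 2 := by linarith [h.2]
    have h3' : ⌊y⌋₊ < c + 1 := by exact_mod_cast h3
    have h4' : c < ⌊y⌋₊ + 2 := by exact_mod_cast h4
    rw [Finset.mem_insert, Finset.mem_singleton]
    omega
  have := (Finset.card_le_card hsub).trans Finset.card_le_two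
  exact_mod_cast this

/-- The small-denominator estimate in the form used for summation. -/
theorem triWt_mul_inv_le {a b c M : ℕ} (ha : 1 ≤ a) (hb : 1 ≤ b) (hM : 1 ≤ M)
    (h : a ≤ M ∧ b ≤ M ∨ c ≤ M ∧ (a ≤ M ∨ b ≤ M)) :
    triWt a b c * |√(a : ℝ) + √(b : ℝ) - √(c : ℝ)|⁻¹ ≤ triWt a b c +
      12 * √(M : ℝ) * (if a ≤ 16 * M ∧ b ≤ 16 * M ∧ c ≤ 16 * M then triWt a b c else 0) +
      25 * (if NearSum a b c ∧ a ≤ M ∧ b ≤ M then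
        (a : ℝ) ^ (-(3 / 8) : ℝ) * (b : ℝ) ^ (-(3 / 8) : ℝ) else 0) := by
  have hw := triWt_nonneg a b c
  have hMs : 1 ≤ √(M : ℝ) := Real.one_le_sqrt.2 (by exact_mod_cast hM)
  have hle : ∀ n : ℕ, n ≤ M → √(n : ℝ) ≤ √(M : ℝ) := fun n hn => Real.sqrt_le_sqrt (by exact_mod_cast hn)
  have h16 : √(((16 * M : ℕ)) : ℝ) = 4 * √(M : ℝ) := by
    push_cast
    rw [Real.sqrt_mul (by norm_num), show (16 : ℝ) = 4 ^ 2 by norm_num, Real.sqrt_sq (by norm_num)]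
  have hle16 : ∀ n : ℕ, n ≤ 16 * M → √(n : ℝ) ≤ 4 * √(M : ℝ) := fun n hn => by
    rw [← h16]; exact Real.sqrt_le_sqrt (by exact_mod_cast hn)
  have hgt16 : ∀ n : ℕ, ¬ n ≤ 16 * M → 4 * √(M : ℝ) ≤ √(n : ℝ) := fun n hn => by
    rw [← h16]; exact Real.sqrt_le_sqrt (by exact_mod_cast (not_le.1 hn).le)
  have nn : ∀ n : ℕ, 0 ≤ √(n : ℝ) := fun n => Real.sqrt_nonneg _
  by_cases h1 : a ≤ 16 * M ∧ b ≤ 16 * M ∧ c ≤ 16 * M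
  · by_cases h2 : NearSum a b c
    · have h3 : a ≤ M ∧ b ≤ M := by
        obtain ⟨hac, hbc⟩ := h2.le ha hb
        omega
      rw [if_pos h1, if_pos ⟨h2, h3⟩]
      have := triWt_mul_near_le ha hb h2
      have : 0 ≤ 12 * √(M : ℝ) * triWt a b c := by positivity
      linarith
    · rw [if_pos h1, if_neg (fun h => h2 h.1)]
      have h4 := inv_sqrt_add_sub_le_of_not_near h2
      have : √(a : ℝ) + √(b : ℝ) + √(c : ℝ) ≤ 12 * √(M : ℝ) := by
        linarith [hle16 a h1.1, hle16 b h1.2.1, hle16 c h1.2.2]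
      have := mul_le_mul_of_nonneg_left (h4.trans this) hw
      linarith
  · have hge : 1 ≤ |√(a : ℝ) + √(b : ℝ) - √(c : ℝ)| := by
      rw [le_abs]
      by_cases ha' : a ≤ 16 * M
      · by_cases hb' : b ≤ 16 * M
        · have hc' : ¬ c ≤ 16 * M := fun hc => h1 ⟨ha', hb', hc⟩
          right
          have hh : a ≤ M ∧ b ≤ M := by omega
          linarith [hle a hh.1, hle b hh.2, hgt16 c hc']
        · left
          have hh : a ≤ M ∧ c ≤ M := by omega
          linarith [nn a, hle c hh.2, hgt16 b hb']
      · left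
        have hh : b ≤ M ∧ c ≤ M := by omega
        linarith [nn b, hle c hh.2, hgt16 a ha']
    have hi : |√(a : ℝ) + √(b : ℝ) - √(c : ℝ)|⁻¹ ≤ 1 := inv_le_one_of_one_le₀ hge
    have h0 : 0 ≤ 25 * (if NearSum a b c ∧ a ≤ M ∧ b ≤ M then
        (a : ℝ) ^ (-(3 / 8) : ℝ) * (b : ℝ) ^ (-(3 / 8) : ℝ) else 0) := by positivity
    rw [if_neg h1]
    nlinarith [mul_le_mul_of_nonneg_left hi hw]

theorem sum_triWt_le (M L : ℕ) :
    ∑ m ∈ Finset.Icc 1 M, ∑ n ∈ Finset.Icc 1 M, ∑ k ∈ Finset.Icc 1 L, triWt m n k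
      ≤ 64 * (M : ℝ) ^ (1 / 2 : ℝ) * (L : ℝ) ^ (1 / 4 : ℝ) := by
  have h : ∀ K : ℕ, ∑ n ∈ Finset.Icc 1 K, (n : ℝ) ^ (-(3 / 4) : ℝ) ≤ 4 * (K : ℝ) ^ (1 / 4 : ℝ) := fun K =>
    (sum_rpow_neg_le (by norm_num) (by norm_num) K).trans (le_of_eq (by norm_num; ring))
  have e : ∑ m ∈ Finset.Icc 1 M, ∑ n ∈ Finset.Icc 1 M, ∑ k ∈ Finset.Icc 1 L, triWt m n k =
      (∑ m ∈ Finset.Icc 1 M, (m : ℝ) ^ (-(3 / 4) : ℝ)) * (∑ n ∈ Finset.Icc 1 M, (n : ℝ) ^ (-(3 / 4) : ℝ)) *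
      (∑ k ∈ Finset.Icc 1 L, (k : ℝ) ^ (-(3 / 4) : ℝ)) := by
    simp only [triWt, ← Finset.mul_sum, ← Finset.sum_mul]
  rw [e]
  have hM : (M : ℝ) ^ (1 / 2 : ℝ) = (M : ℝ) ^ (1 / 4 : ℝ) * (M : ℝ) ^ (1 / 4 : ℝ) := by
    rw [← Real.rpow_add_of_nonneg (by positivity) (by norm_num) (by norm_num)]; norm_num
  calc _ ≤ (4 * (M : ℝ) ^ (1 / 4 : ℝ)) * (4 * (M : ℝ) ^ (1 / 4 : ℝ)) * (4 * (L : ℝ) ^ (1 / 4 : ℝ)) := by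
        gcongr <;> exact h _
    _ = _ := by rw [hM]; ring

theorem sqrt_mul_sum_triWt_trunc_le (M L : ℕ) :
    12 * √(M : ℝ) * ∑ m ∈ Finset.Icc 1 M, ∑ n ∈ Finset.Icc 1 M, ∑ k ∈ Finset.Icc 1 L,
      (if k ≤ 16 * M then triWt m n k else 0) ≤ 1536 * (M : ℝ) ^ (5 / 4 : ℝ) := by
  have h1 : ∑ m ∈ Finset.Icc 1 M, ∑ n ∈ Finset.Icc 1 M, ∑ k ∈ Finset.Icc 1 L,
      (if k ≤ 16 * M then triWt m n k else 0) ≤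
      ∑ m ∈ Finset.Icc 1 M, ∑ n ∈ Finset.Icc 1 M, ∑ k ∈ Finset.Icc 1 (16 * M), triWt m n k := by
    refine Finset.sum_le_sum fun m _ => Finset.sum_le_sum fun n _ => ?_
    rw [← Finset.sum_filter]
    refine Finset.sum_le_sum_of_subset_of_nonneg (fun k hk => ?_) fun k _ _ => triWt_nonneg _ _ _
    rw [Finset.mem_filter, Finset.mem_Icc] at hk
    exact Finset.mem_Icc.2 ⟨hk.1.1, hk.2⟩
  have h2 := h1.trans (sum_triWt_le M (16 * M))
  have h16 : ((16 * M : ℕ) : ℝ) ^ (1 / 4 : ℝ) = 2 * (M : ℝ) ^ (1 / 4 : ℝ) := by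
    push_cast
    rw [Real.mul_rpow (by norm_num) (by positivity), show (16 : ℝ) = 2 ^ (4 : ℝ) by norm_num,
      ← Real.rpow_mul (by norm_num)]
    norm_num
  rw [h16] at h2
  have h3 := mul_le_mul_of_nonneg_left h2 (by positivity : 0 ≤ 12 * √(M : ℝ))
  refine h3.trans (le_of_eq ?_)
  rw [Real.sqrt_eq_rpow]
  have : (M : ℝ) ^ (5 / 4 : ℝ) = (M : ℝ) ^ (1 / 2 : ℝ) * (M : ℝ) ^ (1 / 2 : ℝ) * (M : ℝ) ^ (1 / 4 : ℝ) := by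
    rw [← Real.rpow_add_of_nonneg (by positivity) (by norm_num) (by norm_num),
      ← Real.rpow_add_of_nonneg (by positivity) (by norm_num) (by norm_num)]
    norm_num
  rw [this]; ring

theorem sum_rpow_mul_rpow_le (M : ℕ) :
    ∑ a ∈ Finset.Icc 1 M, ∑ b ∈ Finset.Icc 1 M, (a : ℝ) ^ (-(3 / 8) : ℝ) * (b : ℝ) ^ (-(3 / 8) : ℝ) * 2
      ≤ 6 * (M : ℝ) ^ (5 / 4 : ℝ) := by
  have h : ∑ n ∈ Finset.Icc 1 M, (n : ℝ) ^ (-(3 / 8) : ℝ) ≤ 8 / 5 * (M : ℝ) ^ (5 / 8 : ℝ) :=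
    (sum_rpow_neg_le (by norm_num) (by norm_num) M).trans (le_of_eq (by norm_num; ring))
  have h0 : 0 ≤ ∑ n ∈ Finset.Icc 1 M, (n : ℝ) ^ (-(3 / 8) : ℝ) := by positivity
  simp only [← Finset.sum_mul, ← Finset.mul_sum]
  have hM : (M : ℝ) ^ (5 / 4 : ℝ) = (M : ℝ) ^ (5 / 8 : ℝ) * (M : ℝ) ^ (5 / 8 : ℝ) := by
    rw [← Real.rpow_add_of_nonneg (by positivity) (by norm_num) (by norm_num)]; norm_num
  have h8 : 0 ≤ (M : ℝ) ^ (5 / 8 : ℝ) := by positivity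
  rw [hM]
  nlinarith [mul_le_mul h h h0 (by positivity)]

theorem sum_ite_near_le (a b L : ℕ) :
    ∑ c ∈ Finset.Icc 1 L, (if NearSum a b c then
        (a : ℝ) ^ (-(3 / 8) : ℝ) * (b : ℝ) ^ (-(3 / 8) : ℝ) else 0)
      ≤ (a : ℝ) ^ (-(3 / 8) : ℝ) * (b : ℝ) ^ (-(3 / 8) : ℝ) * 2 := by
  have h := card_filter_nearSum_le a b L
  rw [Finset.sum_boole] at h
  rw [← Finset.sum_filter, Finset.sum_const, nsmul_eq_mul, mul_comm]
  exact mul_le_mul_of_nonneg_left h (by positivity)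

theorem sum_triWt_mul_inv_le_outer {M : ℕ} (hM : 1 ≤ M) (L : ℕ) :
    ∑ m ∈ Finset.Icc 1 M, ∑ n ∈ Finset.Icc 1 M, ∑ k ∈ Finset.Icc 1 L,
      triWt m n k * |√(m : ℝ) + √(n : ℝ) - √(k : ℝ)|⁻¹
      ≤ 64 * (M : ℝ) ^ (1 / 2 : ℝ) * (L : ℝ) ^ (1 / 4 : ℝ) + 1686 * (M : ℝ) ^ (5 / 4 : ℝ) := by
  have hpt : ∀ m ∈ Finset.Icc 1 M, ∀ n ∈ Finset.Icc 1 M, ∀ k ∈ Finset.Icc 1 L,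
      triWt m n k * |√(m : ℝ) + √(n : ℝ) - √(k : ℝ)|⁻¹ ≤ triWt m n k +
      12 * √(M : ℝ) * (if k ≤ 16 * M then triWt m n k else 0) +
      25 * (if NearSum m n k then
        (m : ℝ) ^ (-(3 / 8) : ℝ) * (n : ℝ) ^ (-(3 / 8) : ℝ) else 0) := by
    intro m hm n hn k hk
    rw [Finset.mem_Icc] at hm hn hk
    have := triWt_mul_inv_le (c := k) hm.1 hn.1 hM (Or.inl ⟨hm.2, hn.2⟩)
    refine this.trans (add_le_add (add_le_add le_rfl ?_) ?_)
    · refine mul_le_mul_of_nonneg_left ?_ (by positivity)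
      by_cases h : k ≤ 16 * M
      · rw [if_pos h, if_pos ⟨by omega, by omega, h⟩]
      · rw [if_neg h, if_neg fun h' => h h'.2.2]
    · refine mul_le_mul_of_nonneg_left ?_ (by norm_num)
      by_cases h : NearSum m n k
      · rw [if_pos h, if_pos ⟨h, hm.2, hn.2⟩]
      · rw [if_neg h, if_neg fun h' => h h'.1]
  refine (Finset.sum_le_sum fun m hm => Finset.sum_le_sum fun n hn => Finset.sum_le_sum fun k hk =>
    hpt m hm n hn k hk).trans ?_
  simp only [Finset.sum_add_distrib, ← Finset.mul_sum]
  have h1 := sum_triWt_le M L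
  have h2 := sqrt_mul_sum_triWt_trunc_le M L
  have h3 : ∑ m ∈ Finset.Icc 1 M, ∑ n ∈ Finset.Icc 1 M, ∑ k ∈ Finset.Icc 1 L,
      (if NearSum m n k then
        (m : ℝ) ^ (-(3 / 8) : ℝ) * (n : ℝ) ^ (-(3 / 8) : ℝ) else 0) ≤ 6 * (M : ℝ) ^ (5 / 4 : ℝ) :=
    (Finset.sum_le_sum fun m _ => Finset.sum_le_sum fun n _ => sum_ite_near_le m n L).trans
      (sum_rpow_mul_rpow_le M)
  linarith

theorem sum_triWt_mul_inv_le_inner {M : ℕ} (hM : 1 ≤ M) (L : ℕ) :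
    ∑ m ∈ Finset.Icc 1 M, ∑ n ∈ Finset.Icc 1 M, ∑ k ∈ Finset.Icc 1 L,
      triWt m n k * |√(m : ℝ) + √(k : ℝ) - √(n : ℝ)|⁻¹
      ≤ 64 * (M : ℝ) ^ (1 / 2 : ℝ) * (L : ℝ) ^ (1 / 4 : ℝ) + 1686 * (M : ℝ) ^ (5 / 4 : ℝ) := by
  have hpt : ∀ m ∈ Finset.Icc 1 M, ∀ n ∈ Finset.Icc 1 M, ∀ k ∈ Finset.Icc 1 L,
      triWt m n k * |√(m : ℝ) + √(k : ℝ) - √(n : ℝ)|⁻¹ ≤ triWt m n k +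
      12 * √(M : ℝ) * (if k ≤ 16 * M then triWt m n k else 0) +
      25 * (if k ≤ M then (if NearSum m k n then
        (m : ℝ) ^ (-(3 / 8) : ℝ) * (k : ℝ) ^ (-(3 / 8) : ℝ) else 0) else 0) := by
    intro m hm n hn k hk
    rw [Finset.mem_Icc] at hm hn hk
    have := triWt_mul_inv_le (c := n) hm.1 hk.1 hM (Or.inr ⟨hn.2, Or.inl hm.2⟩)
    have es : triWt m k n = triWt m n k := by rw [triWt, triWt]; ring
    rw [es] at this
    refine this.trans (add_le_add (add_le_add le_rfl ?_) ?_)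
    · refine mul_le_mul_of_nonneg_left ?_ (by positivity)
      by_cases h : k ≤ 16 * M
      · rw [if_pos h, if_pos ⟨by omega, h, by omega⟩]
      · rw [if_neg h, if_neg fun h' => h h'.2.1]
    · refine mul_le_mul_of_nonneg_left ?_ (by norm_num)
      by_cases h : k ≤ M
      · rw [if_pos h]
        by_cases h2 : NearSum m k n
        · rw [if_pos h2, if_pos ⟨h2, hm.2, h⟩]
        · rw [if_neg h2, if_neg fun h' => h2 h'.1]
      · rw [if_neg h, if_neg fun h' => h h'.2.2]
  refine (Finset.sum_le_sum fun m hm => Finset.sum_le_sum fun n hn => Finset.sum_le_sum fun k hk =>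
    hpt m hm n hn k hk).trans ?_
  simp only [Finset.sum_add_distrib, ← Finset.mul_sum]
  have h1 := sum_triWt_le M L
  have h2 := sqrt_mul_sum_triWt_trunc_le M L
  have h3 : ∑ m ∈ Finset.Icc 1 M, ∑ n ∈ Finset.Icc 1 M, ∑ k ∈ Finset.Icc 1 L,
      (if k ≤ M then (if NearSum m k n then
        (m : ℝ) ^ (-(3 / 8) : ℝ) * (k : ℝ) ^ (-(3 / 8) : ℝ) else 0) else 0)
        ≤ 6 * (M : ℝ) ^ (5 / 4 : ℝ) := by
    refine le_trans (Finset.sum_le_sum fun m _ => ?_) (sum_rpow_mul_rpow_le M)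
    calc _ ≤ ∑ n ∈ Finset.Icc 1 M, ∑ k ∈ Finset.Icc 1 M, (if NearSum m k n then
        (m : ℝ) ^ (-(3 / 8) : ℝ) * (k : ℝ) ^ (-(3 / 8) : ℝ) else 0) := by
          refine Finset.sum_le_sum fun n _ => ?_
          rw [← Finset.sum_filter]
          refine Finset.sum_le_sum_of_subset_of_nonneg (fun k hk => ?_) fun k _ _ => by positivity
          rw [Finset.mem_filter, Finset.mem_Icc] at hk
          exact Finset.mem_Icc.2 ⟨hk.1.1, hk.2⟩
      _ ≤ _ := by
          rw [Finset.sum_comm]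
          exact Finset.sum_le_sum fun k _ => sum_ite_near_le m k M
  linarith

/-- The resonance indicator weighted by the coefficients. -/
noncomputable def resTerm (b : ℕ → ℝ) (m n k : ℕ) : ℝ :=
  b m * b n * b k * if √(m : ℝ) + √(n : ℝ) - √(k : ℝ) = 0 then 1 else 0

/-- The integral of the product of three sines against the weight `x^{9/4}`. -/
noncomputable def triInt (X : ℝ) (m n k : ℕ) : ℝ :=
  ∫ x in (1 : ℝ)..X, x ^ (9 / 4 : ℝ) * (Real.sin (2 * π * √(m : ℝ) * √x + π / 4) *
    Real.sin (2 * π * √(n : ℝ) * √x + π / 4) * Real.sin (2 * π * √(k : ℝ) * √x + π / 4))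

theorem sin_mul_sin_mul_sin (u v w : ℝ) : Real.sin u * Real.sin v * Real.sin w =
    (Real.sin (u + v - w) + Real.sin (u + w - v) + Real.sin (v + w - u) - Real.sin (u + v + w)) / 4 := by
  simp only [Real.sin_sub, Real.sin_add, Real.cos_add]
  ring

theorem triInt_eq {X : ℝ} (hX : 1 ≤ X) (m n k : ℕ) : triInt X m n k =
    (oscInt (9 / 4) X (√(m : ℝ) + √(n : ℝ) - √(k : ℝ)) (π / 4) +
     oscInt (9 / 4) X (√(m : ℝ) + √(k : ℝ) - √(n : ℝ)) (π / 4) +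
     oscInt (9 / 4) X (√(n : ℝ) + √(k : ℝ) - √(m : ℝ)) (π / 4) -
     oscInt (9 / 4) X (√(m : ℝ) + √(n : ℝ) + √(k : ℝ)) (3 * π / 4)) / 4 := by
  have hc : ∀ u ψ : ℝ, IntervalIntegrable
      (fun x : ℝ => x ^ (9 / 4 : ℝ) * Real.sin (2 * π * u * √x + ψ)) volume 1 X := by
    intro u ψ
    apply ContinuousOn.intervalIntegrable
    rw [Set.uIcc_of_le hX]
    refine ContinuousOn.mul ?_ (by fun_prop)
    exact ContinuousOn.rpow_const continuousOn_id fun x hx => Or.inl (by simpa using (by linarith [hx.1] : x ≠ 0))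
  rw [oscInt, oscInt, oscInt, oscInt, ← intervalIntegral.integral_add (hc _ _) (hc _ _),
    ← intervalIntegral.integral_add ((hc _ _).add (hc _ _)) (hc _ _),
    ← intervalIntegral.integral_sub (((hc _ _).add (hc _ _)).add (hc _ _)) (hc _ _),
    ← intervalIntegral.integral_div, triInt]
  congr 1; ext x
  rw [sin_mul_sin_mul_sin]
  rw [show 2 * π * √(m : ℝ) * √x + π / 4 + (2 * π * √(n : ℝ) * √x + π / 4) - (2 * π * √(k : ℝ) * √x + π / 4)
      = 2 * π * (√(m : ℝ) + √(n : ℝ) - √(k : ℝ)) * √x + π / 4 by ring,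
    show 2 * π * √(m : ℝ) * √x + π / 4 + (2 * π * √(k : ℝ) * √x + π / 4) - (2 * π * √(n : ℝ) * √x + π / 4)
      = 2 * π * (√(m : ℝ) + √(k : ℝ) - √(n : ℝ)) * √x + π / 4 by ring,
    show 2 * π * √(n : ℝ) * √x + π / 4 + (2 * π * √(k : ℝ) * √x + π / 4) - (2 * π * √(m : ℝ) * √x + π / 4)
      = 2 * π * (√(n : ℝ) + √(k : ℝ) - √(m : ℝ)) * √x + π / 4 by ring,
    show 2 * π * √(m : ℝ) * √x + π / 4 + (2 * π * √(n : ℝ) * √x + π / 4) + (2 * π * √(k : ℝ) * √x + π / 4)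
      = 2 * π * (√(m : ℝ) + √(n : ℝ) + √(k : ℝ)) * √x + 3 * π / 4 by ring]
  ring

/-- The main-term integral attached to each resonance. -/
noncomputable def resWeight (X : ℝ) : ℝ :=
  Real.sin (π / 4) * ((X ^ (9 / 4 + 1 : ℝ) - 1) / (9 / 4 + 1))

theorem abs_triInt_sub_le {b : ℕ → ℝ} {B X : ℝ} (hX : 1 ≤ X) {m n k : ℕ} (hm : 1 ≤ m)
    (hbm : |b m| ≤ B * (m : ℝ) ^ (-(3 / 4) : ℝ)) (hbn : |b n| ≤ B * (n : ℝ) ^ (-(3 / 4) : ℝ))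
    (hbk : |b k| ≤ B * (k : ℝ) ^ (-(3 / 4) : ℝ)) (hB : 0 ≤ B) :
    |b m * b n * b k * triInt X m n k -
      resWeight X / 4 * (resTerm b m n k + resTerm b m k n + resTerm b n k m)|
      ≤ B ^ 3 * X ^ (11 / 4 : ℝ) * (triWt m n k * |√(m : ℝ) + √(n : ℝ) - √(k : ℝ)|⁻¹ +
        triWt m n k * |√(m : ℝ) + √(k : ℝ) - √(n : ℝ)|⁻¹ +
        triWt m n k * |√(n : ℝ) + √(k : ℝ) - √(m : ℝ)|⁻¹ + triWt m n k) := by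
  have hX0 : (0 : ℝ) < X := by linarith
  have e2 : (9 / 4 + 1 / 2 : ℝ) = 11 / 4 := by norm_num
  have key := fun s ψ => abs_oscInt_sub_le (k := 9 / 4) (by norm_num) hX s ψ
  rw [e2] at key
  have k1 := key (√(m : ℝ) + √(n : ℝ) - √(k : ℝ)) (π / 4)
  have k2 := key (√(m : ℝ) + √(k : ℝ) - √(n : ℝ)) (π / 4)
  have k3 := key (√(n : ℝ) + √(k : ℝ) - √(m : ℝ)) (π / 4)
  have hm1 : 1 ≤ √(m : ℝ) := Real.one_le_sqrt.2 (by exact_mod_cast hm)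
  have hn0 : 0 ≤ √(n : ℝ) := Real.sqrt_nonneg _
  have hk0 : 0 ≤ √(k : ℝ) := Real.sqrt_nonneg _
  have k4 := abs_oscInt_le (k := 9 / 4) (by norm_num) hX
    (s := √(m : ℝ) + √(n : ℝ) + √(k : ℝ)) (by positivity) (3 * π / 4)
  rw [e2] at k4
  have k4' : X ^ (11 / 4 : ℝ) * |√(m : ℝ) + √(n : ℝ) + √(k : ℝ)|⁻¹ ≤ X ^ (11 / 4 : ℝ) * 1 := by
    apply mul_le_mul_of_nonneg_left _ (by positivity)
    apply inv_le_one_of_one_le₀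
    rw [abs_of_nonneg (by positivity)]; linarith
  have hb3 : |b m * b n * b k| ≤ B ^ 3 * triWt m n k := by
    rw [abs_mul, abs_mul, triWt]
    calc _ ≤ (B * (m : ℝ) ^ (-(3 / 4) : ℝ)) * (B * (n : ℝ) ^ (-(3 / 4) : ℝ)) *
          (B * (k : ℝ) ^ (-(3 / 4) : ℝ)) := by gcongr
      _ = _ := by ring
  rw [triInt_eq hX]
  simp only [resTerm]
  have hW : ∀ s : ℝ, (if s = 0 then Real.sin (π / 4) * ((X ^ (9 / 4 + 1 : ℝ) - 1) / (9 / 4 + 1)) else 0)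
      = resWeight X * (if s = 0 then 1 else 0) := by
    intro s; rw [resWeight]; split_ifs <;> ring
  rw [hW] at k1 k2 k3
  generalize oscInt (9 / 4) X (√(m : ℝ) + √(n : ℝ) - √(k : ℝ)) (π / 4) = o1 at *
  generalize oscInt (9 / 4) X (√(m : ℝ) + √(k : ℝ) - √(n : ℝ)) (π / 4) = o2 at *
  generalize oscInt (9 / 4) X (√(n : ℝ) + √(k : ℝ) - √(m : ℝ)) (π / 4) = o3 at *
  generalize oscInt (9 / 4) X (√(m : ℝ) + √(n : ℝ) + √(k : ℝ)) (3 * π / 4) = o4 at *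
  generalize (if √(m : ℝ) + √(n : ℝ) - √(k : ℝ) = 0 then (1 : ℝ) else 0) = i1 at *
  generalize (if √(m : ℝ) + √(k : ℝ) - √(n : ℝ) = 0 then (1 : ℝ) else 0) = i2 at *
  generalize (if √(n : ℝ) + √(k : ℝ) - √(m : ℝ) = 0 then (1 : ℝ) else 0) = i3 at *
  generalize |√(m : ℝ) + √(n : ℝ) - √(k : ℝ)|⁻¹ = g1 at *
  generalize |√(m : ℝ) + √(k : ℝ) - √(n : ℝ)|⁻¹ = g2 at *
  generalize |√(n : ℝ) + √(k : ℝ) - √(m : ℝ)|⁻¹ = g3 at *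
  have e : b m * b n * b k * ((o1 + o2 + o3 - o4) / 4) - resWeight X / 4 *
      (b m * b n * b k * i1 + b m * b k * b n * i2 + b n * b k * b m * i3) = b m * b n * b k *
      (((o1 - resWeight X * i1) + (o2 - resWeight X * i2) + (o3 - resWeight X * i3) - o4) / 4) := by ring
  rw [e, abs_mul]
  have h5 : |((o1 - resWeight X * i1) + (o2 - resWeight X * i2) + (o3 - resWeight X * i3) - o4) / 4|
      ≤ X ^ (11 / 4 : ℝ) * (g1 + g2 + g3 + 1) := by
    rw [abs_div, abs_of_pos (by norm_num : (0 : ℝ) < 4)]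
    have hn := abs_nonneg (((o1 - resWeight X * i1) + (o2 - resWeight X * i2) + (o3 - resWeight X * i3) - o4))
    have h6 : |((o1 - resWeight X * i1) + (o2 - resWeight X * i2) + (o3 - resWeight X * i3) - o4)|
      ≤ |o1 - resWeight X * i1| + |o2 - resWeight X * i2| + |o3 - resWeight X * i3| + |o4| := by
      refine (abs_sub _ _).trans ?_
      gcongr
      refine (abs_add_le _ _).trans ?_
      gcongr
      exact abs_add_le _ _
    rw [div_le_iff₀ (by norm_num)]
    linarith
  refine (mul_le_mul hb3 h5 (abs_nonneg _) (by have := triWt_nonneg m n k; positivity)).trans (le_of_eq ?_)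
  ring

theorem resTerm_eq_zero {b : ℕ → ℝ} {m n k : ℕ} (h : k < n) : resTerm b m n k = 0 := by
  rw [resTerm, if_neg, mul_zero]
  have h1 : √(k : ℝ) < √(n : ℝ) := Real.sqrt_lt_sqrt (by positivity) (by exact_mod_cast h)
  have h2 : 0 ≤ √(m : ℝ) := Real.sqrt_nonneg _
  intro h3; linarith

theorem integral_sinSum_mul_eq {b : ℕ → ℝ} {X : ℝ} (hX : 1 ≤ X) (P Q : Finset ℕ) :
    ∫ x in (1 : ℝ)..X, x ^ (9 / 4 : ℝ) * (sinSum b P x ^ 2 * sinSum b Q x)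
      = ∑ m ∈ P, ∑ n ∈ P, ∑ k ∈ Q, b m * b n * b k * triInt X m n k := by
  have hterm : ∀ m n k : ℕ, IntervalIntegrable (fun x : ℝ => b m * b n * b k * (x ^ (9 / 4 : ℝ) *
      (Real.sin (2 * π * √(m : ℝ) * √x + π / 4) * Real.sin (2 * π * √(n : ℝ) * √x + π / 4) *
        Real.sin (2 * π * √(k : ℝ) * √x + π / 4)))) volume 1 X := by
    intro m n k
    apply ContinuousOn.intervalIntegrable
    rw [Set.uIcc_of_le hX]
    refine ContinuousOn.mul continuousOn_const (ContinuousOn.mul ?_ (by fun_prop))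
    exact ContinuousOn.rpow_const continuousOn_id fun x hx => Or.inl (by simpa using (by linarith [hx.1] : x ≠ 0))
  have hsum1 : ∀ m n : ℕ, IntervalIntegrable (fun x : ℝ => ∑ k ∈ Q, b m * b n * b k * (x ^ (9 / 4 : ℝ) *
      (Real.sin (2 * π * √(m : ℝ) * √x + π / 4) * Real.sin (2 * π * √(n : ℝ) * √x + π / 4) *
        Real.sin (2 * π * √(k : ℝ) * √x + π / 4)))) volume 1 X := by
    intro m n
    have := IntervalIntegrable.sum Q fun k _ => hterm m n k
    rwa [Finset.sum_fn] at this
  have hsum2 : ∀ m : ℕ, IntervalIntegrable (fun x : ℝ => ∑ n ∈ P, ∑ k ∈ Q, b m * b n * b k *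
      (x ^ (9 / 4 : ℝ) *
      (Real.sin (2 * π * √(m : ℝ) * √x + π / 4) * Real.sin (2 * π * √(n : ℝ) * √x + π / 4) *
        Real.sin (2 * π * √(k : ℝ) * √x + π / 4)))) volume 1 X := by
    intro m
    have := IntervalIntegrable.sum P fun n _ => hsum1 m n
    rwa [Finset.sum_fn] at this
  have h1 : ∀ m ∈ P, ∑ n ∈ P, ∑ k ∈ Q, b m * b n * b k * triInt X m n k =
      ∫ x in (1 : ℝ)..X, ∑ n ∈ P, ∑ k ∈ Q, b m * b n * b k * (x ^ (9 / 4 : ℝ) *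
      (Real.sin (2 * π * √(m : ℝ) * √x + π / 4) * Real.sin (2 * π * √(n : ℝ) * √x + π / 4) *
        Real.sin (2 * π * √(k : ℝ) * √x + π / 4))) := by
    intro m _
    rw [intervalIntegral.integral_finsetSum fun n _ => hsum1 m n]
    refine Finset.sum_congr rfl fun n _ => ?_
    rw [intervalIntegral.integral_finsetSum fun k _ => hterm m n k]
    refine Finset.sum_congr rfl fun k _ => ?_
    rw [intervalIntegral.integral_const_mul, triInt]
  rw [Finset.sum_congr rfl h1, ← intervalIntegral.integral_finsetSum fun m _ => hsum2 m]
  congr 1; ext x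
  rw [sinSum, sinSum, sq, Finset.sum_mul_sum, Finset.sum_mul, Finset.mul_sum]
  refine Finset.sum_congr rfl fun m _ => ?_
  rw [Finset.sum_mul, Finset.mul_sum]
  refine Finset.sum_congr rfl fun n _ => ?_
  rw [Finset.mul_sum, Finset.mul_sum]
  refine Finset.sum_congr rfl fun k _ => ?_
  ring

theorem sum_resTerm_inner {b : ℕ → ℝ} {M L : ℕ} (hML : M ≤ L) :
    ∑ m ∈ Finset.Icc 1 M, ∑ n ∈ Finset.Icc 1 M, ∑ k ∈ Finset.Icc 1 L, resTerm b m k n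
      = ∑ m ∈ Finset.Icc 1 M, ∑ n ∈ Finset.Icc 1 M, ∑ k ∈ Finset.Icc 1 M, resTerm b m n k := by
  refine Finset.sum_congr rfl fun m _ => ?_
  rw [Finset.sum_comm (t := Finset.Icc 1 M) (s := Finset.Icc 1 M) (f := fun n k => resTerm b m n k)]
  refine Finset.sum_congr rfl fun n hn => ?_
  symm
  apply Finset.sum_subset (Finset.Icc_subset_Icc_right hML)
  intro k hk hk2
  apply resTerm_eq_zero
  rw [Finset.mem_Icc] at *
  omega

theorem abs_integral_sinSum_cube_sub_le {b : ℕ → ℝ} {B X : ℝ} {M L : ℕ} (hX : 1 ≤ X)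
    (hM : 1 ≤ M) (hML : M ≤ L)
    (hb : ∀ n ∈ Finset.Icc 1 L, |b n| ≤ B * (n : ℝ) ^ (-(3 / 4) : ℝ)) (hB : 0 ≤ B) :
    |(∫ x in (1 : ℝ)..X, x ^ (9 / 4 : ℝ) * (sinSum b (Finset.Icc 1 M) x ^ 2 * sinSum b (Finset.Icc 1 L) x)) -
      resWeight X / 4 * (
        (∑ m ∈ Finset.Icc 1 M, ∑ n ∈ Finset.Icc 1 M, ∑ k ∈ Finset.Icc 1 L, resTerm b m n k) +
        2 * ∑ m ∈ Finset.Icc 1 M, ∑ n ∈ Finset.Icc 1 M, ∑ k ∈ Finset.Icc 1 M, resTerm b m n k)|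
      ≤ B ^ 3 * X ^ (11 / 4 : ℝ) *
        (256 * (M : ℝ) ^ (1 / 2 : ℝ) * (L : ℝ) ^ (1 / 4 : ℝ) + 5058 * (M : ℝ) ^ (5 / 4 : ℝ)) := by
  have hX0 : (0 : ℝ) < X := by linarith
  have hr3 : ∑ m ∈ Finset.Icc 1 M, ∑ n ∈ Finset.Icc 1 M, ∑ k ∈ Finset.Icc 1 L, resTerm b n k m
      = ∑ m ∈ Finset.Icc 1 M, ∑ n ∈ Finset.Icc 1 M, ∑ k ∈ Finset.Icc 1 M, resTerm b m n k := by
    rw [Finset.sum_comm]; exact sum_resTerm_inner hML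
  have hr2 := sum_resTerm_inner (b := b) hML
  have e1 : resWeight X / 4 * (
        (∑ m ∈ Finset.Icc 1 M, ∑ n ∈ Finset.Icc 1 M, ∑ k ∈ Finset.Icc 1 L, resTerm b m n k) +
        2 * ∑ m ∈ Finset.Icc 1 M, ∑ n ∈ Finset.Icc 1 M, ∑ k ∈ Finset.Icc 1 M, resTerm b m n k) =
      ∑ m ∈ Finset.Icc 1 M, ∑ n ∈ Finset.Icc 1 M, ∑ k ∈ Finset.Icc 1 L,
        resWeight X / 4 * (resTerm b m n k + resTerm b m k n + resTerm b n k m) := by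
    simp only [← Finset.mul_sum, Finset.sum_add_distrib]
    rw [hr2, hr3]; ring
  rw [integral_sinSum_mul_eq hX, e1]
  simp only [← Finset.sum_sub_distrib]
  have hle : ∀ m ∈ Finset.Icc 1 M, ∀ n ∈ Finset.Icc 1 M, ∀ k ∈ Finset.Icc 1 L,
      |b m * b n * b k * triInt X m n k -
        resWeight X / 4 * (resTerm b m n k + resTerm b m k n + resTerm b n k m)|
      ≤ B ^ 3 * X ^ (11 / 4 : ℝ) * (triWt m n k * |√(m : ℝ) + √(n : ℝ) - √(k : ℝ)|⁻¹ +
        triWt m n k * |√(m : ℝ) + √(k : ℝ) - √(n : ℝ)|⁻¹ +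
        triWt m n k * |√(n : ℝ) + √(k : ℝ) - √(m : ℝ)|⁻¹ + triWt m n k) := fun m hm n hn k hk =>
    abs_triInt_sub_le hX (Finset.mem_Icc.1 hm).1 (hb m (Finset.Icc_subset_Icc_right hML hm))
      (hb n (Finset.Icc_subset_Icc_right hML hn)) (hb k hk) hB
  have habs : |∑ m ∈ Finset.Icc 1 M, ∑ n ∈ Finset.Icc 1 M, ∑ k ∈ Finset.Icc 1 L,
      (b m * b n * b k * triInt X m n k -
        resWeight X / 4 * (resTerm b m n k + resTerm b m k n + resTerm b n k m))| ≤
      ∑ m ∈ Finset.Icc 1 M, ∑ n ∈ Finset.Icc 1 M, ∑ k ∈ Finset.Icc 1 L,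
      B ^ 3 * X ^ (11 / 4 : ℝ) * (triWt m n k * |√(m : ℝ) + √(n : ℝ) - √(k : ℝ)|⁻¹ +
        triWt m n k * |√(m : ℝ) + √(k : ℝ) - √(n : ℝ)|⁻¹ +
        triWt m n k * |√(n : ℝ) + √(k : ℝ) - √(m : ℝ)|⁻¹ + triWt m n k) := by
    refine (Finset.abs_sum_le_sum_abs _ _).trans (Finset.sum_le_sum fun m hm => ?_)
    refine (Finset.abs_sum_le_sum_abs _ _).trans (Finset.sum_le_sum fun n hn => ?_)
    exact (Finset.abs_sum_le_sum_abs _ _).trans (Finset.sum_le_sum fun k hk => hle m hm n hn k hk)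
  refine habs.trans ?_
  simp only [← Finset.mul_sum, Finset.sum_add_distrib]
  apply mul_le_mul_of_nonneg_left _ (by positivity)
  have h1 := sum_triWt_mul_inv_le_outer hM L
  have h2 := sum_triWt_mul_inv_le_inner hM L
  have h3 : ∑ m ∈ Finset.Icc 1 M, ∑ n ∈ Finset.Icc 1 M, ∑ k ∈ Finset.Icc 1 L,
      triWt m n k * |√(n : ℝ) + √(k : ℝ) - √(m : ℝ)|⁻¹ =
      ∑ m ∈ Finset.Icc 1 M, ∑ n ∈ Finset.Icc 1 M, ∑ k ∈ Finset.Icc 1 L,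
      triWt m n k * |√(m : ℝ) + √(k : ℝ) - √(n : ℝ)|⁻¹ := by
    rw [Finset.sum_comm]
    refine Finset.sum_congr rfl fun m _ => Finset.sum_congr rfl fun n _ => Finset.sum_congr rfl fun k _ => ?_
    rw [triWt, triWt]; ring
  have h4 := sum_triWt_le M L
  linarith

theorem sum_resTerm_eq_resonance {b : ℕ → ℝ} {M N : ℕ} (hMN : 4 * M ≤ N)
    (hb : ∀ n ∈ Finset.Icc 1 N, b n = coef n) :
    ∑ m ∈ Finset.Icc 1 M, ∑ n ∈ Finset.Icc 1 M, ∑ k ∈ Finset.Icc 1 N, resTerm b m n k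
      = ∑ m ∈ Finset.Icc 1 M, ∑ n ∈ Finset.Icc 1 M, resonance m n := by
  refine Finset.sum_congr rfl fun m hm => Finset.sum_congr rfl fun n hn => ?_
  have hm' := Finset.mem_Icc.1 hm
  have hn' := Finset.mem_Icc.1 hn
  rw [resonance, Finset.mul_sum]
  symm
  calc _ = ∑ k ∈ Finset.Icc 1 (2 * (m + n)), resTerm b m n k := by
        refine Finset.sum_congr rfl fun k hk => ?_
        have hk' := Finset.mem_Icc.1 hk
        rw [resTerm, hb m (Finset.mem_Icc.2 (by omega)), hb n (Finset.mem_Icc.2 (by omega)),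
          hb k (Finset.mem_Icc.2 (by omega))]
        by_cases h : √(m : ℝ) + √(n : ℝ) = √(k : ℝ)
        · rw [if_pos h, if_pos (by linarith)]; ring
        · rw [if_neg h, if_neg (fun h2 => h (by linarith))]; ring
    _ = _ := by
        apply Finset.sum_subset (Finset.Icc_subset_Icc_right (by omega))
        intro k hk hk2
        rw [resTerm, if_neg, mul_zero]
        intro h
        have := le_two_mul_add_of_sqrt_add_eq (by linarith : √(m : ℝ) + √(n : ℝ) = √(k : ℝ))
        rw [Finset.mem_Icc] at *
        omega

theorem continuousOn_rpow_mul_sinSum {b : ℕ → ℝ} {X : ℝ} (k : ℝ) (P Q : Finset ℕ) :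
    ContinuousOn (fun x : ℝ => x ^ k * (sinSum b P x ^ 2 * sinSum b Q x)) (Set.Icc 1 X) := by
  refine ContinuousOn.mul ?_ ?_
  · exact ContinuousOn.rpow_const continuousOn_id fun x hx => Or.inl (by simpa using (by linarith [hx.1] : x ≠ 0))
  · exact (((continuous_sinSum b P).pow 2).mul (continuous_sinSum b Q)).continuousOn

/-- The cubic main term. -/
theorem abs_integral_cubic_sub_le {b : ℕ → ℝ} {B X : ℝ} {M N : ℕ} (hX : 1 ≤ X)
    (hM : 1 ≤ M) (hMN : 4 * M ≤ N)
    (hb : ∀ n ∈ Finset.Icc 1 N, |b n| ≤ B * (n : ℝ) ^ (-(3 / 4) : ℝ)) (hB : 0 ≤ B)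
    (hbc : ∀ n ∈ Finset.Icc 1 N, b n = coef n) :
    |(∫ x in (1 : ℝ)..X, x ^ (9 / 4 : ℝ) * (3 * (sinSum b (Finset.Icc 1 M) x ^ 2 *
        sinSum b (Finset.Icc 1 N) x) - 2 * sinSum b (Finset.Icc 1 M) x ^ 3)) -
      3 / 4 * resWeight X * ∑ m ∈ Finset.Icc 1 M, ∑ n ∈ Finset.Icc 1 M, resonance m n|
      ≤ B ^ 3 * X ^ (11 / 4 : ℝ) *
        (768 * (M : ℝ) ^ (1 / 2 : ℝ) * (N : ℝ) ^ (1 / 4 : ℝ) + 26000 * (M : ℝ) ^ (5 / 4 : ℝ)) := by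
  have hML : M ≤ N := by omega
  have hX0 : (0 : ℝ) < X := by linarith
  have h1 := abs_integral_sinSum_cube_sub_le hX hM hML hb hB
  have h2 := abs_integral_sinSum_cube_sub_le hX hM le_rfl
    (fun n hn => hb n (Finset.Icc_subset_Icc_right hML hn)) hB
  rw [sum_resTerm_eq_resonance hMN hbc] at h1
  have hi : ∀ P Q : Finset ℕ, IntervalIntegrable (fun x : ℝ => x ^ (9 / 4 : ℝ) *
      (sinSum b P x ^ 2 * sinSum b Q x)) volume 1 X := fun P Q => by
    apply ContinuousOn.intervalIntegrable
    rw [Set.uIcc_of_le hX]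
    exact continuousOn_rpow_mul_sinSum _ _ _
  have e : ∫ x in (1 : ℝ)..X, x ^ (9 / 4 : ℝ) * (3 * (sinSum b (Finset.Icc 1 M) x ^ 2 *
        sinSum b (Finset.Icc 1 N) x) - 2 * sinSum b (Finset.Icc 1 M) x ^ 3) =
      3 * (∫ x in (1 : ℝ)..X, x ^ (9 / 4 : ℝ) * (sinSum b (Finset.Icc 1 M) x ^ 2 * sinSum b (Finset.Icc 1 N) x))
      - 2 * (∫ x in (1 : ℝ)..X, x ^ (9 / 4 : ℝ) *
        (sinSum b (Finset.Icc 1 M) x ^ 2 * sinSum b (Finset.Icc 1 M) x)) := by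
    rw [← intervalIntegral.integral_const_mul, ← intervalIntegral.integral_const_mul,
      ← intervalIntegral.integral_sub ((hi _ _).const_mul _) ((hi _ _).const_mul _)]
    congr 1; ext x; ring
  rw [e]
  have hM1 : (1 : ℝ) ≤ M := by exact_mod_cast hM
  have hM3 : (M : ℝ) ^ (1 / 2 : ℝ) * (M : ℝ) ^ (1 / 4 : ℝ) ≤ (M : ℝ) ^ (5 / 4 : ℝ) := by
    rw [← Real.rpow_add (by linarith)]
    exact Real.rpow_le_rpow_of_exponent_le hM1 (by norm_num)
  have hM4 := mul_le_mul_of_nonneg_left hM3 (by positivity : 0 ≤ B ^ 3 * X ^ (11 / 4 : ℝ))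
  have hM5 : 0 ≤ B ^ 3 * X ^ (11 / 4 : ℝ) * (M : ℝ) ^ (5 / 4 : ℝ) := by positivity
  rw [abs_le] at h1 h2 ⊢
  constructor
  · linarith [h1.1, h2.2]
  · linarith [h1.2, h2.1]

theorem monotone_NT : Monotone NT := by
  intro s t hst
  have hpi := Real.pi_pos
  rw [NT, NT]
  refine Nat.cast_le.2 (Set.ncard_le_ncard (fun q hq => le_trans hq hst) ?_)
  refine (finite_lattice_disc (t / (4 * π ^ 2))).subset ?_
  intro q hq
  simp only [Set.mem_ofPred_eq] at hq ⊢
  rw [le_div_iff₀ (by positivity)]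
  linarith

theorem summable_NH (t : ℝ) : Summable fun p : ℕ × ℕ =>
    if 2 * π * (p.1 + 1 : ℝ) * ((p.1 + 1 : ℝ) + 2 * (p.2 : ℝ) + 1) ≤ t then
      2 * (p.1 + 1 : ℝ) else 0 := by
  apply summable_of_hasFiniteSupport
  refine (((Set.finite_Iic ⌊t⌋₊).prod (Set.finite_Iic ⌊t⌋₊))).subset ?_
  intro p hp
  rw [Function.mem_support] at hp
  have h : 2 * π * (p.1 + 1 : ℝ) * ((p.1 + 1 : ℝ) + 2 * (p.2 : ℝ) + 1) ≤ t := by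
    by_contra h
    exact hp (if_neg h)
  have hpi := Real.pi_gt_three
  have h1 : (0 : ℝ) ≤ p.1 := Nat.cast_nonneg _
  have h2 : (0 : ℝ) ≤ p.2 := Nat.cast_nonneg _
  have h3 : (p.1 + 1 : ℝ) * ((p.1 + 1 : ℝ) + 2 * (p.2 : ℝ) + 1) ≤
      2 * π * ((p.1 + 1 : ℝ) * ((p.1 + 1 : ℝ) + 2 * (p.2 : ℝ) + 1)) :=
    le_mul_of_one_le_left (by positivity) (by linarith)
  have h4 : 0 ≤ (p.1 : ℝ) * p.2 := by positivity
  have h5 : 0 ≤ (p.1 : ℝ) * p.1 := by positivity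
  refine ⟨Nat.le_floor (by nlinarith), Nat.le_floor (by nlinarith)⟩

theorem monotone_NH : Monotone NH := by
  intro s t hst
  refine (summable_NH s).tsum_le_tsum (fun p => ?_) (summable_NH t)
  by_cases h : 2 * π * (p.1 + 1 : ℝ) * ((p.1 + 1 : ℝ) + 2 * (p.2 : ℝ) + 1) ≤ s
  · rw [if_pos h, if_pos (h.trans hst)]
  · rw [if_neg h]; split_ifs <;> positivity

theorem measurable_R : Measurable R := by
  unfold R
  exact (monotone_NT.measurable.add monotone_NH.measurable).sub (by fun_prop)

theorem abs_R_le {x : ℝ} (hx : 1 ≤ x) : |R (2 * π * x)| ≤ 34 * x := by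
  have h := abs_R_add_sum_saw_le hx
  have hs : √x ≤ x := by
    rw [Real.sqrt_le_left (by linarith)]; nlinarith
  have h1 : |2 * ∑ i ∈ Finset.range ⌊√x⌋₊, ((i : ℝ) + 1) * saw (sawArg x (i + 1))| ≤ x := by
    rw [abs_mul, abs_two]
    have : |∑ i ∈ Finset.range ⌊√x⌋₊, ((i : ℝ) + 1) * saw (sawArg x (i + 1))| ≤ √x * (√x * (1 / 2)) := by
      refine (Finset.abs_sum_le_sum_abs _ _).trans ?_
      refine (Finset.sum_le_card_nsmul _ _ (√x * (1 / 2)) ?_).trans ?_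
      · intro i hi
        rw [abs_mul, abs_of_nonneg (by positivity : (0 : ℝ) ≤ (i : ℝ) + 1)]
        have hi' : ((i + 1 : ℕ) : ℝ) ≤ √x := by
          have : i + 1 ≤ ⌊√x⌋₊ := Finset.mem_range.1 hi
          exact (Nat.le_floor_iff (Real.sqrt_nonneg x)).1 this
        push_cast at hi'
        exact mul_le_mul hi' (abs_saw_le _) (abs_nonneg _) (Real.sqrt_nonneg x)
      · rw [Finset.card_range, nsmul_eq_mul]
        exact mul_le_mul_of_nonneg_right (Nat.floor_le (Real.sqrt_nonneg x)) (by positivity)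
    rw [← mul_assoc, Real.mul_self_sqrt (by linarith)] at this
    linarith
  rw [abs_le] at h h1 ⊢
  constructor <;> linarith

theorem abs_cube_sub_le {A b f α β γ τ : ℝ} (hτ : 0 < τ) (hA : |A| ≤ α) (hb : |b| ≤ β)
    (hf : |f| ≤ γ) :
    |(A + b + f) ^ 3 - (A ^ 3 + 3 * (A ^ 2 * b))| ≤ 3 / 2 * α * τ * A ^ 2 +
      (6 * α + 4 * β) * b ^ 2 + (3 / 2 * α / τ + 6 * α + 4 * γ) * f ^ 2 := by
  have e : (A + b + f) ^ 3 - (A ^ 3 + 3 * (A ^ 2 * b)) =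
      3 * A ^ 2 * f + 3 * A * (b + f) ^ 2 + (b + f) ^ 3 := by ring
  have hα : 0 ≤ α := (abs_nonneg A).trans hA
  have h1 : |3 * A ^ 2 * f| ≤ 3 / 2 * α * (τ * A ^ 2 + f ^ 2 / τ) := by
    have : |A| * |f| ≤ (τ * A ^ 2 + f ^ 2 / τ) / 2 := by
      rw [← sq_abs A, ← sq_abs f]
      have : 0 ≤ (τ * |A| - |f|) ^ 2 / τ := by positivity
      have e2 : (τ * |A| - |f|) ^ 2 / τ = τ * |A| ^ 2 - 2 * (|A| * |f|) + |f| ^ 2 / τ := by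
        field_simp; ring
      linarith
    rw [abs_mul, abs_mul, abs_of_pos (by norm_num : (0 : ℝ) < 3), abs_pow]
    calc 3 * |A| ^ 2 * |f| = 3 * (|A| * (|A| * |f|)) := by ring
      _ ≤ 3 * (α * ((τ * A ^ 2 + f ^ 2 / τ) / 2)) := by gcongr
      _ = _ := by ring
  have h2 : |3 * A * (b + f) ^ 2| ≤ 6 * α * (b ^ 2 + f ^ 2) := by
    rw [abs_mul, abs_mul, abs_of_pos (by norm_num : (0 : ℝ) < 3), abs_of_nonneg (sq_nonneg (b + f))]
    have : (b + f) ^ 2 ≤ 2 * (b ^ 2 + f ^ 2) := by nlinarith [sq_nonneg (b - f)]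
    calc 3 * |A| * (b + f) ^ 2 ≤ 3 * α * (2 * (b ^ 2 + f ^ 2)) := by gcongr
      _ = _ := by ring
  have h3 : |(b + f) ^ 3| ≤ 4 * (β * b ^ 2 + γ * f ^ 2) := by
    rw [abs_pow, ← sq_abs b, ← sq_abs f]
    have hb0 := abs_nonneg b
    have hf0 := abs_nonneg f
    calc |b + f| ^ 3 ≤ (|b| + |f|) ^ 3 := by gcongr; exact abs_add_le _ _
      _ ≤ 4 * (|b| * |b| ^ 2 + |f| * |f| ^ 2) := by
        nlinarith [mul_nonneg (add_nonneg hb0 hf0) (sq_nonneg (|b| - |f|))]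
      _ ≤ _ := by gcongr
  rw [e]
  calc _ ≤ |3 * A ^ 2 * f| + |3 * A * (b + f) ^ 2| + |(b + f) ^ 3| :=
        (abs_add_le _ _).trans (by gcongr; exact abs_add_le _ _)
    _ ≤ _ := add_le_add (add_le_add h1 h2) h3
    _ = _ := by ring

theorem abs_integral_cube_sub_le {ρ A b f : ℝ → ℝ} {X α β γ τ a2 b2 f2 : ℝ} (hX : 1 ≤ X)
    (hτ : 0 < τ) (hρ : ∀ x ∈ Set.Icc 1 X, ρ x = A x + b x + f x)
    (hA : ∀ x ∈ Set.Icc 1 X, |A x| ≤ α) (hb : ∀ x ∈ Set.Icc 1 X, |b x| ≤ β)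
    (hf : ∀ x ∈ Set.Icc 1 X, |f x| ≤ γ)
    (cA : ContinuousOn A (Set.uIcc 1 X)) (cb : ContinuousOn b (Set.uIcc 1 X))
    (if2 : IntervalIntegrable (fun x => f x ^ 2) volume 1 X)
    (iρ : IntervalIntegrable (fun x => ρ x ^ 3) volume 1 X)
    (ha2 : ∫ x in (1 : ℝ)..X, A x ^ 2 ≤ a2) (hb2 : ∫ x in (1 : ℝ)..X, b x ^ 2 ≤ b2)
    (hf2 : ∫ x in (1 : ℝ)..X, f x ^ 2 ≤ f2) :
    |(∫ x in (1 : ℝ)..X, ρ x ^ 3) - ∫ x in (1 : ℝ)..X, (A x ^ 3 + 3 * (A x ^ 2 * b x))| ≤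
      3 / 2 * α * τ * a2 + (6 * α + 4 * β) * b2 + (3 / 2 * α / τ + 6 * α + 4 * γ) * f2 := by
  have h1 : (1 : ℝ) ∈ Set.Icc 1 X := ⟨le_rfl, hX⟩
  have hα : 0 ≤ α := (abs_nonneg _).trans (hA 1 h1)
  have hβ : 0 ≤ β := (abs_nonneg _).trans (hb 1 h1)
  have hγ : 0 ≤ γ := (abs_nonneg _).trans (hf 1 h1)
  have i1 : IntervalIntegrable (fun x => A x ^ 2) volume 1 X := (cA.pow 2).intervalIntegrable
  have i2 : IntervalIntegrable (fun x => b x ^ 2) volume 1 X := (cb.pow 2).intervalIntegrable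
  have i3 : IntervalIntegrable (fun x => A x ^ 3 + 3 * (A x ^ 2 * b x)) volume 1 X :=
    ((cA.pow 3).add (continuousOn_const.mul ((cA.pow 2).mul cb))).intervalIntegrable
  rw [← intervalIntegral.integral_sub iρ i3]
  refine (intervalIntegral.abs_integral_le_integral_abs hX).trans ?_
  have hInt : ∫ x in (1 : ℝ)..X, (3 / 2 * α * τ * A x ^ 2 + (6 * α + 4 * β) * b x ^ 2 +
      (3 / 2 * α / τ + 6 * α + 4 * γ) * f x ^ 2) = 3 / 2 * α * τ * (∫ x in (1 : ℝ)..X, A x ^ 2) +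
      (6 * α + 4 * β) * (∫ x in (1 : ℝ)..X, b x ^ 2) +
      (3 / 2 * α / τ + 6 * α + 4 * γ) * ∫ x in (1 : ℝ)..X, f x ^ 2 := by
    rw [intervalIntegral.integral_add ((i1.const_mul _).add (i2.const_mul _)) (if2.const_mul _),
      intervalIntegral.integral_add (i1.const_mul _) (i2.const_mul _)]
    simp only [intervalIntegral.integral_const_mul]
  calc _ ≤ ∫ x in (1 : ℝ)..X, (3 / 2 * α * τ * A x ^ 2 + (6 * α + 4 * β) * b x ^ 2 +
        (3 / 2 * α / τ + 6 * α + 4 * γ) * f x ^ 2) := by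
        refine intervalIntegral.integral_mono_on hX (iρ.sub i3).abs
          (((i1.const_mul _).add (i2.const_mul _)).add (if2.const_mul _)) fun x hx => ?_
        rw [hρ x hx]
        exact abs_cube_sub_le hτ (hA x hx) (hb x hx) (hf x hx)
    _ = _ := hInt
    _ ≤ _ := by gcongr

theorem pow_rpow_eq_pow {W : ℝ} (hW : 0 ≤ W) {n m : ℕ} {r : ℝ} (h : (n : ℝ) * r = m) :
    (W ^ n) ^ r = W ^ m := by
  rw [← Real.rpow_natCast, ← Real.rpow_mul hW, h, Real.rpow_natCast]

/-- The contribution of the frequencies in `P` to the Voronoi-type expansion. -/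
noncomputable def voronoiPart (b : ℕ → ℝ) (P : Finset ℕ) (x : ℝ) : ℝ :=
  2 / π * x ^ (3 / 4 : ℝ) * sinSum b P x

theorem two_div_pi_le_one : 2 / π ≤ 1 := by
  rw [div_le_one Real.pi_pos]; linarith [Real.pi_gt_three]

theorem continuousOn_voronoiPart (b : ℕ → ℝ) (P : Finset ℕ) {X : ℝ} (hX : 1 ≤ X) :
    ContinuousOn (voronoiPart b P) (Set.uIcc 1 X) := by
  rw [Set.uIcc_of_le hX]
  exact (continuousOn_const.mul (continuousOn_id.rpow_const fun x hx => Or.inl (by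
    simpa using (by linarith [hx.1] : x ≠ 0)))).mul (continuous_sinSum b P).continuousOn

theorem voronoiPart_sq_le (b : ℕ → ℝ) (P : Finset ℕ) {x : ℝ} (hx : 1 ≤ x) :
    voronoiPart b P x ^ 2 ≤ x ^ (3 / 2 : ℝ) * sinSum b P x ^ 2 := by
  have h : (x ^ (3 / 4 : ℝ)) ^ 2 = x ^ (3 / 2 : ℝ) := by
    rw [← Real.rpow_natCast, ← Real.rpow_mul (by linarith)]; norm_num
  have hU : (2 / π) ^ 2 ≤ 1 := pow_le_one₀ (by positivity) two_div_pi_le_one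
  rw [voronoiPart, mul_pow, mul_pow, h, mul_assoc]
  exact mul_le_of_le_one_left (by positivity) hU

theorem integral_voronoiPart_sq_le {b : ℕ → ℝ} {P : Finset ℕ} {B G W s : ℝ} {K : ℕ} {j : ℕ}
    (hW : 1 ≤ W)
    (hP : P ⊆ Finset.Icc 1 K) (hb : ∀ n ∈ P, |b n| ≤ B * (n : ℝ) ^ (-(3 / 4) : ℝ)) (hB : 0 ≤ B)
    (hBG : B ≤ G) (hG : 1 ≤ G) (hK : 1 + Real.log K ≤ G) (hj : 56 ≤ j)
    (hS : W ^ 140 * ∑ n ∈ P, (n : ℝ) ^ (-(3 / 2) : ℝ) ≤ s * W ^ (2 * j)) :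
    ∫ x in (1 : ℝ)..W ^ 56, voronoiPart b P x ^ 2 ≤ (s + 8) * G ^ 4 * W ^ (2 * j) := by
  have hX : 1 ≤ W ^ 56 := one_le_pow₀ hW
  have c1 : ContinuousOn (fun x => x ^ (3 / 2 : ℝ) * sinSum b P x ^ 2) (Set.uIcc 1 (W ^ 56)) := by
    rw [Set.uIcc_of_le hX]
    exact (continuousOn_id.rpow_const fun x hx => Or.inl (by
      simpa using (by linarith [hx.1] : x ≠ 0))).mul ((continuous_sinSum b P).continuousOn.pow 2)
  have hK0 : 0 ≤ 1 + Real.log K := by linarith [log_natCast_nonneg K]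
  have e1 : (W ^ 56) ^ (5 / 2 : ℝ) = W ^ 140 := pow_rpow_eq_pow (by linarith) (by norm_num)
  have hW0 : 0 < W := by linarith
  have hBG2 : B ^ 2 ≤ G ^ 2 := pow_le_pow_left₀ hB hBG 2
  have hBG4 : B ^ 2 ≤ G ^ 4 := hBG2.trans (pow_le_pow_right₀ hG (by norm_num))
  calc _ ≤ ∫ x in (1 : ℝ)..W ^ 56, x ^ (3 / 2 : ℝ) * sinSum b P x ^ 2 :=
        intervalIntegral.integral_mono_on hX
          ((continuousOn_voronoiPart b P hX).pow 2).intervalIntegrable c1.intervalIntegrable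
          fun x hx => voronoiPart_sq_le b P hx.1
    _ ≤ B ^ 2 * (W ^ 56) ^ (5 / 2 : ℝ) * ∑ n ∈ P, (n : ℝ) ^ (-(3 / 2) : ℝ) +
        8 * B ^ 2 * (W ^ 56) ^ 2 * (1 + Real.log K) ^ 2 := integral_sinSum_sq_le hX hP hb hB
    _ = B ^ 2 * (W ^ 140 * ∑ n ∈ P, (n : ℝ) ^ (-(3 / 2) : ℝ)) +
        8 * B ^ 2 * W ^ 112 * (1 + Real.log K) ^ 2 := by rw [e1]; ring
    _ ≤ G ^ 4 * (s * W ^ (2 * j)) + 8 * G ^ 2 * W ^ (2 * j) * G ^ 2 := by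
        refine add_le_add (mul_le_mul hBG4 hS (mul_nonneg (pow_nonneg hW0.le _)
          (Finset.sum_nonneg fun n _ => by positivity)) (by positivity)) ?_
        exact mul_le_mul (mul_le_mul (mul_le_mul_of_nonneg_left hBG2 (by norm_num))
          (pow_le_pow_right₀ hW (by omega)) (by positivity) (by positivity))
          (pow_le_pow_left₀ hK0 hK 2) (by positivity) (by positivity)
    _ = _ := by ring

theorem abs_voronoiPart_le {b : ℕ → ℝ} {P : Finset ℕ} {B W x : ℝ} {K : ℕ} (hW : 1 ≤ W)
    (hP : P ⊆ Finset.Icc 1 K) (hb : ∀ n ∈ P, |b n| ≤ B * (n : ℝ) ^ (-(3 / 4) : ℝ)) (hB : 0 ≤ B)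
    (hx : x ∈ Set.Icc 1 (W ^ 56)) :
    |voronoiPart b P x| ≤ 4 * B * W ^ 42 * (K : ℝ) ^ (1 / 4 : ℝ) := by
  have h1 := abs_sinSum_le hP hb hB x
  have h0 : 0 < x := by linarith [hx.1]
  have h2 : x ^ (3 / 4 : ℝ) ≤ W ^ 42 := by
    refine (Real.rpow_le_rpow h0.le hx.2 (by norm_num)).trans (le_of_eq ?_)
    exact pow_rpow_eq_pow (by linarith) (by norm_num)
  rw [voronoiPart, abs_mul, abs_mul, abs_of_nonneg (by positivity : 0 ≤ 2 / π),
    abs_of_nonneg (by positivity : 0 ≤ x ^ (3 / 4 : ℝ))]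
  calc _ ≤ 1 * W ^ 42 * (4 * B * (K : ℝ) ^ (1 / 4 : ℝ)) := by
        gcongr; exact two_div_pi_le_one
    _ = _ := by ring

theorem sinSum_Ioc (b : ℕ → ℝ) {M N : ℕ} (hMN : M ≤ N) (x : ℝ) :
    sinSum b (Finset.Ioc M N) x = sinSum b (Finset.Icc 1 N) x - sinSum b (Finset.Icc 1 M) x := by
  have h : ∀ K : ℕ, Finset.Icc 1 K = Finset.Ioc 0 K := fun K => by
    ext n; simp only [Finset.mem_Icc, Finset.mem_Ioc]; omega
  rw [h, h, eq_sub_iff_add_eq', sinSum, sinSum, sinSum,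
    Finset.sum_Ioc_consecutive _ (Nat.zero_le M) hMN]

theorem coefTrunc_sum_eq (Z : ℕ) {x : ℝ} {M N : ℕ} (hMN : M ≤ N) (hNZ : N ≤ Z ^ 14) :
    2 / π * x ^ (3 / 4 : ℝ) * ∑ n ∈ Finset.Icc 1 (Z ^ 14),
      coefTrunc Z n * Real.sin (2 * π * √(n * x) + π / 4) =
    voronoiPart (coefTrunc Z) (Finset.Icc 1 M) x + voronoiPart (coefTrunc Z) (Finset.Ioc M N) x +
      voronoiPart (coefTrunc Z) (Finset.Ioc N (Z ^ 14)) x := by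
  have h : ∑ n ∈ Finset.Icc 1 (Z ^ 14), coefTrunc Z n * Real.sin (2 * π * √(n * x) + π / 4) =
      sinSum (coefTrunc Z) (Finset.Icc 1 (Z ^ 14)) x := by
    rw [sinSum]
    refine Finset.sum_congr rfl fun n _ => ?_
    rw [Real.sqrt_mul (Nat.cast_nonneg n), ← mul_assoc]
  rw [h, voronoiPart, voronoiPart, voronoiPart, sinSum_Ioc _ hMN, sinSum_Ioc _ hNZ]
  ring

theorem abs_integral_R_cube_sub_le {W B G : ℝ} {M N Z : ℕ} (hW : 1 ≤ W) (hM1 : 1 ≤ M)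
    (hMl : W ^ 20 / 4 ≤ M) (hMu : (M : ℝ) ≤ W ^ 20) (hNl : W ^ 32 ≤ N) (hNu : (N : ℝ) ≤ 4 * W ^ 32)
    (hMN : M ≤ N) (hZ : 2 ≤ Z) (hNZ : N ≤ Z ^ 14) (hXZ : W ^ 56 < (Z : ℝ) ^ 2)
    (hb : ∀ n ∈ Finset.Icc 1 (Z ^ 14), |coefTrunc Z n| ≤ B * (n : ℝ) ^ (-(3 / 4) : ℝ))
    (hB : 0 ≤ B) (hBG : B ≤ G) (hG : 1 ≤ G) (hK : 1 + Real.log ((Z ^ 14 : ℕ) : ℝ) ≤ G) :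
    |(∫ x in (1 : ℝ)..W ^ 56, R (2 * π * x) ^ 3) - ∫ x in (1 : ℝ)..W ^ 56,
      (voronoiPart (coefTrunc Z) (Finset.Icc 1 M) x ^ 3 +
        3 * (voronoiPart (coefTrunc Z) (Finset.Icc 1 M) x ^ 2 *
          voronoiPart (coefTrunc Z) (Finset.Ioc M N) x))| ≤ 10 ^ 9 * G ^ 5 * W ^ 180 := by
  have hX : 1 ≤ W ^ 56 := one_le_pow₀ hW
  have hW0 : 0 < W := by linarith
  have hG0 : 0 < G := by linarith
  have hlogZ := log_natCast_nonneg Z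
  have hpi := Real.pi_pos
  rw [log_natCast_pow] at hK
  push_cast at hK
  have hlog : 1 + Real.log Z ≤ G := by linarith
  set b := coefTrunc Z with hbdef
  set P₁ := Finset.Icc 1 M with hP₁
  set P₂ := Finset.Ioc M N with hP₂
  set P₃ := Finset.Ioc N (Z ^ 14) with hP₃
  have hKM : 1 + Real.log M ≤ G := by
    refine le_trans ?_ hK
    have h : Real.log M ≤ Real.log ((Z ^ 14 : ℕ) : ℝ) :=
      Real.log_le_log (by exact_mod_cast hM1) (by exact_mod_cast hMN.trans hNZ)
    rw [log_natCast_pow] at h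
    push_cast at h
    linarith
  have hKN : 1 + Real.log N ≤ G := by
    refine le_trans ?_ hK
    have h : Real.log N ≤ Real.log ((Z ^ 14 : ℕ) : ℝ) :=
      Real.log_le_log (by exact_mod_cast hM1.trans hMN) (by exact_mod_cast hNZ)
    rw [log_natCast_pow] at h
    push_cast at h
    linarith
  have s₁ : P₁ ⊆ Finset.Icc 1 M := subset_rfl
  have s₂ : P₂ ⊆ Finset.Icc 1 N := fun n hn => by
    rw [hP₂, Finset.mem_Ioc] at hn; rw [Finset.mem_Icc]; omega
  have s₃ : P₃ ⊆ Finset.Icc 1 (Z ^ 14) := fun n hn => by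
    rw [hP₃, Finset.mem_Ioc] at hn; rw [Finset.mem_Icc]; omega
  have t₂ : Finset.Icc 1 N ⊆ Finset.Icc 1 (Z ^ 14) := Finset.Icc_subset_Icc_right hNZ
  have t₁ : Finset.Icc 1 M ⊆ Finset.Icc 1 (Z ^ 14) := Finset.Icc_subset_Icc_right (hMN.trans hNZ)
  have b₁ : ∀ n ∈ P₁, |b n| ≤ B * (n : ℝ) ^ (-(3 / 4) : ℝ) := fun n hn => hb n (t₁ (s₁ hn))
  have b₂ : ∀ n ∈ P₂, |b n| ≤ B * (n : ℝ) ^ (-(3 / 4) : ℝ) := fun n hn => hb n (t₂ (s₂ hn))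
  have b₃ : ∀ n ∈ P₃, |b n| ≤ B * (n : ℝ) ^ (-(3 / 4) : ℝ) := fun n hn => hb n (s₃ hn)
  have hMpow : (M : ℝ) ^ (1 / 4 : ℝ) ≤ W ^ 5 := by
    refine (Real.rpow_le_rpow (by positivity) hMu (by norm_num)).trans (le_of_eq ?_)
    exact pow_rpow_eq_pow hW0.le (by norm_num)
  have hNpow : (N : ℝ) ^ (1 / 4 : ℝ) ≤ 2 * W ^ 8 := by
    refine (Real.rpow_le_rpow (by positivity)
      (hNu.trans (by gcongr; norm_num : 4 * W ^ 32 ≤ 2 ^ 4 * W ^ 32)) (by norm_num)).trans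
      (le_of_eq ?_)
    rw [Real.mul_rpow (by norm_num) (by positivity),
      pow_rpow_eq_pow (by norm_num) (by norm_num : ((4 : ℕ) : ℝ) * (1 / 4) = (1 : ℕ)),
      pow_rpow_eq_pow hW0.le (by norm_num : ((32 : ℕ) : ℝ) * (1 / 4) = (8 : ℕ)), pow_one]
  have hMtail : (M : ℝ) ^ (-(1 / 2) : ℝ) ≤ 2 * (W ^ 10)⁻¹ := by
    refine (Real.rpow_le_rpow_of_nonpos (by positivity) hMl (by norm_num)).trans (le_of_eq ?_)
    rw [Real.rpow_neg (by positivity), Real.div_rpow (by positivity) (by norm_num),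
      pow_rpow_eq_pow hW0.le (by norm_num : ((20 : ℕ) : ℝ) * (1 / 2) = (10 : ℕ)),
      show (4 : ℝ) = 2 ^ 2 by norm_num,
      pow_rpow_eq_pow (by norm_num) (by norm_num : ((2 : ℕ) : ℝ) * (1 / 2) = (1 : ℕ)), pow_one,
      inv_div, div_eq_mul_inv]
  have hNtail : (N : ℝ) ^ (-(1 / 2) : ℝ) ≤ (W ^ 16)⁻¹ := by
    refine (Real.rpow_le_rpow_of_nonpos (by positivity) hNl (by norm_num)).trans (le_of_eq ?_)
    rw [Real.rpow_neg (by positivity),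
      pow_rpow_eq_pow hW0.le (by norm_num : ((32 : ℕ) : ℝ) * (1 / 2) = (16 : ℕ))]
  have S₁ : W ^ 140 * ∑ n ∈ P₁, (n : ℝ) ^ (-(3 / 2) : ℝ) ≤ 3 * W ^ (2 * 70) := by
    have h := sum_rpow_tail_le (le_refl 1) M
    rw [Nat.cast_one, Real.one_rpow] at h
    have e : P₁ = insert 1 (Finset.Ioc 1 M) := by
      ext n; simp only [hP₁, Finset.mem_Icc, Finset.mem_insert, Finset.mem_Ioc]; omega
    rw [e, Finset.sum_insert (by simp), Nat.cast_one, Real.one_rpow, mul_comm]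
    exact mul_le_mul_of_nonneg_right (by linarith) (pow_nonneg hW0.le _)
  have S₂ : W ^ 140 * ∑ n ∈ P₂, (n : ℝ) ^ (-(3 / 2) : ℝ) ≤ 4 * W ^ (2 * 65) := by
    have h := (sum_rpow_tail_le hM1 N).trans (mul_le_mul_of_nonneg_left hMtail two_pos.le)
    refine (mul_le_mul_of_nonneg_left h (pow_nonneg hW0.le _)).trans (le_of_eq ?_)
    rw [show W ^ 140 = W ^ 130 * W ^ 10 by ring]
    field_simp
    ring
  have S₃ : W ^ 140 * ∑ n ∈ P₃, (n : ℝ) ^ (-(3 / 2) : ℝ) ≤ 2 * W ^ (2 * 62) := by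
    have h := (sum_rpow_tail_le (hM1.trans hMN) (Z ^ 14)).trans
      (mul_le_mul_of_nonneg_left hNtail two_pos.le)
    refine (mul_le_mul_of_nonneg_left h (pow_nonneg hW0.le _)).trans (le_of_eq ?_)
    rw [show W ^ 140 = W ^ 124 * W ^ 16 by ring]
    field_simp
  have a2 := integral_voronoiPart_sq_le hW s₁ b₁ hB hBG hG hKM (by norm_num) S₁
  have b2 := integral_voronoiPart_sq_le hW s₂ b₂ hB hBG hG hKN (by norm_num) S₂
  have c2 := integral_voronoiPart_sq_le hW s₃ b₃ hB hBG hG (by rw [log_natCast_pow]; push_cast; exact hK)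
    (by norm_num) S₃
  have aα : ∀ x ∈ Set.Icc 1 (W ^ 56), |voronoiPart b P₁ x| ≤ 4 * G * W ^ 47 := fun x hx => by
    refine (abs_voronoiPart_le hW s₁ b₁ hB hx).trans ?_
    calc _ ≤ 4 * G * W ^ 42 * W ^ 5 := by gcongr
      _ = _ := by ring
  have aβ : ∀ x ∈ Set.Icc 1 (W ^ 56), |voronoiPart b P₂ x| ≤ 8 * G * W ^ 50 := fun x hx => by
    refine (abs_voronoiPart_le hW s₂ b₂ hB hx).trans ?_
    calc _ ≤ 4 * G * W ^ 42 * (2 * W ^ 8) := by gcongr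
      _ = _ := by ring
  set f : ℝ → ℝ := fun x => R (2 * π * x) - voronoiPart b P₁ x - voronoiPart b P₂ x with hf
  have aγ : ∀ x ∈ Set.Icc 1 (W ^ 56), |f x| ≤ 46 * G * W ^ 56 := fun x hx => by
    have h1 := abs_R_le hx.1
    have h2 := aα x hx
    have h3 := aβ x hx
    have h4 : G * W ^ 47 ≤ G * W ^ 56 := by gcongr; norm_num
    have h5 : G * W ^ 50 ≤ G * W ^ 56 := by gcongr; norm_num
    have h6 : x ≤ G * W ^ 56 := hx.2.trans (le_mul_of_one_le_left (by positivity) hG)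
    rw [hf]
    beta_reduce
    rw [abs_le] at *
    constructor <;> linarith
  have mR : Measurable fun x => R (2 * π * x) := measurable_R.comp (by fun_prop)
  have cA := continuousOn_voronoiPart b P₁ hX
  have cB := continuousOn_voronoiPart b P₂ hX
  have cC := continuousOn_voronoiPart b P₃ hX
  have iRb : ∀ k : ℕ, IntervalIntegrable (fun x => R (2 * π * x) ^ k) volume 1 (W ^ 56) := fun k => by
    rw [intervalIntegrable_iff]
    refine Measure.integrableOn_of_bounded (M := (34 * W ^ 56) ^ k) ?_ (mR.pow_const k).aestronglyMeasurable ?_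
    · rw [Set.uIoc_of_le hX]; simp
    · refine (ae_restrict_iff' measurableSet_uIoc).2 (Filter.Eventually.of_forall fun x hx => ?_)
      rw [Set.uIoc_of_le hX] at hx
      rw [Real.norm_eq_abs, abs_pow]
      have := abs_R_le hx.1.le
      exact pow_le_pow_left₀ (abs_nonneg _) (this.trans (by linarith [hx.2])) k
  have if2 : IntervalIntegrable (fun x => f x ^ 2) volume 1 (W ^ 56) := by
    have e : (fun x => f x ^ 2) = fun x => R (2 * π * x) ^ 2 -
        (2 * (voronoiPart b P₁ x + voronoiPart b P₂ x)) * R (2 * π * x) ^ 1 +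
        (voronoiPart b P₁ x + voronoiPart b P₂ x) ^ 2 := by
      funext x; rw [hf]; ring
    rw [e]
    exact ((iRb 2).sub ((iRb 1).continuousOn_mul (continuousOn_const.mul (cA.add cB)))).add
      ((cA.add cB).pow 2).intervalIntegrable
  have iE : IntervalIntegrable (fun x => voronoiErr Z x ^ 2) volume 1 (W ^ 56) := by
    refine intervalIntegrable_of_bdd (B := (160 * (1 + Real.log Z) ^ 2 * Z ^ 2) ^ 2)
      ((measurable_voronoiErr Z).pow_const 2) (fun x => ?_) _ _
    rw [abs_pow, abs_of_nonneg (voronoiErr_nonneg Z x)]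
    exact pow_le_pow_left₀ (voronoiErr_nonneg Z x) (voronoiErr_le Z x) 2
  have f2 : ∫ x in (1 : ℝ)..W ^ 56, f x ^ 2 ≤ 4000000 * G ^ 4 * W ^ 124 := by
    have hpt : ∀ x ∈ Set.Icc 1 (W ^ 56), f x ^ 2 ≤ 3 * voronoiPart b P₃ x ^ 2 +
        3 * 1100 ^ 2 * G ^ 4 * W ^ 56 + 3 * voronoiErr Z x ^ 2 := fun x hx => by
      have h := abs_R_sub_sum_coefTrunc_le hZ hx.1 (hx.2.trans_lt hXZ)
      rw [coefTrunc_sum_eq Z hMN hNZ] at h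
      have h1 : (1100 * (1 + Real.log Z) ^ 2 * √x) ^ 2 ≤ 1100 ^ 2 * G ^ 4 * W ^ 56 := by
        rw [mul_pow, mul_pow, Real.sq_sqrt (by linarith [hx.1]), ← pow_mul]
        have h0 := hx.2
        have h00 := hx.1
        gcongr
      have h2 : |f x| ≤ |voronoiPart b P₃ x| + 1100 * (1 + Real.log Z) ^ 2 * √x + voronoiErr Z x := by
        have e : f x = (R (2 * π * x) - (voronoiPart b P₁ x + voronoiPart b P₂ x +
            voronoiPart b P₃ x)) + voronoiPart b P₃ x := by rw [hf]; ring
        rw [e]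
        refine (abs_add_le _ _).trans ?_
        linarith
      calc f x ^ 2 = |f x| ^ 2 := (sq_abs _).symm
        _ ≤ (|voronoiPart b P₃ x| + 1100 * (1 + Real.log Z) ^ 2 * √x + voronoiErr Z x) ^ 2 := by
          gcongr
        _ ≤ 3 * |voronoiPart b P₃ x| ^ 2 + 3 * (1100 * (1 + Real.log Z) ^ 2 * √x) ^ 2 +
            3 * voronoiErr Z x ^ 2 := by
          generalize 1100 * (1 + Real.log Z) ^ 2 * √x = v
          generalize |voronoiPart b P₃ x| = u
          generalize voronoiErr Z x = w
          nlinarith [sq_nonneg (u - v), sq_nonneg (v - w), sq_nonneg (u - w)]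
        _ ≤ _ := by rw [sq_abs]; linarith
    have i3 : IntervalIntegrable (fun x => 3 * voronoiPart b P₃ x ^ 2) volume 1 (W ^ 56) :=
      (continuousOn_const.mul (cC.pow 2)).intervalIntegrable
    have i4 : IntervalIntegrable (fun _ : ℝ => 3 * 1100 ^ 2 * G ^ 4 * W ^ 56) volume 1 (W ^ 56) :=
      intervalIntegrable_const
    have hE := integral_voronoiErr_sq_le hZ hX hXZ.le
    have hE2 : 1000 * (1 + Real.log Z) ^ 2 ≤ 1000 * G ^ 4 * W ^ 124 := by
      calc _ ≤ 1000 * G ^ 2 * 1 := by rw [mul_one]; gcongr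
        _ ≤ _ := by
          refine mul_le_mul (mul_le_mul_of_nonneg_left (pow_le_pow_right₀ hG (by norm_num)) (by norm_num))
            (one_le_pow₀ hW) zero_le_one (by positivity)
    have h5 : (W ^ 56 - 1) * (3 * 1100 ^ 2 * G ^ 4 * W ^ 56) ≤ 3 * 1100 ^ 2 * G ^ 4 * W ^ 124 := by
      calc _ ≤ W ^ 56 * (3 * 1100 ^ 2 * G ^ 4 * W ^ 56) := by gcongr; linarith
        _ = 3 * 1100 ^ 2 * G ^ 4 * W ^ 112 := by ring
        _ ≤ _ := mul_le_mul_of_nonneg_left (pow_le_pow_right₀ hW (by norm_num)) (by positivity)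
    calc _ ≤ ∫ x in (1 : ℝ)..W ^ 56, (3 * voronoiPart b P₃ x ^ 2 +
          3 * 1100 ^ 2 * G ^ 4 * W ^ 56 + 3 * voronoiErr Z x ^ 2) :=
          intervalIntegral.integral_mono_on hX if2 ((i3.add i4).add (iE.const_mul 3)) hpt
      _ = 3 * (∫ x in (1 : ℝ)..W ^ 56, voronoiPart b P₃ x ^ 2) +
          (W ^ 56 - 1) * (3 * 1100 ^ 2 * G ^ 4 * W ^ 56) +
          3 * ∫ x in (1 : ℝ)..W ^ 56, voronoiErr Z x ^ 2 := by
        rw [intervalIntegral.integral_add (i3.add i4) (iE.const_mul 3),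
          intervalIntegral.integral_add i3 i4, intervalIntegral.integral_const, smul_eq_mul,
          intervalIntegral.integral_const_mul, intervalIntegral.integral_const_mul]
      _ ≤ 3 * ((2 + 8) * G ^ 4 * W ^ (2 * 62)) + 3 * 1100 ^ 2 * G ^ 4 * W ^ 124 +
          3 * (1000 * G ^ 4 * W ^ 124) := by
        gcongr
        exact hE.trans hE2
      _ ≤ _ := by
        norm_num
        have : 0 ≤ G ^ 4 * W ^ 124 := by positivity
        linarith
  have key := abs_integral_cube_sub_le (ρ := fun x => R (2 * π * x)) (f := f) hX
    (inv_pos.2 (pow_pos hW0 8)) (fun x _ => by rw [hf]; ring) aα aβ aγ cA cB if2 (iRb 3) a2 b2 f2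
  refine key.trans ?_
  have e : 3 / 2 * (4 * G * W ^ 47) * (W ^ 8)⁻¹ * ((3 + 8) * G ^ 4 * W ^ (2 * 70)) =
      66 * G ^ 5 * W ^ 179 := by
    rw [show W ^ 47 = W ^ 39 * W ^ 8 by ring]; field_simp; ring
  have e2 : 3 / 2 * (4 * G * W ^ 47) / (W ^ 8)⁻¹ = 6 * G * W ^ 55 := by
    rw [div_inv_eq_mul]; ring
  rw [e, e2]
  have w1 : G ^ 5 * W ^ 179 ≤ G ^ 5 * W ^ 180 :=
    mul_le_mul_of_nonneg_left (pow_le_pow_right₀ hW (by norm_num)) (by positivity)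
  have w2 : 6 * (4 * G * W ^ 47) + 4 * (8 * G * W ^ 50) ≤ 56 * G * W ^ 50 := by
    have : G * W ^ 47 ≤ G * W ^ 50 :=
      mul_le_mul_of_nonneg_left (pow_le_pow_right₀ hW (by norm_num)) hG0.le
    linarith
  have w3 : 6 * G * W ^ 55 + 6 * (4 * G * W ^ 47) + 4 * (46 * G * W ^ 56) ≤ 214 * G * W ^ 56 := by
    have h1 : G * W ^ 47 ≤ G * W ^ 56 :=
      mul_le_mul_of_nonneg_left (pow_le_pow_right₀ hW (by norm_num)) hG0.le
    have h2 : G * W ^ 55 ≤ G * W ^ 56 :=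
      mul_le_mul_of_nonneg_left (pow_le_pow_right₀ hW (by norm_num)) hG0.le
    linarith
  calc _ ≤ 66 * G ^ 5 * W ^ 179 + 56 * G * W ^ 50 * ((4 + 8) * G ^ 4 * W ^ (2 * 65)) +
        214 * G * W ^ 56 * (4000000 * G ^ 4 * W ^ 124) := by gcongr
    _ = 66 * (G ^ 5 * W ^ 179) + 672 * (G ^ 5 * W ^ 180) + 856000000 * (G ^ 5 * W ^ 180) := by ring
    _ ≤ _ := by
      have : 0 ≤ G ^ 5 * W ^ 180 := by positivity
      linarith

theorem integral_voronoiPart_cubic (b : ℕ → ℝ) {X : ℝ} {M N : ℕ} (hX : 1 ≤ X) (hMN : M ≤ N) :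
    ∫ x in (1 : ℝ)..X, (voronoiPart b (Finset.Icc 1 M) x ^ 3 +
        3 * (voronoiPart b (Finset.Icc 1 M) x ^ 2 * voronoiPart b (Finset.Ioc M N) x)) =
      (2 / π) ^ 3 * ∫ x in (1 : ℝ)..X, x ^ (9 / 4 : ℝ) *
        (3 * (sinSum b (Finset.Icc 1 M) x ^ 2 * sinSum b (Finset.Icc 1 N) x) -
          2 * sinSum b (Finset.Icc 1 M) x ^ 3) := by
  rw [← intervalIntegral.integral_const_mul]
  refine intervalIntegral.integral_congr fun x hx => ?_
  rw [Set.uIcc_of_le hX] at hx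
  have h : x ^ (9 / 4 : ℝ) = (x ^ (3 / 4 : ℝ)) ^ 3 := by
    rw [← Real.rpow_natCast, ← Real.rpow_mul (by linarith [hx.1])]; norm_num
  rw [voronoiPart, voronoiPart, sinSum_Ioc b hMN, h]
  ring

theorem abs_integral_main_sub_le {W B G C D : ℝ} {M N Z : ℕ} (hW : 1 ≤ W) (hM1 : 1 ≤ M)
    (hMl : W ^ 20 / 4 ≤ M) (hMu : (M : ℝ) ≤ W ^ 20) (hNu : (N : ℝ) ≤ 4 * W ^ 32)
    (hMN : 4 * M ≤ N) (hNZ : N < Z ^ 2)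
    (hb : ∀ n ∈ Finset.Icc 1 N, |coefTrunc Z n| ≤ B * (n : ℝ) ^ (-(3 / 4) : ℝ))
    (hB : 0 ≤ B) (hBG : B ≤ G) (hG : 1 ≤ G) (hC : 0 ≤ C) (hD0 : 0 ≤ D)
    (hD : |(∑ m ∈ Finset.Icc 1 M, ∑ n ∈ Finset.Icc 1 M, resonance m n) - D| ≤
      C * (M : ℝ) ^ (-(1 / 8) : ℝ)) :
    |(∫ x in (1 : ℝ)..W ^ 56,
      (voronoiPart (coefTrunc Z) (Finset.Icc 1 M) x ^ 3 +
        3 * (voronoiPart (coefTrunc Z) (Finset.Icc 1 M) x ^ 2 *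
          voronoiPart (coefTrunc Z) (Finset.Ioc M N) x))) -
      (2 / π) ^ 3 * (3 / 13 * Real.sin (π / 4) * D) * W ^ 182| ≤
      (28000 + 2 * C + D) * G ^ 5 * W ^ 180 := by
  have hX : 1 ≤ W ^ 56 := one_le_pow₀ hW
  have hW0 : 0 < W := by linarith
  have hpi := Real.pi_pos
  have hG0 : 0 < G := by linarith
  have hU : (2 / π) ^ 3 ≤ 1 := pow_le_one₀ (by positivity) two_div_pi_le_one
  have hs0 : 0 ≤ Real.sin (π / 4) := by rw [Real.sin_pi_div_four]; positivity
  have hs1 : Real.sin (π / 4) ≤ 1 := Real.sin_le_one _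
  have hMpow : (M : ℝ) ^ (5 / 4 : ℝ) ≤ W ^ 25 := by
    refine (Real.rpow_le_rpow (by positivity) hMu (by norm_num)).trans (le_of_eq ?_)
    exact pow_rpow_eq_pow hW0.le (by norm_num)
  have hMpow2 : (M : ℝ) ^ (1 / 2 : ℝ) ≤ W ^ 10 := by
    refine (Real.rpow_le_rpow (by positivity) hMu (by norm_num)).trans (le_of_eq ?_)
    exact pow_rpow_eq_pow hW0.le (by norm_num)
  have hNpow : (N : ℝ) ^ (1 / 4 : ℝ) ≤ 2 * W ^ 8 := by
    refine (Real.rpow_le_rpow (by positivity)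
      (hNu.trans (by gcongr; norm_num : 4 * W ^ 32 ≤ 2 ^ 4 * W ^ 32)) (by norm_num)).trans
      (le_of_eq ?_)
    rw [Real.mul_rpow (by norm_num) (by positivity),
      pow_rpow_eq_pow (by norm_num) (by norm_num : ((4 : ℕ) : ℝ) * (1 / 4) = (1 : ℕ)),
      pow_rpow_eq_pow hW0.le (by norm_num : ((32 : ℕ) : ℝ) * (1 / 4) = (8 : ℕ)), pow_one]
  have hMtail : W ^ 182 * (M : ℝ) ^ (-(1 / 8) : ℝ) ≤ 2 * W ^ 180 := by
    have h1 : W ^ 16 / 2 ^ 8 ≤ (M : ℝ) := by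
      refine le_trans ?_ hMl
      have : W ^ 16 ≤ W ^ 20 := pow_le_pow_right₀ hW (by norm_num)
      have : 0 ≤ W ^ 16 := by positivity
      linarith
    have h2 : (M : ℝ) ^ (-(1 / 8) : ℝ) ≤ 2 * (W ^ 2)⁻¹ := by
      refine (Real.rpow_le_rpow_of_nonpos (by positivity) h1 (by norm_num)).trans (le_of_eq ?_)
      rw [Real.rpow_neg (by positivity), Real.div_rpow (by positivity) (by norm_num),
        pow_rpow_eq_pow hW0.le (by norm_num : ((16 : ℕ) : ℝ) * (1 / 8) = (2 : ℕ)),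
        pow_rpow_eq_pow (by norm_num) (by norm_num : ((8 : ℕ) : ℝ) * (1 / 8) = (1 : ℕ)), pow_one,
        inv_div, div_eq_mul_inv]
    refine (mul_le_mul_of_nonneg_left h2 (pow_nonneg hW0.le _)).trans (le_of_eq ?_)
    rw [show W ^ 182 = W ^ 180 * W ^ 2 by ring]
    field_simp
  have key := abs_integral_cubic_sub_le hX hM1 hMN hb hB fun n hn =>
    coefTrunc_eq_coef ((Finset.mem_Icc.1 hn).2.trans_lt hNZ)
  rw [integral_voronoiPart_cubic _ hX (by omega)]
  have e1 : (W ^ 56) ^ (11 / 4 : ℝ) = W ^ 154 := pow_rpow_eq_pow hW0.le (by norm_num)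
  have e2 : (W ^ 56) ^ (9 / 4 + 1 : ℝ) = W ^ 182 := pow_rpow_eq_pow hW0.le (by norm_num)
  have k1 : B ^ 3 * (W ^ 56) ^ (11 / 4 : ℝ) *
        (768 * (M : ℝ) ^ (1 / 2 : ℝ) * (N : ℝ) ^ (1 / 4 : ℝ) + 26000 * (M : ℝ) ^ (5 / 4 : ℝ)) ≤
      28000 * G ^ 5 * W ^ 180 := by
    rw [e1]
    have g1 : B ^ 3 ≤ G ^ 5 :=
      (pow_le_pow_left₀ hB hBG 3).trans (pow_le_pow_right₀ hG (by norm_num))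
    have g2 : 768 * (M : ℝ) ^ (1 / 2 : ℝ) * (N : ℝ) ^ (1 / 4 : ℝ) + 26000 * (M : ℝ) ^ (5 / 4 : ℝ) ≤
        28000 * W ^ 26 := by
      have g3 : (M : ℝ) ^ (1 / 2 : ℝ) * (N : ℝ) ^ (1 / 4 : ℝ) ≤ W ^ 10 * (2 * W ^ 8) := by gcongr
      have g4 : W ^ 18 ≤ W ^ 26 := pow_le_pow_right₀ hW (by norm_num)
      have g5 : W ^ 25 ≤ W ^ 26 := pow_le_pow_right₀ hW (by norm_num)
      have g6 : W ^ 10 * (2 * W ^ 8) = 2 * W ^ 18 := by ring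
      have g7 : 0 ≤ W ^ 26 := pow_nonneg hW0.le _
      rw [mul_assoc]
      linarith
    calc _ ≤ G ^ 5 * W ^ 154 * (28000 * W ^ 26) :=
          mul_le_mul (mul_le_mul_of_nonneg_right g1 (pow_nonneg hW0.le _)) g2 (by positivity)
            (mul_nonneg (by positivity) (pow_nonneg hW0.le _))
      _ = _ := by ring
  have key2 := key.trans k1
  generalize (∫ x in (1 : ℝ)..W ^ 56, x ^ (9 / 4 : ℝ) *
        (3 * (sinSum (coefTrunc Z) (Finset.Icc 1 M) x ^ 2 * sinSum (coefTrunc Z) (Finset.Icc 1 N) x) -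
          2 * sinSum (coefTrunc Z) (Finset.Icc 1 M) x ^ 3)) = J at key2 ⊢
  generalize ∑ m ∈ Finset.Icc 1 M, ∑ n ∈ Finset.Icc 1 M, resonance m n = S at key2 hD
  have e3 : resWeight (W ^ 56) = 4 / 13 * Real.sin (π / 4) * (W ^ 182 - 1) := by
    rw [resWeight, e2]; ring
  have w1 : 1 ≤ W ^ 182 := one_le_pow₀ hW
  have w2 : 1 ≤ G ^ 5 * W ^ 180 := by
    have := mul_le_mul (one_le_pow₀ hG : 1 ≤ G ^ 5) (one_le_pow₀ hW : 1 ≤ W ^ 180) zero_le_one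
      (by positivity)
    linarith
  have w3 : W ^ 180 ≤ G ^ 5 * W ^ 180 :=
    le_mul_of_one_le_left (by positivity) (one_le_pow₀ hG)
  have k2 : |3 / 4 * resWeight (W ^ 56) * S - 3 / 13 * Real.sin (π / 4) * D * W ^ 182| ≤
      (2 * C + D) * (G ^ 5 * W ^ 180) := by
    have e4 : 3 / 4 * resWeight (W ^ 56) * S - 3 / 13 * Real.sin (π / 4) * D * W ^ 182 =
        3 / 13 * Real.sin (π / 4) * ((W ^ 182 - 1) * (S - D) - D) := by rw [e3]; ring
    have h1 : |(W ^ 182 - 1) * (S - D) - D| ≤ C * (2 * W ^ 180) + D := by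
      refine (abs_sub _ _).trans ?_
      rw [abs_mul, abs_of_nonneg hD0, abs_of_nonneg (by linarith : 0 ≤ W ^ 182 - 1)]
      have : (W ^ 182 - 1) * |S - D| ≤ W ^ 182 * (C * (M : ℝ) ^ (-(1 / 8) : ℝ)) :=
        mul_le_mul (by linarith) hD (abs_nonneg _) (by positivity)
      have h3 : C * (W ^ 182 * (M : ℝ) ^ (-(1 / 8) : ℝ)) ≤ C * (2 * W ^ 180) :=
        mul_le_mul_of_nonneg_left hMtail hC
      linarith
    rw [e4, abs_mul, abs_of_nonneg (by positivity)]
    calc _ ≤ 1 * (C * (2 * W ^ 180) + D) := by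
          gcongr
          linarith
      _ ≤ 1 * (C * (2 * (G ^ 5 * W ^ 180)) + D * (G ^ 5 * W ^ 180)) := by
          gcongr
          exact le_mul_of_one_le_right hD0 w2
      _ = _ := by ring
  have e5 : (2 / π) ^ 3 * J - (2 / π) ^ 3 * (3 / 13 * Real.sin (π / 4) * D) * W ^ 182 =
      (2 / π) ^ 3 * ((J - 3 / 4 * resWeight (W ^ 56) * S) +
        (3 / 4 * resWeight (W ^ 56) * S - 3 / 13 * Real.sin (π / 4) * D * W ^ 182)) := by ring
  rw [e5, abs_mul, abs_of_nonneg (by positivity : 0 ≤ (2 / π) ^ 3)]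
  calc _ ≤ 1 * (28000 * G ^ 5 * W ^ 180 + (2 * C + D) * (G ^ 5 * W ^ 180)) := by
        refine mul_le_mul hU ((abs_add_le _ _).trans (add_le_add key2 k2)) (abs_nonneg _) zero_le_one
    _ = _ := by ring

theorem exists_lattice_cutoffs {W : ℝ} (hW : 1 ≤ W) : ∃ M N Z : ℕ, 1 ≤ M ∧ W ^ 20 / 4 ≤ M ∧
    (M : ℝ) ≤ W ^ 20 ∧ W ^ 32 ≤ N ∧ (N : ℝ) ≤ 4 * W ^ 32 ∧ 4 * M ≤ N ∧ 2 ≤ Z ∧ N < Z ^ 2 ∧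
    W ^ 56 < (Z : ℝ) ^ 2 ∧ (Z : ℝ) ≤ 4 * W ^ 28 := by
  have h20 : 1 ≤ W ^ 20 := one_le_pow₀ hW
  have h32 : W ^ 20 ≤ W ^ 32 := pow_le_pow_right₀ hW (by norm_num)
  have h28 : 1 ≤ W ^ 28 := one_le_pow₀ hW
  have h56 : W ^ 32 ≤ W ^ 56 := pow_le_pow_right₀ hW (by norm_num)
  have hM : (⌊W ^ 20⌋₊ : ℝ) ≤ W ^ 20 := Nat.floor_le (by linarith)
  have hM' : W ^ 20 < ⌊W ^ 20⌋₊ + 1 := Nat.lt_floor_add_one _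
  have hM1 : 1 ≤ ⌊W ^ 20⌋₊ := Nat.le_floor (by simpa using h20)
  have hM1' : (1 : ℝ) ≤ ⌊W ^ 20⌋₊ := by exact_mod_cast hM1
  have hN : (⌊4 * W ^ 32⌋₊ : ℝ) ≤ 4 * W ^ 32 := Nat.floor_le (by linarith)
  have hN' : 4 * W ^ 32 < ⌊4 * W ^ 32⌋₊ + 1 := Nat.lt_floor_add_one _
  have hZ : 2 * W ^ 28 ≤ ⌈2 * W ^ 28⌉₊ := Nat.le_ceil _
  have hZ' : (⌈2 * W ^ 28⌉₊ : ℝ) < 2 * W ^ 28 + 1 := Nat.ceil_lt_add_one (by linarith)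
  have hsq : 4 * W ^ 56 < ((⌈2 * W ^ 28⌉₊ + 1 : ℕ) : ℝ) ^ 2 := by
    push_cast
    calc 4 * W ^ 56 = (2 * W ^ 28) ^ 2 := by ring
      _ < _ := pow_lt_pow_left₀ (by linarith) (by linarith) (by norm_num)
  refine ⟨⌊W ^ 20⌋₊, ⌊4 * W ^ 32⌋₊, ⌈2 * W ^ 28⌉₊ + 1, hM1, by linarith, hM, by linarith, hN,
    Nat.le_floor ?_, ?_, ?_, by linarith, ?_⟩
  · push_cast; linarith
  · have : 1 ≤ ⌈2 * W ^ 28⌉₊ := Nat.one_le_ceil_iff.2 (by linarith)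
    omega
  · have : (⌊4 * W ^ 32⌋₊ : ℝ) < ((⌈2 * W ^ 28⌉₊ + 1 : ℕ) : ℝ) ^ 2 := by linarith
    exact_mod_cast this
  · push_cast; linarith

theorem exists_coefTrunc_bound {ε : ℝ} (hε : 0 < ε) : ∃ K : ℝ, 0 < K ∧ ∀ Z : ℕ, 2 ≤ Z → ∀ W : ℝ,
    1 ≤ W → (Z : ℝ) ≤ 4 * W ^ 28 → ∃ B G : ℝ, 0 ≤ B ∧ B ≤ G ∧ 1 ≤ G ∧
      1 + Real.log ((Z ^ 14 : ℕ) : ℝ) ≤ G ∧ G ≤ K * W ^ (392 * ε) ∧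
      ∀ n ∈ Finset.Icc 1 (Z ^ 14), |coefTrunc Z n| ≤ B * (n : ℝ) ^ (-(3 / 4) : ℝ) := by
  obtain ⟨C, hC, h⟩ := exists_card_divisors_le hε
  refine ⟨(C + 1 + 1 / ε) * (4 ^ 14) ^ ε, by positivity, fun Z hZ W hW hZW => ?_⟩
  have hZ1 : (1 : ℝ) ≤ ((Z ^ 14 : ℕ) : ℝ) := by
    exact_mod_cast Nat.one_le_pow _ _ (by omega)
  have hp : 1 ≤ ((Z ^ 14 : ℕ) : ℝ) ^ ε := Real.one_le_rpow hZ1 hε.le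
  have hlog : Real.log ((Z ^ 14 : ℕ) : ℝ) ≤ ((Z ^ 14 : ℕ) : ℝ) ^ ε / ε :=
    Real.log_le_rpow_div (by linarith) hε
  have hpow : ((Z ^ 14 : ℕ) : ℝ) ^ ε ≤ (4 ^ 14) ^ ε * W ^ (392 * ε) := by
    have e : (W ^ 392) ^ ε = W ^ (392 * ε) := by
      rw [← Real.rpow_natCast, ← Real.rpow_mul (by linarith)]; norm_num
    rw [← e, ← Real.mul_rpow (by positivity) (pow_nonneg (by linarith) _)]
    refine Real.rpow_le_rpow (by linarith) ?_ hε.le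
    push_cast
    calc (Z : ℝ) ^ 14 ≤ (4 * W ^ 28) ^ 14 := by gcongr
      _ = _ := by ring
  refine ⟨C * ((Z ^ 14 : ℕ) : ℝ) ^ ε, (C + 1 + 1 / ε) * ((Z ^ 14 : ℕ) : ℝ) ^ ε, by positivity, ?_, ?_,
    ?_, ?_, fun n hn => ?_⟩
  · gcongr
    have : 0 < 1 / ε := by positivity
    linarith
  · have : 0 < 1 / ε := by positivity
    nlinarith
  · have : (C + 1 + 1 / ε) * ((Z ^ 14 : ℕ) : ℝ) ^ ε = C * ((Z ^ 14 : ℕ) : ℝ) ^ ε +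
      ((Z ^ 14 : ℕ) : ℝ) ^ ε + ((Z ^ 14 : ℕ) : ℝ) ^ ε / ε := by ring
    rw [this]
    have : 0 ≤ C * ((Z ^ 14 : ℕ) : ℝ) ^ ε := by positivity
    linarith
  · rw [mul_assoc]
    exact mul_le_mul_of_nonneg_left hpow (by positivity)
  · obtain ⟨h1, h2⟩ := Finset.mem_Icc.1 hn
    refine (abs_coefTrunc_le (by omega) h1).trans ?_
    refine mul_le_mul_of_nonneg_right ((h n h1).trans ?_) (by positivity)
    refine mul_le_mul_of_nonneg_left ?_ hC.le
    exact Real.rpow_le_rpow (by positivity) (by exact_mod_cast h2) hε.le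

theorem exists_third_moment_rescaled : ∃ d : ℝ, 0 < d ∧ ∀ δ : ℝ, 0 < δ → ∃ C : ℝ, 0 < C ∧
    ∀ X : ℝ, 1 ≤ X → |(∫ x in (1 : ℝ)..X, R (2 * π * x) ^ 3) - d * X ^ (13 / 4 : ℝ)| ≤
      C * X ^ (45 / 14 + δ) := by
  have hpi := Real.pi_pos
  obtain ⟨D, hD, C₀, hC₀, hres⟩ := exists_resonance_sum
  refine ⟨(2 / π) ^ 3 * (3 / 13 * Real.sin (π / 4) * D), ?_, fun δ hδ => ?_⟩
  · rw [Real.sin_pi_div_four]; positivity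
  obtain ⟨K, hK, hbound⟩ := exists_coefTrunc_bound (ε := δ / 35) (by positivity)
  refine ⟨(10 ^ 9 + (28000 + 2 * C₀ + D)) * K ^ 5, by positivity, fun X hX => ?_⟩
  obtain ⟨W, hW, rfl⟩ : ∃ W : ℝ, 1 ≤ W ∧ W ^ 56 = X := by
    refine ⟨X ^ (1 / 56 : ℝ), Real.one_le_rpow hX (by norm_num), ?_⟩
    rw [← Real.rpow_natCast, ← Real.rpow_mul (by linarith)]
    norm_num
  have hW0 : 0 < W := by linarith
  obtain ⟨M, N, Z, hM1, hMl, hMu, hNl, hNu, hMN, hZ, hNZ, hXZ, hZW⟩ := exists_lattice_cutoffs hW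
  obtain ⟨B, G, hB, hBG, hG, hlog, hGK, hb⟩ := hbound Z hZ W hW hZW
  have hNZ' : N ≤ Z ^ 14 := hNZ.le.trans (Nat.pow_le_pow_right (by omega) (by norm_num))
  have h1 := abs_integral_R_cube_sub_le hW hM1 hMl hMu hNl hNu (by omega) hZ hNZ' hXZ hb hB hBG hG hlog
  have h2 := abs_integral_main_sub_le hW hM1 hMl hMu hNu hMN hNZ
    (fun n hn => hb n (Finset.Icc_subset_Icc_right hNZ' hn)) hB hBG hG hC₀.le hD.le (hres M hM1)
  rw [pow_rpow_eq_pow hW0.le (by norm_num : ((56 : ℕ) : ℝ) * (13 / 4) = (182 : ℕ))]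
  have hG5 : G ^ 5 ≤ K ^ 5 * W ^ (56 * δ) := by
    calc G ^ 5 ≤ (K * W ^ (392 * (δ / 35))) ^ 5 := by gcongr
      _ = _ := by
        rw [mul_pow, ← Real.rpow_natCast (W ^ _), ← Real.rpow_mul hW0.le]
        congr 2
        push_cast; ring
  have e : (W ^ 56) ^ (45 / 14 + δ) = W ^ (56 * δ) * W ^ 180 := by
    rw [← Real.rpow_natCast, ← Real.rpow_mul hW0.le, ← Real.rpow_natCast, ← Real.rpow_add hW0]
    congr 1
    push_cast; ring
  rw [e]
  refine (abs_sub_le _ _ _).trans ((add_le_add h1 h2).trans ?_)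
  calc _ = (10 ^ 9 + (28000 + 2 * C₀ + D)) * (G ^ 5 * W ^ 180) := by ring
    _ ≤ (10 ^ 9 + (28000 + 2 * C₀ + D)) * (K ^ 5 * W ^ (56 * δ) * W ^ 180) := by gcongr
    _ = _ := by ring

theorem intervalIntegrable_R_cube (a b : ℝ) : IntervalIntegrable (fun t => R t ^ 3) volume a b := by
  rw [intervalIntegrable_iff]
  have hmono : Monotone fun t => NT t + NH t := monotone_NT.add monotone_NH
  set S := |NT (min a b) + NH (min a b)| + |NT (max a b) + NH (max a b)|
  obtain ⟨c, hc⟩ : ∃ c, ∀ t ∈ Set.uIcc a b,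
      |(Real.sqrt (2 * π) / (6 * π ^ 2)) * t ^ ((3 : ℝ) / 2)| ≤ c := by
    have hcont : ContinuousOn (fun t : ℝ => (Real.sqrt (2 * π) / (6 * π ^ 2)) * t ^ ((3 : ℝ) / 2))
        (Set.uIcc a b) := by
      apply Continuous.continuousOn
      exact continuous_const.mul (Real.continuous_rpow_const (by norm_num))
    obtain ⟨c, hc⟩ := isCompact_uIcc.exists_bound_of_continuousOn hcont
    exact ⟨c, fun t ht => hc t ht⟩
  refine Measure.integrableOn_of_bounded (M := (S + c) ^ 3) ?_
    (measurable_R.pow_const 3).aestronglyMeasurable ?_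
  · simp [Set.uIoc]
  · refine (ae_restrict_iff' measurableSet_uIoc).2 (Filter.Eventually.of_forall fun t ht => ?_)
    have ht' := Set.uIoc_subset_uIcc ht
    rw [Real.norm_eq_abs, abs_pow]
    refine pow_le_pow_left₀ (abs_nonneg _) ?_ 3
    rw [R]
    refine (abs_sub _ _).trans (add_le_add ?_ (hc t ht'))
    have l1 := hmono ht'.1
    have l2 := hmono ht'.2
    beta_reduce at l1 l2
    rw [abs_le]
    have p1 := neg_abs_le (NT (min a b) + NH (min a b))
    have p2 := le_abs_self (NT (max a b) + NH (max a b))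
    have p3 := abs_nonneg (NT (min a b) + NH (min a b))
    have p4 := abs_nonneg (NT (max a b) + NH (max a b))
    exact ⟨by linarith, by linarith⟩

end HeisenbergWeyl

/-- Third moment of the Weyl remainder:
`∫₁^T R(t)³ dt = d₃ T^{13/4} + O_δ(T^{45/14+δ})` with `d₃ > 0`. -/
theorem third_moment_weyl_remainder_heisenberg :
    ∃ d₃ : ℝ, 0 < d₃ ∧ ∀ δ : ℝ, 0 < δ → ∃ C : ℝ, 0 < C ∧ ∀ T : ℝ, 2 ≤ T →
      |(∫ t in (1:ℝ)..T, R t ^ 3) - d₃ * T ^ ((13 : ℝ) / 4)| ≤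
        C * T ^ ((45 : ℝ) / 14 + δ) := by
  have hpi := Real.pi_gt_three
  have hpi0 := Real.pi_pos
  obtain ⟨d, hd, h⟩ := HeisenbergWeyl.exists_third_moment_rescaled
  refine ⟨2 * π * d / (2 * π) ^ (13 / 4 : ℝ), by positivity, fun δ hδ => ?_⟩
  obtain ⟨C, hC, hX⟩ := h δ hδ
  set d₃ := 2 * π * d / (2 * π) ^ (13 / 4 : ℝ) with hd₃
  have hd₃0 : 0 < d₃ := by positivity
  set J := ∫ t in (1 : ℝ)..(2 * π), |R t ^ 3| with hJ
  have hii := HeisenbergWeyl.intervalIntegrable_R_cube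
  have hJ0 : 0 ≤ J := intervalIntegral.integral_nonneg (by linarith) fun _ _ => abs_nonneg _
  refine ⟨J + 2 * π * C + d₃ * (2 * π) ^ (13 / 4 : ℝ), by positivity, fun T hT => ?_⟩
  have hpow1 : 1 ≤ T ^ (45 / 14 + δ) := Real.one_le_rpow (by linarith) (by positivity)
  rcases le_total T (2 * π) with hT2 | hT2
  · have h1 : |∫ t in (1 : ℝ)..T, R t ^ 3| ≤ J := by
      refine (intervalIntegral.abs_integral_le_integral_abs (by linarith)).trans ?_
      rw [hJ, ← intervalIntegral.integral_add_adjacent_intervals (hii 1 T).abs (hii T (2 * π)).abs]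
      exact le_add_of_nonneg_right (intervalIntegral.integral_nonneg hT2 fun _ _ => abs_nonneg _)
    have h2 : d₃ * T ^ (13 / 4 : ℝ) ≤ d₃ * (2 * π) ^ (13 / 4 : ℝ) := by gcongr
    refine (abs_sub _ _).trans ?_
    rw [abs_of_nonneg (by positivity : 0 ≤ d₃ * T ^ (13 / 4 : ℝ))]
    calc _ ≤ (J + 2 * π * C + d₃ * (2 * π) ^ (13 / 4 : ℝ)) * 1 := by
          have : 0 ≤ 2 * π * C := by positivity
          linarith
      _ ≤ _ := mul_le_mul_of_nonneg_left hpow1 (by positivity)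
  · have hX1 : 1 ≤ T / (2 * π) := by rw [one_le_div (by positivity)]; exact hT2
    have key := hX _ hX1
    have hsub : ∫ t in (2 * π)..T, R t ^ 3 = 2 * π * ∫ x in (1 : ℝ)..(T / (2 * π)), R (2 * π * x) ^ 3 := by
      rw [intervalIntegral.mul_integral_comp_mul_left (f := fun t => R t ^ 3), mul_one,
        mul_div_cancel₀ _ (by positivity)]
    have e : (∫ t in (1 : ℝ)..T, R t ^ 3) - d₃ * T ^ (13 / 4 : ℝ) =
        (∫ t in (1 : ℝ)..(2 * π), R t ^ 3) + 2 * π * ((∫ x in (1 : ℝ)..(T / (2 * π)),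
          R (2 * π * x) ^ 3) - d * (T / (2 * π)) ^ (13 / 4 : ℝ)) := by
      rw [← intervalIntegral.integral_add_adjacent_intervals (hii 1 (2 * π)) (hii (2 * π) T), hsub,
        Real.div_rpow (by linarith) (by positivity), hd₃]
      ring
    have h1 : |∫ t in (1 : ℝ)..(2 * π), R t ^ 3| ≤ J :=
      intervalIntegral.abs_integral_le_integral_abs (by linarith)
    have h2 : (T / (2 * π)) ^ (45 / 14 + δ) ≤ T ^ (45 / 14 + δ) := by
      refine Real.rpow_le_rpow (by positivity) (div_le_self (by linarith) (by linarith)) (by positivity)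
    rw [e]
    refine (abs_add_le _ _).trans ?_
    rw [abs_mul, abs_of_nonneg (by positivity : 0 ≤ 2 * π)]
    calc _ ≤ J * T ^ (45 / 14 + δ) + 2 * π * (C * T ^ (45 / 14 + δ)) := by
          refine add_le_add (h1.trans (le_mul_of_one_le_right hJ0 hpow1)) ?_
          exact mul_le_mul_of_nonneg_left (key.trans (mul_le_mul_of_nonneg_left h2 hC.le)) (by positivity)
      _ ≤ (J + 2 * π * C + d₃ * (2 * π) ^ (13 / 4 : ℝ)) * T ^ (45 / 14 + δ) := by
          have : 0 ≤ d₃ * (2 * π) ^ (13 / 4 : ℝ) * T ^ (45 / 14 + δ) := by positivity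
          linarith
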